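/- (Upper Bound Theorem for the facets of simplicial balls.) Let d ≥ 1 and let K be a finite geometric simplicial complex in some real vector space ℝ^m, all of whose faces have at most d+1 vertices, such that the underlying space of K (the union of the convex hulls of its faces, with the subspace topology) is homeomorphic to the closed unit ball of ℝ^d. Let 𝔟 be the number of vertices of K. Call a face with exactly d vertices a boundary ridge if it is contained in exactly one face with d+1 vertices, and let 𝔟' be the number of vertices of K that lie in some boundary ridge. Then the number of faces of K with d+1 vertices is at most C(𝔟 − ⌈(d+1)/2⌉, ⌊(d+1)/2⌋) + C(𝔟 − 1 − ⌈d/2⌉, ⌊d/2⌋) − (𝔟' − d), where C(·,·) denotes binomial coefficients and the sum of the two binomials is the number of facets of the cyclic (d+1)-polytope with 𝔟 vertices. -/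

import Mathlib

set_option linter.unusedSectionVars false

namespace UBT

section Chains

variable {k : Type*} [Field k] [CharP k 2] {α β : Type*} [DecidableEq α] [DecidableEq β]

/-- The simplicial boundary map in characteristic two. -/
noncomputable def bd (k : Type*) [Field k] {α : Type*} [DecidableEq α] :
    (Finset α →₀ k) →ₗ[k] (Finset α →₀ k) :=
  Finsupp.linearCombination k fun σ => ∑ v ∈ σ, Finsupp.single (σ.erase v) 1

lemma bd_single (σ : Finset α) :
    bd k (Finsupp.single σ 1) = ∑ v ∈ σ, Finsupp.single (σ.erase v) (1 : k) := by
  simp [bd]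

lemma add_self_mod (x : α →₀ k) : x + x = 0 := by
  ext a; simp [CharTwo.add_self_eq_zero]

lemma sum_pairs_eq_zero (σ : Finset α) (f : α → α → (β →₀ k)) (hf : ∀ a b, f a b = f b a) :
    ∑ v ∈ σ, ∑ w ∈ σ.erase v, f v w = 0 := by
  induction σ using Finset.induction_on with
  | empty => simp
  | insert a s ha ih =>
    rw [Finset.sum_insert ha, Finset.erase_insert ha]
    have : ∀ v ∈ s, ∑ w ∈ (insert a s).erase v, f v w = f v a + ∑ w ∈ s.erase v, f v w := by
      intro v hv
      have hav : a ≠ v := by rintro rfl; exact ha hv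
      rw [Finset.erase_insert_of_ne hav, Finset.sum_insert (by simp [ha])]
    rw [Finset.sum_congr rfl this, Finset.sum_add_distrib, ih, add_zero]
    simp_rw [hf a]
    exact add_self_mod _

lemma bd_bd (z : Finset α →₀ k) : bd k (bd k z) = 0 := by
  have : (bd k).comp (bd k) = (0 : (Finset α →₀ k) →ₗ[k] (Finset α →₀ k)) := by
    ext1 σ
    ext1
    simp only [LinearMap.comp_apply, Finsupp.lsingle_apply, bd_single, map_sum,
      LinearMap.zero_apply]
    exact sum_pairs_eq_zero σ (fun a b => Finsupp.single ((σ.erase a).erase b) 1)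
      fun a b => by rw [Finset.erase_right_comm]
  exact LinearMap.congr_fun this z

/-- Chains supported on the faces of `L` with exactly `j` vertices. -/
def chains (k : Type*) [Field k] {α : Type*} (L : Set (Finset α)) (j : ℕ) :
    Submodule k (Finset α →₀ k) :=
  Finsupp.supported k k {σ | σ ∈ L ∧ σ.card = j}

lemma mem_chains {L : Set (Finset α)} {j : ℕ} {z : Finset α →₀ k} :
    z ∈ chains k L j ↔ ∀ σ, z σ ≠ 0 → σ ∈ L ∧ σ.card = j := by
  simp [chains, Finsupp.mem_supported, Set.subset_def]

lemma single_mem_chains {L : Set (Finset α)} {σ : Finset α} (c : k) (h : σ ∈ L) {j : ℕ}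
    (hj : σ.card = j) : Finsupp.single σ c ∈ chains k L j :=
  Finsupp.single_mem_supported k c ⟨h, hj⟩

lemma chains_mono {L L' : Set (Finset α)} (h : L ⊆ L') (j : ℕ) : chains k L j ≤ chains k L' j :=
  Finsupp.supported_mono fun _ hσ => ⟨h hσ.1, hσ.2⟩

/-- Linear maps are controlled on chains by their values on faces. -/
lemma map_mem_of_chains {M : Type*} [AddCommGroup M] [Module k M] (f : (Finset α →₀ k) →ₗ[k] M)
    {L : Set (Finset α)} {j : ℕ} (N : Submodule k M)
    (h : ∀ σ ∈ L, σ.card = j → f (Finsupp.single σ 1) ∈ N) {z : Finset α →₀ k}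
    (hz : z ∈ chains k L j) : f z ∈ N := by
  rw [← Finsupp.sum_single z, Finsupp.sum, map_sum]
  refine N.sum_mem fun σ hσ => ?_
  have := mem_chains.1 hz σ (Finsupp.mem_support_iff.1 hσ)
  rw [← mul_one (z σ), ← smul_eq_mul, ← Finsupp.smul_single, map_smul]
  exact N.smul_mem _ (h σ this.1 this.2)

lemma eq_of_chains {M : Type*} [AddCommGroup M] [Module k M] (f g : (Finset α →₀ k) →ₗ[k] M)
    {L : Set (Finset α)} {j : ℕ}
    (h : ∀ σ ∈ L, σ.card = j → f (Finsupp.single σ 1) = g (Finsupp.single σ 1))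
    {z : Finset α →₀ k} (hz : z ∈ chains k L j) : f z = g z := by
  have := map_mem_of_chains (f - g) ⊥ (fun σ h1 h2 => by simp [h σ h1 h2]) hz
  simpa [sub_eq_zero] using this

/-- Vanishing of reduced homology in the degree of faces with `j` vertices. -/
def AcyclicAt (k : Type*) [Field k] {α : Type*} [DecidableEq α] (L : Set (Finset α)) (j : ℕ) :
    Prop :=
  ∀ z ∈ chains k L j, bd k z = 0 → ∃ w ∈ chains k L (j + 1), bd k w = z

/-- Join with a vertex. -/
noncomputable def coneMap (k : Type*) [Field k] {α : Type*} [DecidableEq α] (v : α) :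
    (Finset α →₀ k) →ₗ[k] (Finset α →₀ k) :=
  Finsupp.linearCombination k fun σ => if v ∈ σ then 0 else Finsupp.single (insert v σ) 1

lemma coneMap_single (v : α) (σ : Finset α) : coneMap k v (Finsupp.single σ 1) =
    if v ∈ σ then 0 else Finsupp.single (insert v σ) 1 := by
  simp [coneMap]

lemma bd_coneMap (v : α) (z : Finset α →₀ k) :
    bd k (coneMap k v z) = z + coneMap k v (bd k z) := by
  have : (bd k).comp (coneMap k v) = LinearMap.id + (coneMap k v).comp (bd k) := by
    ext1 σ
    ext1
    simp only [LinearMap.comp_apply, Finsupp.lsingle_apply, bd_single, map_sum,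
      LinearMap.add_apply, LinearMap.id_apply, coneMap_single]
    by_cases h : v ∈ σ
    · rw [if_pos h, map_zero, ← Finset.add_sum_erase _ _ h]
      rw [Finset.sum_eq_zero]
      · simp [Finset.insert_erase h, add_self_mod]
      · intro w hw
        rw [if_pos]
        simp only [Finset.mem_erase] at hw ⊢
        exact ⟨hw.1.symm, h⟩
    · rw [if_neg h, bd_single, Finset.sum_insert h, Finset.erase_insert h]
      congr 1
      refine Finset.sum_congr rfl fun w hw => ?_
      have hvw : v ≠ w := by rintro rfl; exact h hw
      rw [if_neg (by simp [h]), Finset.erase_insert_of_ne hvw]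
  exact LinearMap.congr_fun this z

lemma coneMap_mem {L : Set (Finset α)} {v : α} (hL : ∀ σ ∈ L, insert v σ ∈ L) {j : ℕ}
    {z : Finset α →₀ k} (hz : z ∈ chains k L j) : coneMap k v z ∈ chains k L (j + 1) := by
  refine map_mem_of_chains _ _ (fun σ h1 h2 => ?_) hz
  rw [coneMap_single]
  split_ifs with h
  · exact Submodule.zero_mem _
  · exact single_mem_chains _ (hL σ h1) (by rw [Finset.card_insert_of_notMem h, h2])

lemma acyclicAt_of_cone {L : Set (Finset α)} {v : α} (hL : ∀ σ ∈ L, insert v σ ∈ L) (j : ℕ) :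
    AcyclicAt k L j := by
  intro z hz h0
  refine ⟨coneMap k v z, coneMap_mem hL hz, ?_⟩
  rw [bd_coneMap, h0, map_zero, add_zero]

lemma acyclicAt_powerset {X : Finset α} (hX : X.Nonempty) (j : ℕ) :
    AcyclicAt k {σ | σ ⊆ X} j := by
  obtain ⟨v, hv⟩ := hX
  refine acyclicAt_of_cone (v := v) (fun σ hσ => ?_) j
  exact Finset.insert_subset hv hσ

open Classical in
/-- The recursive choice of fillings behind the acyclic carrier lemma. -/
noncomputable def fillAux (Φ : Finset α → Set (Finset β)) (e : ℕ)
    (r : Finset α → (Finset β →₀ k)) (d0 : Finset β →₀ k) (σ : Finset α) : Finset β →₀ k :=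
  if σ = ∅ then d0 else
    if h : ∃ w ∈ chains k (Φ σ) (σ.card + e),
        bd k w = r σ + ∑ v : {x // x ∈ σ}, fillAux Φ e r d0 (σ.erase v) then h.choose else 0
  termination_by σ.card
  decreasing_by exact Finset.card_lt_card (Finset.erase_ssubset v.2)

/-- Acyclic carrier lemma. -/
lemma exists_carried (K : Set (Finset α)) (hK : IsLowerSet K) (Φ : Finset α → Set (Finset β))
    (hmono : ∀ σ τ, σ ⊆ τ → Φ σ ⊆ Φ τ)
    (hac : ∀ σ ∈ K, σ.Nonempty → ∀ j, AcyclicAt k (Φ σ) j) (e : ℕ)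
    (r : (Finset α →₀ k) →ₗ[k] (Finset β →₀ k))
    (hr : ∀ σ ∈ K, bd k (r (Finsupp.single σ 1)) = r (bd k (Finsupp.single σ 1)))
    (hrm : ∀ σ ∈ K, σ.Nonempty → r (Finsupp.single σ 1) ∈ chains k (Φ σ) (σ.card - 1 + e))
    (d0 : Finset β →₀ k) (hd0 : d0 ∈ chains k (Φ ∅) e) (hbd : bd k d0 = r (Finsupp.single ∅ 1)) :
    ∃ D : (Finset α →₀ k) →ₗ[k] (Finset β →₀ k), D (Finsupp.single ∅ 1) = d0 ∧
      ∀ σ ∈ K, D (Finsupp.single σ 1) ∈ chains k (Φ σ) (σ.card + e) ∧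
        bd k (D (Finsupp.single σ 1)) = r (Finsupp.single σ 1) + D (bd k (Finsupp.single σ 1)) := by
  set g : Finset α → (Finset β →₀ k) := fillAux Φ e (fun σ => r (Finsupp.single σ 1)) d0 with hg
  have hg0 : g ∅ = d0 := by rw [hg, fillAux]; simp
  refine ⟨Finsupp.linearCombination k g, by simp [hg0], fun σ => ?_⟩
  induction hn : σ.card using Nat.strong_induction_on generalizing σ with
  | _ n ih =>
  intro hσ
  have hD : ∀ τ, (Finsupp.linearCombination k g) (Finsupp.single τ 1) = g τ := by simp
  rcases Finset.eq_empty_or_nonempty σ with rfl | hne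
  · subst hn
    simp [hg0, hd0, hbd, bd_single]
  · have hsum : (Finsupp.linearCombination k g) (bd k (Finsupp.single σ 1)) =
        ∑ v ∈ σ, g (σ.erase v) := by
      rw [bd_single, map_sum]; simp
    have key : ∃ w ∈ chains k (Φ σ) (σ.card + e),
        bd k w = r (Finsupp.single σ 1) + ∑ v : {x // x ∈ σ}, g (σ.erase v) := by
      have hpos : 0 < σ.card := hne.card_pos
      rw [show σ.card + e = (σ.card - 1 + e) + 1 by omega,
        Finset.sum_coe_sort σ (fun v => g (σ.erase v))]
      refine hac σ hσ hne _ _ (Submodule.add_mem _ (hrm σ hσ hne)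
        (Submodule.sum_mem _ fun v hv => ?_)) ?_
      · have := (ih _ (by rw [← hn]; exact Finset.card_lt_card (Finset.erase_ssubset hv))
          (σ.erase v) rfl (hK (Finset.erase_subset _ _) hσ)).1
        rw [hD, Finset.card_erase_of_mem hv] at this
        exact chains_mono (hmono _ _ (Finset.erase_subset _ _)) _ this
      · rw [map_add, hr σ hσ, map_sum]
        have : ∀ v ∈ σ, bd k (g (σ.erase v)) = r (Finsupp.single (σ.erase v) 1) +
            Finsupp.linearCombination k g (bd k (Finsupp.single (σ.erase v) 1)) := by
          intro v hv
          have := (ih _ (by rw [← hn]; exact Finset.card_lt_card (Finset.erase_ssubset hv))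
            (σ.erase v) rfl (hK (Finset.erase_subset _ _) hσ)).2
          rwa [hD] at this
        rw [Finset.sum_congr rfl this, Finset.sum_add_distrib, bd_single, map_sum, ← add_assoc,
          add_self_mod, zero_add, ← map_sum, ← map_sum, ← bd_single, bd_bd, map_zero]
    have hgs : g σ = key.choose := by
      have : g σ = fillAux Φ e (fun σ => r (Finsupp.single σ 1)) d0 σ := rfl
      rw [this, fillAux, if_neg hne.ne_empty]
      exact dif_pos key
    rw [hD, hsum, hgs, ← hn]
    refine ⟨key.choose_spec.1, ?_⟩
    rw [key.choose_spec.2, Finset.sum_coe_sort σ (fun v => g (σ.erase v))]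

/-- Two chain maps carried by a common acyclic carrier agree on cycles up to boundaries. -/
lemma carried_homotopic (K : Set (Finset α)) (hK : IsLowerSet K) (Φ : Finset α → Set (Finset β))
    (hmono : ∀ σ τ, σ ⊆ τ → Φ σ ⊆ Φ τ)
    (hac : ∀ σ ∈ K, σ.Nonempty → ∀ j, AcyclicAt k (Φ σ) j)
    (f g : (Finset α →₀ k) →ₗ[k] (Finset β →₀ k))
    (hf : ∀ σ ∈ K, bd k (f (Finsupp.single σ 1)) = f (bd k (Finsupp.single σ 1)))
    (hg : ∀ σ ∈ K, bd k (g (Finsupp.single σ 1)) = g (bd k (Finsupp.single σ 1)))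
    (hfm : ∀ σ ∈ K, σ.Nonempty → f (Finsupp.single σ 1) ∈ chains k (Φ σ) σ.card)
    (hgm : ∀ σ ∈ K, σ.Nonempty → g (Finsupp.single σ 1) ∈ chains k (Φ σ) σ.card)
    (h0 : f (Finsupp.single ∅ 1) = g (Finsupp.single ∅ 1))
    {L : Set (Finset β)} (hL : ∀ σ ∈ K, Φ σ ⊆ L)
    {j : ℕ} {z : Finset α →₀ k} (hz : z ∈ chains k K j) (hbz : bd k z = 0) :
    ∃ w ∈ chains k L (j + 1), bd k w = f z + g z := by
  have hcard : ∀ σ : Finset α, σ.Nonempty → σ.card - 1 + 1 = σ.card := fun σ h => by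
    have := h.card_pos; omega
  obtain ⟨D, hD0, hD⟩ := exists_carried K hK Φ hmono hac 1 (f + g)
    (fun σ hσ => by simp [hf σ hσ, hg σ hσ])
    (fun σ hσ hne => by
      rw [hcard σ hne]; exact Submodule.add_mem _ (hfm σ hσ hne) (hgm σ hσ hne))
    0 (Submodule.zero_mem _) (by simp [h0, add_self_mod])
  refine ⟨D z, map_mem_of_chains _ _ (fun σ h1 h2 => ?_) hz, ?_⟩
  · exact h2 ▸ chains_mono (hL σ h1) _ (hD σ h1).1
  · have := eq_of_chains ((bd k).comp D) (f + g + D.comp (bd k))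
      (fun σ h1 _ => by simpa using (hD σ h1).2) hz
    simpa [hbz] using this

/-- The chain map induced by a vertex map. -/
noncomputable def push (k : Type*) [Field k] {α β : Type*} [DecidableEq β] (φ : α → β) :
    (Finset α →₀ k) →ₗ[k] (Finset β →₀ k) :=
  Finsupp.linearCombination k fun σ =>
    if (σ.image φ).card = σ.card then Finsupp.single (σ.image φ) 1 else 0

lemma push_single (φ : α → β) (σ : Finset α) : push k φ (Finsupp.single σ 1) =
    if (σ.image φ).card = σ.card then Finsupp.single (σ.image φ) 1 else 0 := by
  simp [push]

lemma push_empty (φ : α → β) : push k φ (Finsupp.single ∅ 1) = Finsupp.single ∅ 1 := by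
  simp [push_single]

lemma bd_push (φ : α → β) (z : Finset α →₀ k) : bd k (push k φ z) = push k φ (bd k z) := by
  have : (bd k).comp (push k φ) = (push k φ).comp (bd k) := by
    ext1 σ
    ext1
    simp only [LinearMap.comp_apply, Finsupp.lsingle_apply, bd_single, map_sum, push_single]
    by_cases h : (σ.image φ).card = σ.card
    · rw [if_pos h, bd_single]
      have hinj : Set.InjOn φ σ := Finset.card_image_iff.1 h
      rw [Finset.sum_image hinj]
      refine Finset.sum_congr rfl fun v hv => ?_
      have him : (σ.erase v).image φ = (σ.image φ).erase (φ v) := by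
        ext x
        simp only [Finset.mem_image, Finset.mem_erase]
        constructor
        · rintro ⟨a, ⟨ha, ha'⟩, rfl⟩
          exact ⟨fun hh => ha (hinj ha' hv hh), a, ha', rfl⟩
        · rintro ⟨hx, a, ha, rfl⟩
          exact ⟨a, ⟨fun hh => hx (by rw [hh]), ha⟩, rfl⟩
      rw [if_pos, him]
      exact Finset.card_image_of_injOn (hinj.mono (Finset.erase_subset _ _))
    · rw [if_neg h, map_zero]
      have : ¬ Set.InjOn φ σ := fun hh => h (Finset.card_image_of_injOn hh)
      simp only [Set.InjOn, not_forall] at this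
      obtain ⟨a, ha, b, hb, hab, hne⟩ := this
      have ha : a ∈ σ := ha
      have hb : b ∈ σ := hb
      have himg : (σ.erase a).image φ = (σ.erase b).image φ := by
        have h1 : ∀ {a b : α}, b ∈ σ → φ a = φ b → a ≠ b → (σ.erase a).image φ = σ.image φ := by
          intro a b hb hab hne
          ext x
          simp only [Finset.mem_image, Finset.mem_erase]
          constructor
          · rintro ⟨y, hy, rfl⟩; exact ⟨y, hy.2, rfl⟩
          · rintro ⟨y, hy, rfl⟩
            by_cases hya : y = a
            · exact ⟨b, ⟨Ne.symm hne, hb⟩, by rw [hya, hab]⟩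
            · exact ⟨y, ⟨hya, hy⟩, rfl⟩
        rw [h1 hb hab hne, h1 ha hab.symm (Ne.symm hne)]
      rw [← Finset.add_sum_erase _ _ ha,
        ← Finset.add_sum_erase _ _ (Finset.mem_erase.2 ⟨Ne.symm hne, hb⟩), Finset.sum_eq_zero,
        add_zero, himg, Finset.card_erase_of_mem ha, Finset.card_erase_of_mem hb, add_self_mod]
      intro v hv
      simp only [Finset.mem_erase] at hv
      rw [if_neg]
      intro hc
      exact hne (Finset.card_image_iff.1 hc (Finset.mem_coe.2 (Finset.mem_erase.2 ⟨hv.2.1.symm, ha⟩))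
        (Finset.mem_coe.2 (Finset.mem_erase.2 ⟨hv.1.symm, hb⟩)) hab)
  exact (LinearMap.congr_fun this z).symm ▸ rfl

lemma push_mem_chains {φ : α → β} {L : Set (Finset α)} {M : Set (Finset β)}
    (h : ∀ σ ∈ L, σ.image φ ∈ M) {j : ℕ} {z : Finset α →₀ k} (hz : z ∈ chains k L j) :
    push k φ z ∈ chains k M j := by
  refine map_mem_of_chains _ _ (fun σ h1 h2 => ?_) hz
  rw [push_single]
  split_ifs with h3
  · exact single_mem_chains _ (h σ h1) (h3.trans h2)
  · exact Submodule.zero_mem _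

/-- Contiguous vertex maps induce homotopic chain maps. -/
lemma push_contiguous {φ ψ : α → β} {L : Set (Finset α)} (hL : IsLowerSet L)
    {M : Set (Finset β)} (hM : IsLowerSet M) (h : ∀ σ ∈ L, σ.image φ ∪ σ.image ψ ∈ M) {j : ℕ}
    {z : Finset α →₀ k} (hz : z ∈ chains k L j) (hbz : bd k z = 0) :
    ∃ w ∈ chains k M (j + 1), bd k w = push k φ z + push k ψ z := by
  refine carried_homotopic L hL (fun σ => {τ | τ ⊆ σ.image φ ∪ σ.image ψ}) ?_ ?_ _ _ ?_ ?_ ?_ ?_ ?_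
    ?_ hz hbz
  · intro σ τ hst ρ hρ
    exact hρ.trans (Finset.union_subset_union (Finset.image_subset_image hst)
      (Finset.image_subset_image hst))
  · intro σ _ hne j
    exact acyclicAt_powerset ((hne.image φ).mono Finset.subset_union_left) j
  · intro σ _; exact bd_push _ _
  · intro σ _; exact bd_push _ _
  · intro σ _ _
    exact push_mem_chains (L := {τ | τ ⊆ σ})
      (fun τ hτ => (Finset.image_subset_image hτ).trans Finset.subset_union_left)
      (single_mem_chains _ (by simp) rfl)
  · intro σ _ _
    exact push_mem_chains (L := {τ | τ ⊆ σ})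
      (fun τ hτ => (Finset.image_subset_image hτ).trans Finset.subset_union_right)
      (single_mem_chains _ (by simp) rfl)
  · simp [push_empty]
  · intro σ hσ τ hτ
    exact hM hτ (h σ hσ)

end Chains

section Rips

variable {k : Type*} [Field k] [CharP k 2]

/-- Boundaries of chains in `L`, in the degree of faces with `j` vertices. -/
noncomputable def bdry (k : Type*) [Field k] {α : Type*} [DecidableEq α] (L : Set (Finset α))
    (j : ℕ) : Submodule k (Finset α →₀ k) :=
  (chains k L (j + 1)).map (bd k)

lemma bdry_mono {α : Type*} [DecidableEq α] {L L' : Set (Finset α)} (h : L ⊆ L') (j : ℕ) :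
    bdry k L j ≤ bdry k L' j :=
  Submodule.map_mono (chains_mono h _)

lemma mem_bdry_trans {α : Type*} [DecidableEq α] {L : Set (Finset α)} {j : ℕ}
    {x y z : Finset α →₀ k} (h1 : x + y ∈ bdry k L j) (h2 : y + z ∈ bdry k L j) :
    x + z ∈ bdry k L j := by
  have := Submodule.add_mem _ h1 h2
  rwa [add_assoc, ← add_assoc y, add_self_mod, zero_add] at this

lemma mem_bdry_of_add {α : Type*} [DecidableEq α] {L : Set (Finset α)} {j : ℕ}
    {x y : Finset α →₀ k} (h1 : x + y ∈ bdry k L j) (h2 : y ∈ bdry k L j) : x ∈ bdry k L j := by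
  have := Submodule.add_mem _ h1 h2
  rwa [add_assoc, add_self_mod, add_zero] at this

lemma push_congr {α β : Type*} [DecidableEq α] [DecidableEq β] {φ ψ : α → β}
    {L : Set (Finset α)} (h : ∀ σ ∈ L, ∀ v ∈ σ, φ v = ψ v) {j : ℕ} {z : Finset α →₀ k}
    (hz : z ∈ chains k L j) : push k φ z = push k ψ z := by
  refine eq_of_chains _ _ (fun σ h1 _ => ?_) hz
  rw [push_single, push_single, Finset.image_congr (h σ h1)]

lemma push_id {α : Type*} [DecidableEq α] (z : Finset α →₀ k) : push k id z = z := by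
  have : push k id = (LinearMap.id : (Finset α →₀ k) →ₗ[k] _) := by
    ext1 σ; ext1; simp [push_single]
  rw [this]; rfl

lemma push_comp {α β γ : Type*} [DecidableEq α] [DecidableEq β] [DecidableEq γ] (φ : α → β)
    (ψ : β → γ) (z : Finset α →₀ k) : push k ψ (push k φ z) = push k (ψ ∘ φ) z := by
  have : (push k ψ).comp (push k φ) = push k (ψ ∘ φ) := by
    ext1 σ
    ext1
    simp only [LinearMap.comp_apply, Finsupp.lsingle_apply, push_single]
    have h2 : σ.image (ψ ∘ φ) = (σ.image φ).image ψ := Finset.image_image.symm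
    have hle1 : (σ.image φ).card ≤ σ.card := Finset.card_image_le
    have hle2 : ((σ.image φ).image ψ).card ≤ (σ.image φ).card := Finset.card_image_le
    by_cases h : (σ.image φ).card = σ.card
    · rw [if_pos h, push_single, h2, h]
    · rw [if_neg h, map_zero, if_neg]
      rw [h2]; omega
  exact LinearMap.congr_fun this z

open Classical in
/-- The Vietoris–Rips complex at scale `δ`. -/
def Rips {E : Type*} [PseudoMetricSpace E] (X : Set E) (δ : ℝ) : Set (Finset E) :=
  {σ | ↑σ ⊆ X ∧ ∀ x ∈ σ, ∀ y ∈ σ, dist x y < δ}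

lemma isLowerSet_rips {E : Type*} [PseudoMetricSpace E] (X : Set E) (δ : ℝ) :
    IsLowerSet (Rips X δ) := by
  intro σ τ h hσ
  exact ⟨fun x hx => hσ.1 (h hx), fun x hx y hy => hσ.2 x (h hx) y (h hy)⟩

lemma rips_mono {E : Type*} [PseudoMetricSpace E] {X Y : Set E} (h : X ⊆ Y) {δ δ' : ℝ}
    (hδ : δ ≤ δ') : Rips X δ ⊆ Rips Y δ' := fun _ hσ =>
  ⟨hσ.1.trans h, fun x hx y hy => (hσ.2 x hx y hy).trans_le hδ⟩

lemma image_mem_rips {E F : Type*} [PseudoMetricSpace E] [PseudoMetricSpace F] [DecidableEq F]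
    {X : Set E} {Y : Set F} {δ η : ℝ} (f : E → F) (hf : ∀ x ∈ X, f x ∈ Y)
    (hu : ∀ x ∈ X, ∀ y ∈ X, dist x y < δ → dist (f x) (f y) < η) (σ : Finset E)
    (hσ : σ ∈ Rips X δ) : σ.image f ∈ Rips Y η := by
  refine ⟨?_, ?_⟩
  · intro y hy
    obtain ⟨x, hx, rfl⟩ := Finset.mem_image.1 (Finset.mem_coe.1 hy)
    exact hf x (hσ.1 hx)
  · intro x hx y hy
    obtain ⟨x, hx', rfl⟩ := Finset.mem_image.1 hx
    obtain ⟨y, hy', rfl⟩ := Finset.mem_image.1 hy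
    exact hu x (hσ.1 hx') y (hσ.1 hy') (hσ.2 x hx' y hy')

lemma rips_acyclic {E : Type*} [NormedAddCommGroup E] [NormedSpace ℝ E] [DecidableEq E]
    {X : Set E} (hX : Convex ℝ X) (hne : X.Nonempty) {δ : ℝ} (hδ : 0 < δ) (j : ℕ) :
    AcyclicAt k (Rips X δ) j := by
  classical
  intro z hz hbz
  obtain ⟨c, hc⟩ := hne
  set T : Finset E := z.support.biUnion id with hT
  set L0 : Set (Finset E) := {σ | σ ⊆ T ∧ σ ∈ Rips X δ} with hL0
  have hL0l : IsLowerSet L0 := fun σ τ h hσ =>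
    ⟨h.trans hσ.1, isLowerSet_rips _ _ h hσ.2⟩
  have hz0 : z ∈ chains k L0 j := by
    rw [mem_chains] at hz ⊢
    intro σ hσ
    refine ⟨⟨?_, (hz σ hσ).1⟩, (hz σ hσ).2⟩
    exact Finset.subset_biUnion_of_mem (s := z.support) id (Finsupp.mem_support_iff.2 hσ)
  obtain ⟨δ', hδ'0, hδ', hT'⟩ : ∃ δ', 0 ≤ δ' ∧ δ' < δ ∧ ∀ x ∈ T, ∀ y ∈ T, dist x y < δ →
      dist x y ≤ δ' := by
    set P := ((T ×ˢ T).image fun p => dist p.1 p.2).filter (· < δ) with hP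
    have h0 : (insert 0 P).Nonempty := ⟨0, by simp⟩
    refine ⟨(insert 0 P).max' h0, Finset.le_max' _ _ (by simp), ?_, ?_⟩
    · rw [Finset.max'_lt_iff]
      intro y hy
      rcases Finset.mem_insert.1 hy with rfl | hy
      · exact hδ
      · exact (Finset.mem_filter.1 hy).2
    · intro x hx y hy hxy
      refine Finset.le_max' _ _ (Finset.mem_insert_of_mem ?_)
      rw [hP, Finset.mem_filter]
      refine ⟨?_, hxy⟩
      exact Finset.mem_image.2 ⟨(x, y), Finset.mem_product.2 ⟨hx, hy⟩, rfl⟩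
  obtain ⟨M, hM⟩ : ∃ M : ℝ, ∀ x ∈ T, dist c x ≤ M := by
    refine ⟨∑ x ∈ T, dist c x, fun x hx => ?_⟩
    exact Finset.single_le_sum (f := fun x => dist c x) (fun _ _ => dist_nonneg) hx
  obtain ⟨N, hN⟩ := exists_nat_gt (|M| / (δ - δ'))
  have hNpos : (0 : ℝ) < N := lt_of_le_of_lt (div_nonneg (abs_nonneg _) (by linarith)) hN
  set φ : ℕ → E → E := fun i x => AffineMap.lineMap x c ((i : ℝ) / N) with hφ
  have hstep : ∀ i < N, push k (φ i) z + push k (φ (i + 1)) z ∈ bdry k (Rips X δ) j := by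
    intro i hi
    refine push_contiguous hL0l (isLowerSet_rips X δ) (fun σ hσ => ?_) hz0 hbz
    have hti : ∀ i' : ℕ, i' ≤ N → (0 : ℝ) ≤ i' / N ∧ (i' : ℝ) / N ≤ 1 := fun i' hi' =>
      ⟨by positivity, (div_le_one hNpos).2 (by exact_mod_cast hi')⟩
    have hmem : ∀ i' : ℕ, i' ≤ N → ∀ x ∈ σ, φ i' x ∈ X := fun i' hi' x hx =>
      hX.lineMap_mem (hσ.2.1 hx) hc (hti i' hi')
    have hd : ∀ i' : ℕ, i' ≤ N → ∀ x ∈ σ, ∀ y ∈ σ, dist (φ i' x) (φ i' y) ≤ δ' := by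
      intro i' hi' x hx y hy
      have : φ i' x - φ i' y = (1 - (i' : ℝ) / N) • (x - y) := by
        simp only [hφ, AffineMap.lineMap_apply_module]; module
      rw [dist_eq_norm (φ i' x), this, norm_smul, ← dist_eq_norm x y, Real.norm_eq_abs,
        abs_of_nonneg (by linarith [(hti i' hi').2])]
      have h1 := hT' x (hσ.1 hx) y (hσ.1 hy) (hσ.2.2 x hx y hy)
      nlinarith [(hti i' hi').1, (hti i' hi').2, dist_nonneg (x := x) (y := y)]
    have hs : ∀ x ∈ σ, dist (φ i x) (φ (i + 1) x) < δ - δ' := by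
      intro x hx
      have : φ i x - φ (i + 1) x = (1 / (N : ℝ)) • (x - c) := by
        simp only [hφ, AffineMap.lineMap_apply_module]
        push_cast
        rw [add_div]
        module
      rw [dist_eq_norm (φ i x), this, norm_smul, ← dist_eq_norm x c, Real.norm_eq_abs,
        abs_of_nonneg (by positivity), dist_comm]
      have h1 := hM x (hσ.1 hx)
      have h2 : |M| < N * (δ - δ') := by rwa [div_lt_iff₀ (by linarith)] at hN
      rw [one_div_mul_eq_div, div_lt_iff₀ hNpos]
      have := le_abs_self M
      nlinarith
    refine ⟨?_, ?_⟩
    · intro y hy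
      rcases Finset.mem_union.1 (Finset.mem_coe.1 hy) with hy | hy <;>
        obtain ⟨x, hx, rfl⟩ := Finset.mem_image.1 hy
      · exact hmem i hi.le x hx
      · exact hmem (i + 1) hi x hx
    · intro x hx y hy
      rcases Finset.mem_union.1 hx with hx | hx <;> rcases Finset.mem_union.1 hy with hy | hy <;>
        obtain ⟨x, hx', rfl⟩ := Finset.mem_image.1 hx <;>
        obtain ⟨y, hy', rfl⟩ := Finset.mem_image.1 hy
      · exact (hd i hi.le x hx' y hy').trans_lt hδ'
      · have := dist_triangle (φ i x) (φ i y) (φ (i + 1) y)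
        linarith [hd i hi.le x hx' y hy', hs y hy']
      · have := dist_triangle (φ (i + 1) x) (φ i x) (φ i y)
        rw [dist_comm (φ (i + 1) x) (φ i x)] at this
        linarith [hd i hi.le x hx' y hy', hs x hx']
      · exact (hd (i + 1) hi x hx' y hy').trans_lt hδ'
  have hall : ∀ i ≤ N, push k (φ 0) z + push k (φ i) z ∈ bdry k (Rips X δ) j := by
    intro i
    induction i with
    | zero => intro _; rw [add_self_mod]; exact Submodule.zero_mem _
    | succ i ih => intro hi; exact mem_bdry_trans (ih (by omega)) (hstep i hi)
  have h0 : push k (φ 0) z = z := by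
    have : φ 0 = id := by ext x; simp [hφ]
    rw [this, push_id]
  have hlast : push k (φ N) z ∈ bdry k (Rips X δ) j := by
    have hc1 : ∀ x, φ N x = c := fun x => by
      simp only [hφ, div_self hNpos.ne', AffineMap.lineMap_apply_one]
    have h1 : push k (φ N) z ∈ chains k {σ | σ ⊆ ({c} : Finset E)} j := by
      refine push_mem_chains (fun σ _ => ?_) hz0
      intro y hy
      obtain ⟨x, -, rfl⟩ := Finset.mem_image.1 hy
      simp [hc1]
    refine bdry_mono (fun σ hσ => ?_) j
      (acyclicAt_powerset (Finset.singleton_nonempty c) j _ h1 (by rw [bd_push, hbz, map_zero]))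
    refine ⟨fun x hx => ?_, fun x hx y hy => ?_⟩
    · rw [Finset.mem_singleton.1 (hσ hx)]; exact hc
    · rw [Finset.mem_singleton.1 (hσ hx), Finset.mem_singleton.1 (hσ hy), dist_self]; exact hδ
  have := mem_bdry_of_add (hall N le_rfl) hlast
  rw [h0] at this
  exact this

/-- The geometric realization of an abstract complex, in barycentric coordinates. -/
def realiz {V : Type*} [Fintype V] [DecidableEq V] (K : Set (Finset V)) : Set (V → ℝ) :=
  {w | (∀ v, 0 ≤ w v) ∧ ∑ v, w v = 1 ∧ Finset.univ.filter (fun v => w v ≠ 0) ∈ K}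

lemma realiz_mono {V : Type*} [Fintype V] [DecidableEq V] {K K' : Set (Finset V)} (h : K ⊆ K') :
    realiz K ⊆ realiz K' := fun _ hw => ⟨hw.1, hw.2.1, h hw.2.2⟩

lemma convex_realiz_powerset {V : Type*} [Fintype V] [DecidableEq V] (G : Finset V) :
    Convex ℝ (realiz {σ | σ ⊆ G}) := by
  intro x hx y hy a b ha hb hab
  refine ⟨fun v => ?_, ?_, ?_⟩
  · have := hx.1 v; have := hy.1 v
    simp only [Pi.add_apply, Pi.smul_apply, smul_eq_mul]; positivity
  · simp only [Pi.add_apply, Pi.smul_apply, smul_eq_mul, Finset.sum_add_distrib,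
      ← Finset.mul_sum, hx.2.1, hy.2.1]; linarith
  · intro v hv
    by_contra hG
    have hx' : x v = 0 := by
      by_contra h; exact hG (hx.2.2 (by simpa using h))
    have hy' : y v = 0 := by
      by_contra h; exact hG (hy.2.2 (by simpa using h))
    simp [hx', hy'] at hv

lemma realiz_powerset_nonempty {V : Type*} [Fintype V] [DecidableEq V] {G : Finset V}
    (hG : G.Nonempty) : (realiz {σ | σ ⊆ G}).Nonempty := by
  obtain ⟨v, hv⟩ := hG
  refine ⟨Pi.single v 1, fun u => ?_, by simp, fun u hu => ?_⟩
  · by_cases h : u = v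
    · subst h; simp
    · simp [h]
  · by_cases h : u = v
    · subst h; exact hv
    · simp [h] at hu

set_option maxHeartbeats 1000000 in
/-- Comparison of the homology of a complex with that of a combinatorial model of a region
containing its image. -/
lemma exists_comparison {V ι E : Type*} [Fintype V] [DecidableEq V] [DecidableEq ι]
    [NormedAddCommGroup E] [NormedSpace ℝ E]
    {K : Set (Finset V)} (hK : IsLowerSet K) {L : Set (Finset ι)} (hL : IsLowerSet L)
    {D D1 : Set E} (f : (V → ℝ) → E) (g : E → (V → ℝ))
    (hf : ∀ η > 0, ∃ δ > 0, ∀ x ∈ realiz K, ∀ y ∈ realiz K, dist x y < δ → dist (f x) (f y) < η)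
    (hg : ∀ η > 0, ∃ δ > 0, ∀ x ∈ D, ∀ y ∈ D, dist x y < δ → dist (g x) (g y) < η)
    (hfD : ∀ x ∈ realiz K, f x ∈ D1) (hgf : ∀ x ∈ realiz K, g (f x) = x)
    (ψ : (V → ℝ) → V) {ε : ℝ} (hε : 0 < ε)
    (hψ : ∀ σ ∈ Rips (g '' D) ε, σ.image ψ ∈ K)
    (hψG : ∀ G ∈ K, ∀ x ∈ realiz {σ | σ ⊆ G}, ψ x ∈ G)
    (κ : E → ι) (e : ι → E) {η₀ : ℝ} (hη₀ : 0 < η₀)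
    (hκ : ∀ σ ∈ Rips D1 η₀, σ.image κ ∈ L)
    (hκD : ∀ σ ∈ Rips D1 η₀, convexHull ℝ ((σ : Set E) ∪ (fun x => e (κ x)) '' σ) ⊆ D)
    (heD : ∀ G ∈ L, convexHull ℝ (e '' G) ⊆ D) :
    ∃ τ : (Finset V →₀ k) →ₗ[k] (Finset ι →₀ k),
      (∀ j, ∀ z ∈ chains k K j, τ z ∈ chains k L j ∧ bd k (τ z) = τ (bd k z)) ∧
      ∀ j, ∀ z ∈ chains k K j, bd k z = 0 → τ z ∈ bdry k L j → z ∈ bdry k K j := by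
  classical
  rcases K.eq_empty_or_nonempty with hKe | ⟨σ₀, hσ₀⟩
  · refine ⟨0, fun j z _ => by simp, fun j z hz _ _ => ?_⟩
    have : z = 0 := by
      ext σ
      by_contra h
      have := (mem_chains.1 hz σ h).1
      rw [hKe] at this
      exact this
    rw [this]
    exact Submodule.zero_mem _
  have hKempty : ∅ ∈ K := hK (Finset.empty_subset _) hσ₀
  have hLempty : ∅ ∈ L := by
    have := hκ ∅ ⟨by simp, by simp⟩
    simpa using this
  obtain ⟨η, hη, hgη⟩ := hg ε hε
  set η₁ := min η η₀ with hη₁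
  have hη₁pos : 0 < η₁ := lt_min hη hη₀
  obtain ⟨δ, hδ, hfδ⟩ := hf η₁ hη₁pos
  have hGK : ∀ G ∈ K, {σ | σ ⊆ G} ⊆ K := fun G hG σ hσ => hK hσ hG
  obtain ⟨S, hS0, hS⟩ := exists_carried (k := k) K hK (fun G => Rips (realiz {σ | σ ⊆ G}) δ)
    (fun σ τ h => rips_mono (realiz_mono fun ρ hρ => Finset.Subset.trans hρ h) le_rfl)
    (fun σ hσ hne j => rips_acyclic (convex_realiz_powerset σ) (realiz_powerset_nonempty hne) hδ j)
    0 0 (by simp) (by simp) (Finsupp.single ∅ 1)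
    (by refine single_mem_chains _ ?_ rfl; exact ⟨by simp, by simp⟩) (by simp [bd_single])
  obtain ⟨S', hS'0, hS'⟩ := exists_carried (k := k) L hL
    (fun G => Rips (convexHull ℝ (e '' G)) η)
    (fun σ τ h => rips_mono (convexHull_mono (Set.image_mono (Finset.coe_subset.2 h))) le_rfl)
    (fun σ hσ hne j => rips_acyclic (convex_convexHull ℝ _)
      ((Set.Nonempty.image e (Finset.coe_nonempty.2 hne)).mono (subset_convexHull ℝ _)) hη j)
    0 0 (by simp) (by simp) (Finsupp.single ∅ 1)
    (by refine single_mem_chains _ ?_ rfl; exact ⟨by simp, by simp⟩) (by simp [bd_single])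
  have hSbd : ∀ j, ∀ z ∈ chains k K j, bd k (S z) = S (bd k z) := fun j z hz =>
    eq_of_chains ((bd k).comp S) (S.comp (bd k)) (fun σ h1 _ => by simpa using (hS σ h1).2) hz
  have hS'bd : ∀ j, ∀ z ∈ chains k L j, bd k (S' z) = S' (bd k z) := fun j z hz =>
    eq_of_chains ((bd k).comp S') (S'.comp (bd k)) (fun σ h1 _ => by simpa using (hS' σ h1).2) hz
  have hSm : ∀ j, ∀ z ∈ chains k K j, S z ∈ chains k (Rips (realiz K) δ) j := fun j z hz =>
    map_mem_of_chains _ _ (fun σ h1 h2 => chains_mono (rips_mono (realiz_mono (hGK σ h1)) le_rfl) _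
      (by simpa [h2] using (hS σ h1).1)) hz
  have hS'm : ∀ j, ∀ z ∈ chains k L j, S' z ∈ chains k (Rips D η) j := fun j z hz =>
    map_mem_of_chains _ _ (fun σ h1 h2 => chains_mono (rips_mono (heD σ h1) le_rfl) _
      (by simpa [h2] using (hS' σ h1).1)) hz
  have hfm : ∀ j, ∀ z ∈ chains k (Rips (realiz K) δ) j,
      push k f z ∈ chains k (Rips D1 η₁) j := fun j z hz =>
    push_mem_chains (fun σ hσ => image_mem_rips f hfD hfδ σ hσ) hz
  have hη₁0 : Rips D1 η₁ ⊆ Rips D1 η₀ := rips_mono le_rfl (min_le_right _ _)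
  have hκm : ∀ j, ∀ z ∈ chains k (Rips D1 η₁) j, push k κ z ∈ chains k L j := fun j z hz =>
    push_mem_chains (fun σ hσ => hκ σ (hη₁0 hσ)) hz
  have hτm : ∀ j, ∀ z ∈ chains k K j, push k κ (push k f (S z)) ∈ chains k L j :=
    fun j z hz => hκm j _ (hfm j _ (hSm j z hz))
  refine ⟨(push k κ).comp ((push k f).comp S), fun j z hz => ⟨hτm j z hz, ?_⟩,
    fun j z hz hbz hτ => ?_⟩
  · simp [bd_push, hSbd j z hz]
  · simp only [LinearMap.comp_apply] at hτ
    obtain ⟨w, hw, hwτ⟩ := hτ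
    set y := push k f (S z) with hy
    have hbS : bd k (S z) = 0 := by rw [hSbd j z hz, hbz, map_zero]
    have hby : bd k y = 0 := by rw [hy, bd_push, hbS, map_zero]
    have hym : y ∈ chains k (Rips D1 η₁) j := hfm j _ (hSm j z hz)
    have hsing : ∀ σ ∈ Rips D1 η₁, push k κ (Finsupp.single σ 1) ∈ chains k L σ.card :=
      fun σ hσ => hκm _ _ (single_mem_chains _ hσ rfl)
    have h1 : y + S' (push k κ y) ∈ bdry k (Rips D η) j := by
      refine carried_homotopic (Rips D1 η₁) (isLowerSet_rips _ _)
        (fun σ => Rips (convexHull ℝ ((σ : Set E) ∪ (fun x => e (κ x)) '' σ)) η) ?_ ?_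
        LinearMap.id (S'.comp (push k κ)) ?_ ?_ ?_ ?_ ?_ ?_ hym hby
      · intro σ τ h
        have h' : (σ : Set E) ⊆ τ := Finset.coe_subset.2 h
        exact rips_mono (convexHull_mono (Set.union_subset_union h' (Set.image_mono h'))) le_rfl
      · intro σ _ hne j
        exact rips_acyclic (convex_convexHull ℝ _) (((Finset.coe_nonempty.2 hne).mono
          Set.subset_union_left).mono (subset_convexHull ℝ _)) hη j
      · intro σ _; rfl
      · intro σ hσ
        simp [hS'bd _ _ (hsing σ hσ), bd_push]
      · intro σ hσ _
        refine single_mem_chains (L := Rips _ _) _ ⟨?_, fun a ha b hb => ?_⟩ rfl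
        · exact Set.subset_union_left.trans (subset_convexHull ℝ _)
        · exact (hσ.2 a ha b hb).trans_le (min_le_left _ _)
      · intro σ hσ _
        simp only [LinearMap.comp_apply, push_single]
        split_ifs with hc
        · have := (hS' (σ.image κ) (hκ σ (hη₁0 hσ))).1
          rw [hc, add_zero] at this
          refine chains_mono (rips_mono (convexHull_mono ?_) le_rfl) _ this
          rw [Finset.coe_image, Set.image_image]
          exact Set.subset_union_right
        · rw [map_zero]; exact Submodule.zero_mem _
      · simp [push_empty, hS'0]
      · intro σ hσ
        exact rips_mono (hκD σ (hη₁0 hσ)) le_rfl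
    have h2 : y ∈ bdry k (Rips D η) j := by
      refine mem_bdry_of_add h1 ⟨S' w, hS'm _ w hw, ?_⟩
      rw [hS'bd _ w hw, hwτ]
    obtain ⟨u, hu, huy⟩ := h2
    have h3 : push k ψ (S z) ∈ bdry k K j := by
      refine ⟨push k ψ (push k g u), ?_, ?_⟩
      · refine push_mem_chains hψ (push_mem_chains (fun σ hσ => ?_) hu)
        exact image_mem_rips g (fun x hx => Set.mem_image_of_mem g hx) hgη σ hσ
      · have hyg : push k g y = S z := by
          rw [hy, push_comp]
          refine (push_congr (fun σ hσ v hv => ?_) (hSm j z hz)).trans (push_id _)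
          exact hgf v (hσ.1 hv)
        rw [bd_push, bd_push, huy, hyg]
    refine mem_bdry_of_add (y := push k ψ (S z)) ?_ h3
    refine carried_homotopic K hK (fun σ => {τ | τ ⊆ σ}) (fun σ τ h ρ hρ => hρ.trans h)
      (fun σ _ hne j => acyclicAt_powerset hne j) LinearMap.id ((push k ψ).comp S)
      (fun σ _ => rfl) (fun σ hσ => ?_)
      (fun σ _ _ => single_mem_chains (L := {τ | τ ⊆ σ}) _ (by simp) rfl)
      (fun σ hσ _ => ?_) (by simp [hS0, push_empty]) (fun σ hσ => hGK σ hσ) hz hbz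
    · simp [bd_push, hSbd _ _ (single_mem_chains (1 : k) hσ rfl)]
    · have := (hS σ hσ).1
      rw [add_zero] at this
      refine push_mem_chains (fun τ hτ => ?_) this
      intro v hv
      obtain ⟨x, hx, rfl⟩ := Finset.mem_image.1 hv
      exact hψG σ hσ x (hτ.1 hx)

end Rips

section Topology

variable {k : Type*} [Field k] [CharP k 2] {V : Type*} [Fintype V] [DecidableEq V]

/-- The faces not containing `F`; for empty `F` all faces. -/
def ast (K : Set (Finset V)) (F : Finset V) : Set (Finset V) :=
  {G | G ∈ K ∧ (F.Nonempty → ¬ F ⊆ G)}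

lemma isLowerSet_ast {K : Set (Finset V)} (hK : IsLowerSet K) (F : Finset V) :
    IsLowerSet (ast K F) := fun _ _ h hG =>
  ⟨hK h hG.1, fun hF hFG => hG.2 hF (hFG.trans h)⟩

lemma exists_approximation [Nonempty V] {K : Set (Finset V)} (hK : IsLowerSet K)
    (hKe : ∅ ∈ K) (F : Finset V) :
    ∃ ψ : (V → ℝ) → V, (∀ G ∈ ast K F, ∀ x ∈ realiz {σ | σ ⊆ G}, ψ x ∈ G) ∧
      ∀ θ > 0, ∃ ε > 0, ∀ σ : Finset (V → ℝ),
        (∀ x ∈ σ, x ∈ realiz K ∧ ∀ m, (∀ v ∈ F, m ≤ x v) → F.card * m ≤ 1 - θ) →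
        (∀ x ∈ σ, ∀ y ∈ σ, dist x y < ε) → σ.image ψ ∈ ast K F := by
  have hm : ∀ y : V → ℝ, ∃ m : ℝ, (F.Nonempty → ∃ v ∈ F, y v = m) ∧ (∀ v ∈ F, m ≤ y v) ∧
      (F = ∅ → m = 0) := by
    intro y
    rcases F.eq_empty_or_nonempty with rfl | hF
    · exact ⟨0, by simp, by simp, by simp⟩
    · obtain ⟨v, hv, hmin⟩ := F.exists_min_image y hF
      exact ⟨y v, fun _ => ⟨v, hv, rfl⟩, hmin, fun h => absurd h hF.ne_empty⟩
  choose m hm1 hm2 hm3 using hm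
  set u : (V → ℝ) → V → ℝ := fun y v => y v - if v ∈ F then m y else 0 with hu
  have hψ : ∀ y, ∃ v, ∀ w, u y w ≤ u y v := fun y => by
    obtain ⟨v, -, hv⟩ := Finset.univ.exists_max_image (u y) Finset.univ_nonempty
    exact ⟨v, fun w => hv w (Finset.mem_univ _)⟩
  choose ψ hψ using hψ
  have hsum : ∀ y : V → ℝ, ∑ v, u y v = ∑ v, y v - F.card * m y := by
    intro y
    simp [hu, Finset.sum_sub_distrib]
  have hmax : ∀ y : V → ℝ, ∑ v, u y v ≤ Fintype.card V * u y (ψ y) := by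
    intro y
    have := Finset.sum_le_card_nsmul Finset.univ (u y) (u y (ψ y)) (fun v _ => hψ y v)
    simpa using this
  have hcard : (0 : ℝ) < Fintype.card V := by exact_mod_cast Fintype.card_pos
  refine ⟨ψ, fun G hG x hx => ?_, fun θ hθ => ?_⟩
  · have hm0 : m x = 0 := by
      rcases F.eq_empty_or_nonempty with hF | hF
      · exact hm3 x hF
      · obtain ⟨v, hvF, hvG⟩ := Finset.not_subset.1 (hG.2 hF)
        have hxv : x v = 0 := by
          by_contra h
          exact hvG (hx.2.2 (by simpa using h))
        obtain ⟨w, hw, hwm⟩ := hm1 x hF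
        have h1 := hm2 x v hvF
        have h2 := hx.1 w
        linarith
    have h1 := hsum x
    rw [hx.2.1, hm0] at h1
    have h2 := hmax x
    have h3 : 0 < u x (ψ x) := by
      by_contra h
      push Not at h
      nlinarith
    have h4 : u x (ψ x) = x (ψ x) := by simp [hu, hm0]
    exact hx.2.2 (by simpa using (h4 ▸ h3).ne')
  · refine ⟨θ / (3 * Fintype.card V), by positivity, fun σ h1 h2 => ?_⟩
    set ε := θ / (3 * Fintype.card V) with hε
    have hεpos : 0 < ε := by positivity
    have hbig : ∀ y ∈ σ, 3 * ε ≤ u y (ψ y) := by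
      intro y hy
      have ha := hmax y
      rw [hsum, (h1 y hy).1.2.1] at ha
      have hb := (h1 y hy).2 (m y) (hm2 y)
      have : θ ≤ Fintype.card V * u y (ψ y) := by linarith
      have hc : 3 * ε = θ / Fintype.card V := by rw [hε]; field_simp
      rw [hc, div_le_iff₀ hcard]
      linarith
    have hcoord : ∀ x ∈ σ, ∀ y ∈ σ, ∀ v, |x v - y v| < ε := by
      intro x hx y hy v
      have := (dist_le_pi_dist x y v).trans_lt (h2 x hx y hy)
      rwa [Real.dist_eq] at this
    rcases σ.eq_empty_or_nonempty with rfl | ⟨x, hx⟩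
    · exact ⟨by simpa using hKe, fun hF h => by simp at h; exact hF.ne_empty h⟩
    · refine ⟨hK ?_ (h1 x hx).1.2.2, fun hF hsub => ?_⟩
      · intro v hv
        obtain ⟨y, hy, rfl⟩ := Finset.mem_image.1 hv
        have ha := hbig y hy
        have hb : u y (ψ y) ≤ y (ψ y) := by
          simp only [hu]
          split_ifs with h
          · obtain ⟨w, hw, hwm⟩ := hm1 y ⟨_, h⟩
            have := (h1 y hy).1.1 w
            linarith
          · simp
        have hc := abs_lt.1 (hcoord x hx y hy (ψ y))
        simp only [Finset.mem_filter, Finset.mem_univ, true_and]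
        intro h0
        rw [h0] at hc
        linarith
      · obtain ⟨v, hv, hvm⟩ := hm1 x hF
        obtain ⟨y, hy, hyv⟩ := Finset.mem_image.1 (hsub hv)
        have ha := hbig y hy
        rw [hyv] at ha
        simp only [hu, if_pos hv] at ha
        obtain ⟨w, hw, hwm⟩ := hm1 y hF
        have hb := hm2 x w hw
        have hc := abs_lt.1 (hcoord x hx y hy v)
        have hd := abs_lt.1 (hcoord x hx y hy w)
        linarith

/-- The comparison lemma for a convex model. -/
lemma bounds_of_point {E : Type*} [NormedAddCommGroup E] [NormedSpace ℝ E]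
    {K : Set (Finset V)} (hK : IsLowerSet K)
    {D D1 : Set E} (f : (V → ℝ) → E) (g : E → (V → ℝ))
    (hf : ∀ η > 0, ∃ δ > 0, ∀ x ∈ realiz K, ∀ y ∈ realiz K, dist x y < δ → dist (f x) (f y) < η)
    (hg : ∀ η > 0, ∃ δ > 0, ∀ x ∈ D, ∀ y ∈ D, dist x y < δ → dist (g x) (g y) < η)
    (hfD : ∀ x ∈ realiz K, f x ∈ D1) (hgf : ∀ x ∈ realiz K, g (f x) = x)
    (ψ : (V → ℝ) → V) {ε : ℝ} (hε : 0 < ε)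
    (hψ : ∀ σ ∈ Rips (g '' D) ε, σ.image ψ ∈ K)
    (hψG : ∀ G ∈ K, ∀ x ∈ realiz {σ | σ ⊆ G}, ψ x ∈ G)
    {H : Set E} (hH : Convex ℝ H) (hHD : H ⊆ D) (hDH : D1 ⊆ H) {c : E} (hc : c ∈ H)
    {j : ℕ} {z : Finset V →₀ k} (hz : z ∈ chains k K j) (hbz : bd k z = 0) : z ∈ bdry k K j := by
  obtain ⟨τ, h1, h2⟩ := exists_comparison (k := k) hK (L := (Set.univ : Set (Finset Unit)))
    isLowerSet_univ f g hf hg hfD hgf ψ hε hψ hψG (fun _ => ()) (fun _ => c) one_pos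
    (fun _ _ => trivial)
    (fun σ hσ => (convexHull_min (Set.union_subset (hσ.1.trans hDH)
      (by rintro _ ⟨x, -, rfl⟩; exact hc)) hH).trans hHD)
    (fun G _ => (convexHull_min (by rintro _ ⟨x, -, rfl⟩; exact hc) hH).trans hHD)
  refine h2 j z hz hbz ?_
  refine acyclicAt_of_cone (L := Set.univ) (v := ()) (fun _ _ => trivial) j _ (h1 j z hz).1 ?_
  rw [(h1 j z hz).2, hbz, map_zero]

/-- The coordinates relative to `q`, with an additional coordinate zero. -/
noncomputable def relCoord {d : ℕ} (q y : EuclideanSpace ℝ (Fin d)) (o : Option (Fin d)) : ℝ :=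
  o.elim 0 fun i => y i - q i

/-- The linear functional cutting out the facet of the model simplex opposite to `o`. -/
noncomputable def facetFunctional {d : ℕ} (q : EuclideanSpace ℝ (Fin d)) (o : Option (Fin d))
    (y : EuclideanSpace ℝ (Fin d)) : ℝ :=
  ∑ i, (relCoord q y i - relCoord q y o)

lemma abs_relCoord_sub_le {d : ℕ} (q x y : EuclideanSpace ℝ (Fin d)) (o : Option (Fin d)) :
    |relCoord q x o - relCoord q y o| ≤ dist x y := by
  cases o with
  | none => simp [relCoord]
  | some i =>
    have := PiLp.norm_apply_le (x - y) i
    rw [← dist_eq_norm] at this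
    simpa [relCoord] using this

lemma abs_facetFunctional_sub_le {d : ℕ} (q x y : EuclideanSpace ℝ (Fin d))
    (o : Option (Fin d)) :
    |facetFunctional q o x - facetFunctional q o y| ≤ 2 * (d + 1) * dist x y := by
  rw [facetFunctional, facetFunctional, ← Finset.sum_sub_distrib]
  refine (Finset.abs_sum_le_sum_abs _ _).trans ?_
  have : ∀ i ∈ (Finset.univ : Finset (Option (Fin d))),
      |relCoord q x i - relCoord q x o - (relCoord q y i - relCoord q y o)| ≤ 2 * dist x y := by
    intro i _
    have h1 := abs_le.1 (abs_relCoord_sub_le q x y i)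
    have h2 := abs_le.1 (abs_relCoord_sub_le q x y o)
    rw [abs_le]
    constructor <;> linarith
  refine (Finset.sum_le_card_nsmul _ _ _ this).trans (le_of_eq ?_)
  simp
  ring

lemma facetFunctional_convex {d : ℕ} (q x y : EuclideanSpace ℝ (Fin d)) (o : Option (Fin d))
    {a b : ℝ} (hab : a + b = 1) : facetFunctional q o (a • x + b • y) =
      a * facetFunctional q o x + b * facetFunctional q o y := by
  have h : ∀ i, relCoord q (a • x + b • y) i = a * relCoord q x i + b * relCoord q y i := by
    intro i
    cases i with
    | none => simp [relCoord]
    | some i =>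
      simp only [relCoord, Option.elim, PiLp.add_apply, PiLp.smul_apply, smul_eq_mul]
      linear_combination q i * hab
  simp only [facetFunctional, h, Finset.mul_sum, ← Finset.sum_add_distrib]
  exact Finset.sum_congr rfl fun i _ => by ring

/-- Vertices of a model simplex around `q`. -/
noncomputable def modelVertex {d : ℕ} (q : EuclideanSpace ℝ (Fin d)) (r : ℝ)
    (o : Option (Fin d)) : EuclideanSpace ℝ (Fin d) :=
  q + WithLp.toLp 2 (o.elim (fun _ => -r) fun i => Pi.single i r)

lemma facetFunctional_modelVertex {d : ℕ} (q : EuclideanSpace ℝ (Fin d)) (r : ℝ)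
    {o o' : Option (Fin d)} (h : o' ≠ o) : facetFunctional q o (modelVertex q r o') = r := by
  have h1 : ∀ i, relCoord q (modelVertex q r o') i =
      (if i = o' then r else 0) - (if o' = none then r else 0) := by
    intro i
    cases i <;> cases o' <;> simp [relCoord, modelVertex]
  simp only [facetFunctional, h1]
  rw [if_neg (Ne.symm h)]
  simp

lemma norm_modelVertex_sub_le {d : ℕ} (hd : 1 ≤ d) (q : EuclideanSpace ℝ (Fin d)) {r : ℝ}
    (hr : 0 ≤ r) (o : Option (Fin d)) : ‖modelVertex q r o‖ ≤ ‖q‖ + r * d := by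
  refine (norm_add_le _ _).trans (add_le_add le_rfl ?_)
  have hd' : (1 : ℝ) ≤ d := by exact_mod_cast hd
  rw [EuclideanSpace.norm_eq, Real.sqrt_le_left (by positivity)]
  have : ∀ i ∈ (Finset.univ : Finset (Fin d)), ‖(WithLp.toLp 2 (o.elim (fun _ => -r)
      fun i => Pi.single i r) : EuclideanSpace ℝ (Fin d)) i‖ ^ 2 ≤ r ^ 2 := by
    intro i _
    cases o with
    | none => simp
    | some j =>
      by_cases h : i = j
      · subst h; simp
      · simp [h]; positivity
  refine (Finset.sum_le_card_nsmul _ _ _ this).trans ?_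
  simp
  nlinarith [sq_nonneg r]

/-- The comparison lemma for the complement of an interior point. -/
lemma bounds_of_simplex {d : ℕ} (hd : 1 ≤ d) {K : Set (Finset V)} (hK : IsLowerSet K)
    (f : (V → ℝ) → EuclideanSpace ℝ (Fin d)) (g : EuclideanSpace ℝ (Fin d) → (V → ℝ))
    (q : EuclideanSpace ℝ (Fin d)) (hq : ‖q‖ < 1)
    (hf : ∀ η > 0, ∃ δ > 0, ∀ x ∈ realiz K, ∀ y ∈ realiz K, dist x y < δ → dist (f x) (f y) < η)
    (hg : ∀ η > 0, ∃ δ > 0, ∀ x ∈ Metric.closedBall (0 : EuclideanSpace ℝ (Fin d)) 1,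
      ∀ y ∈ Metric.closedBall (0 : EuclideanSpace ℝ (Fin d)) 1,
      dist x y < δ → dist (g x) (g y) < η)
    {ρ : ℝ} (hρ : 0 < ρ)
    (hfD : ∀ x ∈ realiz K, f x ∈ Metric.closedBall (0 : EuclideanSpace ℝ (Fin d)) 1 ∧
      ρ ≤ dist (f x) q)
    (hgf : ∀ x ∈ realiz K, g (f x) = x)
    (ψ : (V → ℝ) → V)
    (hψ : ∀ ρ' > 0, ∃ ε > 0, ∀ σ ∈ Rips
      (g '' {x | x ∈ Metric.closedBall (0 : EuclideanSpace ℝ (Fin d)) 1 ∧ ρ' ≤ dist x q}) ε,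
      σ.image ψ ∈ K)
    (hψG : ∀ G ∈ K, ∀ x ∈ realiz {σ | σ ⊆ G}, ψ x ∈ G) :
    (∀ j < d, ∀ z ∈ chains k K j, bd k z = 0 → z ∈ bdry k K j) ∧
    ∀ z₁ ∈ chains k K d, ∀ z₂ ∈ chains k K d, bd k z₁ = 0 → bd k z₂ = 0 →
      ∃ a b : k, (a ≠ 0 ∨ b ≠ 0) ∧ a • z₁ + b • z₂ ∈ bdry k K d := by
  classical
  have hd' : (1 : ℝ) ≤ d := by exact_mod_cast hd
  set B := Metric.closedBall (0 : EuclideanSpace ℝ (Fin d)) 1 with hB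
  set r := (1 - ‖q‖) / d with hr
  have hrpos : 0 < r := div_pos (by linarith) (by linarith)
  have hrd : r * d = 1 - ‖q‖ := by rw [hr]; field_simp
  set c₀ := min r (ρ / (2 * d)) with hc₀
  have hc₀pos : 0 < c₀ := lt_min hrpos (by positivity)
  set ρ' := c₀ / (2 * (d + 1)) with hρ'
  have hρ'pos : 0 < ρ' := by positivity
  set D := {x | x ∈ B ∧ ρ' ≤ dist x q} with hD
  set H : Option (Fin d) → Set (EuclideanSpace ℝ (Fin d)) :=
    fun o => {x | x ∈ B ∧ c₀ ≤ facetFunctional q o x} with hH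
  have hHconv : ∀ o, Convex ℝ (H o) := by
    intro o x hx y hy a b ha hb hab
    refine ⟨convex_closedBall 0 1 hx.1 hy.1 ha hb hab, ?_⟩
    rw [facetFunctional_convex q x y o hab]
    nlinarith [hx.2, hy.2]
  have hHD : ∀ o, H o ⊆ D := by
    intro o x hx
    refine ⟨hx.1, ?_⟩
    have h1 := abs_facetFunctional_sub_le q x q o
    have h2 : facetFunctional q o q = 0 := by
      have : ∀ i, relCoord q q i = 0 := by intro i; cases i <;> simp [relCoord]
      simp [facetFunctional, this]
    rw [h2, sub_zero] at h1
    rw [hρ', div_le_iff₀ (by positivity)]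
    have := le_abs_self (facetFunctional q o x)
    have := hx.2
    linarith
  have hmv : ∀ o o', o' ≠ o → modelVertex q r o' ∈ H o := by
    intro o o' h
    refine ⟨?_, ?_⟩
    · rw [hB, mem_closedBall_zero_iff]
      have := norm_modelVertex_sub_le hd q hrpos.le o'
      linarith
    · rw [facetFunctional_modelVertex q r h]; exact min_le_left _ _
  have hκ' : ∀ x, ∃ o, ∀ i, relCoord q x i ≤ relCoord q x o := fun x => by
    obtain ⟨v, -, hv⟩ := Finset.univ.exists_max_image (relCoord q x) Finset.univ_nonempty
    exact ⟨v, fun w => hv w (Finset.mem_univ _)⟩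
  choose κ hκ' using hκ'
  set η := ρ / (8 * d * (d + 1)) with hη
  have hηpos : 0 < η := by positivity
  have hη2 : 8 * d * (d + 1) * η = ρ := by rw [hη]; field_simp
  have key : ∀ σ ∈ Rips {x | x ∈ B ∧ ρ ≤ dist x q} η, σ.Nonempty →
      ∃ o, (∀ y ∈ σ, y ∈ H o) ∧ ∀ y ∈ σ, κ y ≠ o := by
    rintro σ hσ ⟨x, hx⟩
    obtain ⟨o, -, ho⟩ := Finset.univ.exists_min_image (relCoord q x) Finset.univ_nonempty
    have hgap : ρ ≤ d * (relCoord q x (κ x) - relCoord q x o) := by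
      refine (hσ.1 hx).2.trans ?_
      rw [dist_eq_norm, EuclideanSpace.norm_eq]
      set t := relCoord q x (κ x) - relCoord q x o with ht
      have h0 : relCoord q x none = 0 := rfl
      have hmx := hκ' x none
      have hmn := ho none (Finset.mem_univ _)
      rw [h0] at hmx hmn
      have ht0 : 0 ≤ t := by rw [ht]; linarith
      rw [Real.sqrt_le_left (by positivity)]
      have : ∀ i ∈ (Finset.univ : Finset (Fin d)), ‖(x - q) i‖ ^ 2 ≤ t ^ 2 := by
        intro i _
        rw [Real.norm_eq_abs, sq_abs]
        refine sq_le_sq' ?_ ?_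
        · have h3 := ho (some i) (Finset.mem_univ _)
          have h4 : relCoord q x (some i) = (x - q) i := rfl
          linarith
        · have h3 := hκ' x (some i)
          have h4 : relCoord q x (some i) = (x - q) i := rfl
          linarith
      refine (Finset.sum_le_card_nsmul _ _ _ this).trans ?_
      simp
      nlinarith [sq_nonneg t]
    have hgap' : ρ / d ≤ relCoord q x (κ x) - relCoord q x o := by
      rw [div_le_iff₀ (by linarith)]; linarith
    have hρd : ρ / d = 8 * (d + 1) * η := by rw [hη]; field_simp
    refine ⟨o, fun y hy => ⟨(hσ.1 hy).1, ?_⟩, fun y hy hc => ?_⟩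
    · have h1 : relCoord q x (κ x) - relCoord q x o ≤ facetFunctional q o x := by
        rw [facetFunctional]
        exact Finset.single_le_sum (f := fun i => relCoord q x i - relCoord q x o)
          (fun i _ => sub_nonneg.2 (ho i (Finset.mem_univ _))) (Finset.mem_univ (κ x))
      have h2 := abs_le.1 (abs_facetFunctional_sub_le q x y o)
      have h3 := hσ.2 x hx y hy
      have h4 : c₀ ≤ ρ / (2 * d) := min_le_right _ _
      have h5 : ρ / (2 * d) = 4 * (d + 1) * η := by rw [hη]; field_simp; norm_num
      have h6 : 2 * ((d : ℝ) + 1) * dist x y ≤ 2 * (d + 1) * η := by gcongr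
      nlinarith
    · have h1 := abs_le.1 (abs_relCoord_sub_le q x y (κ x))
      have h2 := abs_le.1 (abs_relCoord_sub_le q x y o)
      have h3 := hσ.2 x hx y hy
      have h4 := hκ' y (κ x)
      rw [hc] at h4
      nlinarith
  set L : Set (Finset (Option (Fin d))) := {S | S ≠ Finset.univ} with hL
  have hLl : IsLowerSet L := by
    intro S T h hS hT
    exact hS (Finset.univ_subset_iff.1 (hT ▸ h))
  obtain ⟨ε, hε, hψε⟩ := hψ ρ' hρ'pos
  obtain ⟨τ, h1, h2⟩ := exists_comparison (k := k) hK hLl (D := D)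
    (D1 := {x | x ∈ B ∧ ρ ≤ dist x q}) f g hf
    (fun η hη => by
      obtain ⟨δ, hδ, h⟩ := hg η hη
      exact ⟨δ, hδ, fun x hx y hy => h x hx.1 y hy.1⟩)
    hfD hgf ψ hε hψε hψG κ (modelVertex q r) hηpos
    (fun σ hσ => by
      rcases σ.eq_empty_or_nonempty with rfl | hne
      · intro h
        have : (none : Option (Fin d)) ∈ (∅ : Finset _) := by
          rw [Finset.image_empty] at h; rw [h]; exact Finset.mem_univ _
        simp at this
      · obtain ⟨o, -, ho⟩ := key σ hσ hne
        intro h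
        have : o ∈ σ.image κ := by rw [h]; exact Finset.mem_univ _
        obtain ⟨y, hy, hyo⟩ := Finset.mem_image.1 this
        exact ho y hy hyo)
    (fun σ hσ => by
      rcases σ.eq_empty_or_nonempty with rfl | hne
      · simp
      · obtain ⟨o, ho, ho'⟩ := key σ hσ hne
        refine (convexHull_min (Set.union_subset ho ?_) (hHconv o)).trans (hHD o)
        rintro _ ⟨y, hy, rfl⟩
        exact hmv o _ (ho' y hy))
    (fun G hG => by
      obtain ⟨o, ho⟩ : ∃ o, o ∉ G := by
        by_contra h
        push Not at h
        exact hG (Finset.eq_univ_iff_forall.2 h)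
      refine (convexHull_min ?_ (hHconv o)).trans (hHD o)
      rintro _ ⟨y, hy, rfl⟩
      exact hmv o _ (fun h => ho (h ▸ hy)))
  have hfull : ∀ j, ∀ z ∈ chains k L j, bd k z = 0 →
      ∃ w ∈ chains k Set.univ (j + 1), bd k w = z := fun j z hz hb =>
    acyclicAt_of_cone (L := Set.univ) (v := none) (fun _ _ => trivial) j z
      (chains_mono (Set.subset_univ _) j hz) hb
  have hcu : (Finset.univ : Finset (Option (Fin d))).card = d + 1 := by simp
  refine ⟨fun j hj z hz hb => ?_, fun z₁ hz₁ z₂ hz₂ hb₁ hb₂ => ?_⟩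
  · refine h2 j z hz hb ?_
    obtain ⟨w, hw, hwz⟩ := hfull j _ (h1 j z hz).1 (by rw [(h1 j z hz).2, hb, map_zero])
    refine ⟨w, mem_chains.2 fun σ hσ => ?_, hwz⟩
    have := mem_chains.1 hw σ hσ
    refine ⟨fun h => ?_, this.2⟩
    have h3 := this.2
    rw [h, hcu] at h3
    omega
  · have htop : ∀ z ∈ chains k K d, bd k z = 0 →
        ∃ c : k, τ z = c • bd k (Finsupp.single Finset.univ 1) := by
      intro z hz hb
      obtain ⟨w, hw, hwz⟩ := hfull d _ (h1 d z hz).1 (by rw [(h1 d z hz).2, hb, map_zero])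
      refine ⟨w Finset.univ, ?_⟩
      rw [← hwz, ← map_smul]
      congr 1
      ext σ
      by_cases h : σ = Finset.univ
      · subst h; simp
      · have : w σ = 0 := by
          by_contra h0
          have := (mem_chains.1 hw σ h0).2
          exact h (Finset.card_eq_iff_eq_univ σ |>.1 (by rw [this]; simp))
        rw [this, Finsupp.smul_apply, Finsupp.single_apply, if_neg (Ne.symm h), smul_zero]
    obtain ⟨c₁, hc₁⟩ := htop z₁ hz₁ hb₁
    obtain ⟨c₂, hc₂⟩ := htop z₂ hz₂ hb₂
    obtain ⟨a, b, hab, h0⟩ : ∃ a b : k, (a ≠ 0 ∨ b ≠ 0) ∧ a * c₁ + b * c₂ = 0 := by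
      by_cases h : c₁ = 0
      · exact ⟨1, 0, by simp, by simp [h]⟩
      · exact ⟨c₂, c₁, Or.inr h, by rw [mul_comm, CharTwo.add_self_eq_zero]⟩
    refine ⟨a, b, hab, h2 d _ (Submodule.add_mem _ (Submodule.smul_mem _ _ hz₁)
      (Submodule.smul_mem _ _ hz₂)) (by simp [hb₁, hb₂]) ?_⟩
    rw [map_add, map_smul, map_smul, hc₁, hc₂, smul_smul, smul_smul, ← add_smul, h0, zero_smul]
    exact Submodule.zero_mem _

set_option maxHeartbeats 600000 in
/-- Homology of deletions in a triangulated ball. -/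
theorem ast_homology {d : ℕ} (hd : 1 ≤ d) {K : Set (Finset V)} (hK : IsLowerSet K)
    (Hm : realiz K ≃ₜ Metric.closedBall (0 : EuclideanSpace ℝ (Fin d)) 1) (F : Finset V)
    (hF : F ∈ K) :
    (∀ j, (F.Nonempty → j < d) → ∀ z ∈ chains k (ast K F) j, bd k z = 0 →
      z ∈ bdry k (ast K F) j) ∧
    (F.Nonempty → ∀ z₁ ∈ chains k (ast K F) d, ∀ z₂ ∈ chains k (ast K F) d,
      bd k z₁ = 0 → bd k z₂ = 0 →
      ∃ a b : k, (a ≠ 0 ∨ b ≠ 0) ∧ a • z₁ + b • z₂ ∈ bdry k (ast K F) d) := by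
  classical
  set B := Metric.closedBall (0 : EuclideanSpace ℝ (Fin d)) 1 with hB
  have hKe : ∅ ∈ K := hK (Finset.empty_subset _) hF
  have hBne : Nonempty B := ⟨⟨0, by simp [hB]⟩⟩
  obtain ⟨w₀⟩ : Nonempty (realiz K) := hBne.map Hm.symm
  have : Nonempty V := by
    by_contra h
    rw [not_nonempty_iff] at h
    have := w₀.2.2.1
    simp at this
  have hBc : CompactSpace B := isCompact_iff_compactSpace.1 (isCompact_closedBall _ _)
  have hKc : CompactSpace (realiz K) := Hm.symm.compactSpace
  have hu1 := CompactSpace.uniformContinuous_of_continuous Hm.continuous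
  have hu2 := CompactSpace.uniformContinuous_of_continuous Hm.symm.continuous
  set f : (V → ℝ) → EuclideanSpace ℝ (Fin d) := fun w =>
    if h : w ∈ realiz K then (Hm ⟨w, h⟩ : EuclideanSpace ℝ (Fin d)) else 0 with hf
  set g : EuclideanSpace ℝ (Fin d) → (V → ℝ) := fun x =>
    if h : x ∈ B then (Hm.symm ⟨x, h⟩ : V → ℝ) else 0 with hg
  have hfB : ∀ x ∈ realiz K, f x ∈ B := fun x hx => by
    simp only [hf, dif_pos hx]; exact (Hm ⟨x, hx⟩).2
  have hgK : ∀ x ∈ B, g x ∈ realiz K := fun x hx => by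
    simp only [hg, dif_pos hx]; exact (Hm.symm ⟨x, hx⟩).2
  have hgf : ∀ x ∈ realiz K, g (f x) = x := fun x hx => by
    have h1 := hfB x hx
    simp only [hf, dif_pos hx] at h1
    simp only [hg, hf, dif_pos hx]
    rw [dif_pos h1]
    simp
  have hfg : ∀ x ∈ B, f (g x) = x := fun x hx => by
    have h1 := hgK x hx
    simp only [hg, dif_pos hx] at h1
    simp only [hg, hf, dif_pos hx]
    rw [dif_pos h1]
    simp
  have hfu : ∀ η > 0, ∃ δ > 0, ∀ x ∈ realiz K, ∀ y ∈ realiz K, dist x y < δ →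
      dist (f x) (f y) < η := by
    intro η hη
    obtain ⟨δ, hδ, h⟩ := Metric.uniformContinuous_iff.1 hu1 η hη
    refine ⟨δ, hδ, fun x hx y hy hxy => ?_⟩
    simp only [hf, dif_pos hx, dif_pos hy]
    exact h (a := ⟨x, hx⟩) (b := ⟨y, hy⟩) hxy
  have hgu : ∀ η > 0, ∃ δ > 0, ∀ x ∈ B, ∀ y ∈ B, dist x y < δ → dist (g x) (g y) < η := by
    intro η hη
    obtain ⟨δ, hδ, h⟩ := Metric.uniformContinuous_iff.1 hu2 η hη
    refine ⟨δ, hδ, fun x hx y hy hxy => ?_⟩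
    simp only [hg, dif_pos hx, dif_pos hy]
    exact h (a := ⟨x, hx⟩) (b := ⟨y, hy⟩) hxy
  have hsub : ast K F ⊆ K := fun G hG => hG.1
  have hfu' : ∀ η > 0, ∃ δ > 0, ∀ x ∈ realiz (ast K F), ∀ y ∈ realiz (ast K F), dist x y < δ →
      dist (f x) (f y) < η := fun η hη => by
    obtain ⟨δ, hδ, h⟩ := hfu η hη
    exact ⟨δ, hδ, fun x hx y hy => h x (realiz_mono hsub hx) y (realiz_mono hsub hy)⟩
  have hgf' : ∀ x ∈ realiz (ast K F), g (f x) = x := fun x hx => hgf x (realiz_mono hsub hx)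
  obtain ⟨ψ, hψG, hψ⟩ := exists_approximation hK hKe F
  rcases F.eq_empty_or_nonempty with hFe | hFne
  · obtain ⟨ε, hε, hψε⟩ := hψ 1 one_pos
    refine ⟨fun j _ z hz hb => ?_, fun h => absurd hFe h.ne_empty⟩
    refine bounds_of_point (isLowerSet_ast hK F) (D := B) (D1 := B) f g hfu' hgu
      (fun x hx => hfB x (realiz_mono hsub hx)) hgf' ψ hε (fun σ hσ => ?_) hψG
      (convex_closedBall _ _) le_rfl le_rfl (c := 0) (by simp) hz hb
    refine hψε σ (fun x hx => ⟨?_, fun m _ => by simp [hFe]⟩) hσ.2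
    obtain ⟨y, hy, rfl⟩ := hσ.1 hx
    exact hgK y hy
  have hcF : (0 : ℝ) < F.card := by exact_mod_cast hFne.card_pos
  set p : V → ℝ := fun v => if v ∈ F then (F.card : ℝ)⁻¹ else 0 with hp
  have hpK : p ∈ realiz K := by
    refine ⟨fun v => ?_, ?_, ?_⟩
    · by_cases hv : v ∈ F
      · simp only [hp, if_pos hv]; exact inv_nonneg.2 hcF.le
      · simp only [hp, if_neg hv]; exact le_rfl
    · simp only [hp]
      rw [Finset.sum_ite_mem, Finset.univ_inter, Finset.sum_const, nsmul_eq_mul,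
        mul_inv_cancel₀ hcF.ne']
    · convert hF using 1
      ext v
      simp [hp, hFne.ne_empty]
  set q := f p with hq
  have hqB : q ∈ B := hfB p hpK
  have hψ' : ∀ ρ' > 0, ∃ ε > 0, ∀ σ ∈ Rips (g '' {x | x ∈ B ∧ ρ' ≤ dist x q}) ε,
      σ.image ψ ∈ ast K F := by
    intro ρ' hρ'
    obtain ⟨θ, hθ, hfθ⟩ := hfu ρ' hρ'
    obtain ⟨ε, hε, hψε⟩ := hψ θ hθ
    refine ⟨ε, hε, fun σ hσ => hψε σ (fun x hx => ?_) hσ.2⟩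
    obtain ⟨y, ⟨hyB, hyq⟩, rfl⟩ := hσ.1 hx
    have hyK := hgK y hyB
    refine ⟨hyK, fun m hm => ?_⟩
    have hdist : θ ≤ dist (g y) p := by
      by_contra h
      push Not at h
      have := hfθ _ hyK _ hpK h
      rw [hfg y hyB] at this
      linarith
    set s := 1 - F.card * m with hs
    have hr : ∀ v, 0 ≤ g y v - (if v ∈ F then m else 0) := by
      intro v
      by_cases h : v ∈ F
      · rw [if_pos h]; linarith [hm v h]
      · rw [if_neg h]; linarith [hyK.1 v]
    have hrs : ∑ v, (g y v - (if v ∈ F then m else 0)) = s := by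
      rw [Finset.sum_sub_distrib, hyK.2.1]; simp [hs]
    have hle : ∀ v, g y v - (if v ∈ F then m else 0) ≤ s := fun v => by
      rw [← hrs]
      exact Finset.single_le_sum (f := fun v => g y v - (if v ∈ F then m else 0))
        (fun i _ => hr i) (Finset.mem_univ v)
    have hs0 : 0 ≤ s := by rw [← hrs]; exact Finset.sum_nonneg fun v _ => hr v
    have hdle : dist (g y) p ≤ s := by
      rw [dist_pi_le_iff hs0]
      intro v
      rw [Real.dist_eq, abs_le]
      have h1 := hr v
      have h2 := hle v
      have h3 : (F.card : ℝ)⁻¹ - m = s / F.card := by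
        rw [eq_div_iff hcF.ne', sub_mul, inv_mul_cancel₀ hcF.ne', hs, mul_comm m]
      have h4 : s / F.card ≤ s := div_le_self hs0 (by exact_mod_cast hFne.card_pos)
      have h5 : 0 ≤ s / F.card := div_nonneg hs0 hcF.le
      by_cases hv : v ∈ F
      · simp only [hp, if_pos hv] at h1 h2 ⊢
        constructor <;> linarith
      · simp only [hp, if_neg hv] at h1 h2 ⊢
        constructor <;> linarith
    linarith
  obtain ⟨ρ₀, hρ₀, hgρ⟩ := hgu (F.card : ℝ)⁻¹ (inv_pos.2 hcF)
  set ρ := min ρ₀ 1 with hρ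
  have hρpos : 0 < ρ := lt_min hρ₀ one_pos
  have hfρ : ∀ x ∈ realiz (ast K F), f x ∈ B ∧ ρ ≤ dist (f x) q := by
    intro x hx
    have hxK := realiz_mono hsub hx
    refine ⟨hfB x hxK, ?_⟩
    by_contra h
    push Not at h
    have h1 := hgρ _ (hfB x hxK) _ hqB (h.trans_le (min_le_left _ _))
    rw [hgf x hxK, hgf p hpK] at h1
    obtain ⟨v, hv, hvx⟩ := Finset.not_subset.1 (hx.2.2.2 hFne)
    have h0 : x v = 0 := by
      by_contra h0
      exact hvx (by simpa using h0)
    have h2 := (dist_le_pi_dist x p v).trans_lt h1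
    rw [h0] at h2
    simp only [hp, if_pos hv, dist_zero_left, norm_inv, Real.norm_natCast, lt_self_iff_false] at h2
  have hq1 : ‖q‖ ≤ 1 := by simpa [hB] using hqB
  rcases hq1.lt_or_eq with hq1 | hq1
  · obtain ⟨h1, h2⟩ := bounds_of_simplex (k := k) hd (isLowerSet_ast hK F) f g q hq1 hfu' hgu hρpos
      hfρ hgf' ψ hψ' hψG
    exact ⟨fun j hj => h1 j (hj hFne), fun _ => h2⟩
  · have hall : ∀ j, ∀ z ∈ chains k (ast K F) j, bd k z = 0 → z ∈ bdry k (ast K F) j := by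
      intro j z hz hb
      obtain ⟨ε, hε, hψε⟩ := hψ' (ρ ^ 2 / 2) (half_pos (pow_pos hρpos 2))
      refine bounds_of_point (isLowerSet_ast hK F)
        (D := {x | x ∈ B ∧ ρ ^ 2 / 2 ≤ dist x q}) (D1 := {x | x ∈ B ∧ ρ ≤ dist x q}) f g hfu'
        (fun η hη => by
          obtain ⟨δ, hδ, h⟩ := hgu η hη
          exact ⟨δ, hδ, fun x hx y hy => h x hx.1 y hy.1⟩)
        hfρ hgf' ψ hε hψε hψG (H := {x | x ∈ B ∧ inner ℝ x q ≤ 1 - ρ ^ 2 / 2}) ?_ ?_ ?_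
        (c := 0) ⟨by simp [hB], ?_⟩ hz hb
      · intro x hx y hy a b ha hb hab
        refine ⟨convex_closedBall 0 1 hx.1 hy.1 ha hb hab, ?_⟩
        rw [inner_add_left, real_inner_smul_left, real_inner_smul_left]
        nlinarith [hx.2, hy.2]
      · intro x hx
        refine ⟨hx.1, ?_⟩
        have h1 := real_inner_le_norm (q - x) q
        rw [inner_sub_left, real_inner_self_eq_norm_sq, hq1, ← dist_eq_norm, dist_comm] at h1
        have := hx.2
        linarith
      · intro x hx
        refine ⟨hx.1, ?_⟩
        have h1 := norm_sub_sq_real x q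
        have h2 : ‖x‖ ≤ 1 := by simpa [hB] using hx.1
        have h3 := hx.2
        rw [dist_eq_norm] at h3
        rw [hq1] at h1
        nlinarith [norm_nonneg x, norm_nonneg (x - q)]
      · rw [inner_zero_left]
        have : ρ ≤ 1 := min_le_right _ _
        nlinarith
    refine ⟨fun j _ => hall j, fun _ z₁ hz₁ z₂ _ hb₁ _ => ⟨1, 0, by simp, ?_⟩⟩
    simpa using hall d z₁ hz₁ hb₁

end Topology

section Combinatorics

variable {k : Type*} [Field k] [CharP k 2] {V : Type*} [Fintype V] [DecidableEq V]

/-- The link of a face. -/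
def lk (K : Set (Finset V)) (F : Finset V) : Set (Finset V) := {G | Disjoint F G ∧ F ∪ G ∈ K}

lemma isLowerSet_lk {K : Set (Finset V)} (hK : IsLowerSet K) (F : Finset V) :
    IsLowerSet (lk K F) := fun _ _ h hG =>
  ⟨hG.1.mono_right h, hK (Finset.union_subset_union_right h) hG.2⟩

/-- A face with `n` elements. -/
def IsFacet (K : Set (Finset V)) (n : ℕ) (G : Finset V) : Prop := G ∈ K ∧ G.card = n

/-- Faces contained in a ridge that lies in exactly one facet. -/
def IsBdry (K : Set (Finset V)) (n : ℕ) (F : Finset V) : Prop :=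
  ∃ σ, F ⊆ σ ∧ σ ∈ K ∧ σ.card + 1 = n ∧ ∃! G, IsFacet K n G ∧ σ ⊆ G

/-- The join with a fixed set. -/
noncomputable def joinMap (k : Type*) [Field k] (F : Finset V) :
    (Finset V →₀ k) →ₗ[k] (Finset V →₀ k) :=
  Finsupp.lmapDomain k k fun G => F ∪ G

lemma joinMap_single (F G : Finset V) (c : k) :
    joinMap k F (Finsupp.single G c) = Finsupp.single (F ∪ G) c := by
  simp [joinMap, Finsupp.lmapDomain_apply, Finsupp.mapDomain_single]

/-- The part of a chain containing `F`, with `F` removed. -/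
noncomputable def cutMap (k : Type*) [Field k] (F : Finset V) :
    (Finset V →₀ k) →ₗ[k] (Finset V →₀ k) :=
  Finsupp.linearCombination k fun σ => if F ⊆ σ then Finsupp.single (σ \ F) 1 else 0

lemma cutMap_single (F σ : Finset V) : cutMap k F (Finsupp.single σ 1) =
    if F ⊆ σ then Finsupp.single (σ \ F) 1 else 0 := by
  simp [cutMap]

lemma bd_cutMap (F : Finset V) (z : Finset V →₀ k) :
    bd k (cutMap k F z) = cutMap k F (bd k z) := by
  have : (bd k).comp (cutMap k F) = (cutMap k F).comp (bd k) := by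
    ext1 σ
    ext1
    simp only [LinearMap.comp_apply, Finsupp.lsingle_apply, bd_single, map_sum, cutMap_single]
    by_cases h : F ⊆ σ
    · rw [if_pos h, bd_single]
      have hs : σ \ F ⊆ σ := Finset.sdiff_subset
      rw [← Finset.sum_subset hs]
      · refine Finset.sum_congr rfl fun v hv => ?_
        have hv' := Finset.mem_sdiff.1 hv
        rw [if_pos (Finset.subset_erase.2 ⟨h, hv'.2⟩)]
        congr 1
        ext x
        simp only [Finset.mem_erase, Finset.mem_sdiff]
        tauto
      · intro v hv hv'
        have : v ∈ F := by
          by_contra h'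
          exact hv' (Finset.mem_sdiff.2 ⟨hv, h'⟩)
        rw [if_neg]
        intro h'
        exact (Finset.mem_erase.1 (h' this)).1 rfl
    · rw [if_neg h, map_zero, Finset.sum_eq_zero]
      intro v _
      rw [if_neg]
      exact fun h' => h (h'.trans (Finset.erase_subset _ _))
  exact LinearMap.congr_fun this z

lemma bd_joinMap {K : Set (Finset V)} {F : Finset V} {j : ℕ} {z : Finset V →₀ k}
    (hz : z ∈ chains k (lk K F) j) :
    bd k (joinMap k F z) = joinMap k F (bd k z) + ∑ v ∈ F, joinMap k (F.erase v) z := by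
  refine eq_of_chains ((bd k).comp (joinMap k F))
    ((joinMap k F).comp (bd k) + ∑ v ∈ F, joinMap k (F.erase v)) (fun G hG _ => ?_) hz
    |>.trans (by simp)
  simp only [LinearMap.comp_apply, LinearMap.add_apply, LinearMap.sum_apply, joinMap_single,
    bd_single, map_sum]
  rw [Finset.sum_union hG.1, add_comm]
  have hd := Finset.disjoint_left.1 hG.1
  congr 1
  · refine Finset.sum_congr rfl fun v hv => ?_
    congr 1
    ext x
    simp only [Finset.mem_erase, Finset.mem_union]
    have := hd (a := v)
    constructor
    · tauto
    · rintro (h | h)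
      · exact ⟨fun e => this (e ▸ h) hv, Or.inl h⟩
      · exact ⟨h.1, Or.inr h.2⟩
  · refine Finset.sum_congr rfl fun v hv => ?_
    congr 1
    ext x
    simp only [Finset.mem_erase, Finset.mem_union]
    have := hd hv
    constructor
    · tauto
    · rintro (h | h)
      · exact ⟨h.1, Or.inl h.2⟩
      · exact ⟨fun e => this (e ▸ h), Or.inr h⟩

lemma joinMap_mem {K : Set (Finset V)} {F : Finset V} {j : ℕ} {z : Finset V →₀ k}
    (hz : z ∈ chains k (lk K F) j) : joinMap k F z ∈ chains k K (F.card + j) := by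
  refine map_mem_of_chains _ _ (fun G hG h => ?_) hz
  rw [joinMap_single]
  exact single_mem_chains _ hG.2 (by rw [Finset.card_union_of_disjoint hG.1, h])

lemma cutMap_joinMap {K : Set (Finset V)} {F : Finset V} {j : ℕ} {z : Finset V →₀ k}
    (hz : z ∈ chains k (lk K F) j) : cutMap k F (joinMap k F z) = z := by
  refine eq_of_chains ((cutMap k F).comp (joinMap k F)) LinearMap.id (fun G hG _ => ?_) hz
  simp only [LinearMap.comp_apply, joinMap_single, cutMap_single, LinearMap.id_apply]
  rw [if_pos Finset.subset_union_left, Finset.union_sdiff_cancel_left hG.1]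

lemma cutMap_mem {K : Set (Finset V)} {F : Finset V} {j : ℕ} {z : Finset V →₀ k}
    (hz : z ∈ chains k K (F.card + j)) : cutMap k F z ∈ chains k (lk K F) j := by
  refine map_mem_of_chains _ _ (fun G hG h => ?_) hz
  rw [cutMap_single]
  by_cases hF : F ⊆ G
  · rw [if_pos hF]
    refine single_mem_chains (L := lk K F) _ ⟨Finset.disjoint_sdiff, ?_⟩ ?_
    · rwa [Finset.union_sdiff_of_subset hF]
    · rw [Finset.card_sdiff_of_subset hF, h]; omega
  · rw [if_neg hF]; exact Submodule.zero_mem _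

lemma cutMap_ast {K : Set (Finset V)} {F : Finset V} (hF : F.Nonempty) {j : ℕ}
    {z : Finset V →₀ k} (hz : z ∈ chains k (ast K F) j) : cutMap k F z = 0 := by
  refine eq_of_chains (cutMap k F) 0 (fun G hG _ => ?_) hz
  rw [cutMap_single, if_neg (hG.2 hF)]
  rfl

lemma sum_joinMap_mem {K : Set (Finset V)} (hK : IsLowerSet K) {F : Finset V} {j : ℕ}
    {z : Finset V →₀ k} (hz : z ∈ chains k (lk K F) j) :
    ∑ v ∈ F, joinMap k (F.erase v) z ∈ chains k (ast K F) (F.card - 1 + j) := by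
  refine Submodule.sum_mem _ fun v hv => map_mem_of_chains _ _ (fun G hG h => ?_) hz
  rw [joinMap_single]
  refine single_mem_chains (L := ast K F) _ ⟨hK (Finset.union_subset_union_left (Finset.erase_subset _ _)) hG.2,
    fun _ h' => ?_⟩ ?_
  · have := h' hv
    simp only [Finset.mem_union, Finset.mem_erase, ne_eq, not_true_eq_false, false_and,
      false_or] at this
    exact Finset.disjoint_left.1 hG.1 hv this
  · rw [Finset.card_union_of_disjoint (hG.1.mono_left (Finset.erase_subset _ _)),
      Finset.card_erase_of_mem hv, h]

/-- The homological input about deletions of faces in a ball. -/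
structure DeletionData (k : Type*) [Field k] (d : ℕ) (K : Set (Finset V)) : Prop where
  one_le : 1 ≤ d
  lower : IsLowerSet K
  empty_mem : ∅ ∈ K
  card_le : ∀ G ∈ K, G.card ≤ d + 1
  acyclic : ∀ j, ∀ z ∈ chains k K j, bd k z = 0 → z ∈ bdry k K j
  low : ∀ F ∈ K, F.Nonempty → ∀ j < d, ∀ z ∈ chains k (ast K F) j, bd k z = 0 →
    z ∈ bdry k (ast K F) j
  top : ∀ F ∈ K, F.Nonempty → ∀ z₁ ∈ chains k (ast K F) d, ∀ z₂ ∈ chains k (ast K F) d,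
    bd k z₁ = 0 → bd k z₂ = 0 →
      ∃ a b : k, (a ≠ 0 ∨ b ≠ 0) ∧ a • z₁ + b • z₂ ∈ bdry k (ast K F) d

lemma mem_bdry_lk_of_aux {K : Set (Finset V)} {F : Finset V} (hF : F.Nonempty) {j : ℕ}
    {z u : Finset V →₀ k} (hz : z ∈ chains k (lk K F) j) (hbz : bd k z = 0)
    (hac : ∀ z ∈ chains k K (F.card + j), bd k z = 0 → z ∈ bdry k K (F.card + j))
    (hu : u ∈ chains k (ast K F) (F.card + j))
    (hbu : bd k u = ∑ v ∈ F, joinMap k (F.erase v) z) : z ∈ bdry k (lk K F) j := by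
  have hJ := bd_joinMap hz
  rw [hbz, map_zero, zero_add] at hJ
  have hmem : joinMap k F z + u ∈ chains k K (F.card + j) :=
    Submodule.add_mem _ (joinMap_mem hz) (chains_mono (fun G hG => hG.1) _ hu)
  obtain ⟨y, hy, hyz⟩ := hac _ hmem (by rw [map_add, hJ, hbu, add_self_mod])
  refine ⟨cutMap k F y, cutMap_mem (by rwa [add_assoc] at hy), ?_⟩
  rw [bd_cutMap, hyz, map_add, cutMap_joinMap hz, cutMap_ast hF hu, add_zero]

lemma lk_empty (K : Set (Finset V)) : lk K ∅ = K := by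
  ext G; simp [lk]

theorem DeletionData.lk_low {d : ℕ} {K : Set (Finset V)} (h : DeletionData k d K) {F : Finset V}
    (hF : F ∈ K) {j : ℕ} (hj : j + F.card < d + 1) {z : Finset V →₀ k}
    (hz : z ∈ chains k (lk K F) j) (hbz : bd k z = 0) : z ∈ bdry k (lk K F) j := by
  rcases F.eq_empty_or_nonempty with rfl | hne
  · rw [lk_empty] at hz ⊢
    exact h.acyclic j z hz hbz
  have hJ := bd_joinMap hz
  rw [hbz, map_zero, zero_add] at hJ
  have hcard := hne.card_pos
  have he : F.card - 1 + j + 1 = F.card + j := by omega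
  obtain ⟨u, hu, hbu⟩ := h.low F hF hne (F.card - 1 + j) (by omega) _ (sum_joinMap_mem h.lower hz)
    (by rw [← hJ, bd_bd])
  exact mem_bdry_lk_of_aux hne hz hbz (h.acyclic _) (by rwa [he] at hu) hbu

lemma chains_eq_zero {L : Set (Finset V)} {j : ℕ} (hL : ∀ G ∈ L, G.card ≠ j) {z : Finset V →₀ k}
    (hz : z ∈ chains k L j) : z = 0 := by
  ext σ
  by_contra h0
  have := mem_chains.1 hz σ h0
  exact hL _ this.1 this.2

theorem DeletionData.lk_top {d : ℕ} {K : Set (Finset V)} (h : DeletionData k d K) {F : Finset V}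
    (hF : F ∈ K) (hne : F.Nonempty) {j : ℕ} (hj : j + F.card = d + 1) {z₁ z₂ : Finset V →₀ k}
    (hz₁ : z₁ ∈ chains k (lk K F) j) (hz₂ : z₂ ∈ chains k (lk K F) j) (hb₁ : bd k z₁ = 0)
    (hb₂ : bd k z₂ = 0) : ∃ a b : k, (a ≠ 0 ∨ b ≠ 0) ∧ a • z₁ + b • z₂ = 0 := by
  have hcard := hne.card_pos
  have hd : F.card - 1 + j = d := by omega
  have he : d + 1 = F.card + j := by omega
  have hJ : ∀ z ∈ chains k (lk K F) j, bd k z = 0 →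
      bd k (∑ v ∈ F, joinMap k (F.erase v) z) = 0 := fun z hz hb => by
    have hJ := bd_joinMap hz
    rw [hb, map_zero, zero_add] at hJ
    rw [← hJ, bd_bd]
  obtain ⟨a, b, hab, u, hu, hbu⟩ := h.top F hF hne _ (hd ▸ sum_joinMap_mem h.lower hz₁) _
    (hd ▸ sum_joinMap_mem h.lower hz₂) (hJ _ hz₁ hb₁) (hJ _ hz₂ hb₂)
  refine ⟨a, b, hab, ?_⟩
  have hz : a • z₁ + b • z₂ ∈ chains k (lk K F) j :=
    Submodule.add_mem _ (Submodule.smul_mem _ _ hz₁) (Submodule.smul_mem _ _ hz₂)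
  obtain ⟨w, hw, hwz⟩ := mem_bdry_lk_of_aux (u := u) hne hz (by simp [hb₁, hb₂]) (h.acyclic _)
    (by rwa [he] at hu) (by
      rw [hbu]
      simp only [map_add, map_smul, Finset.sum_add_distrib, Finset.smul_sum])
  rw [← hwz, chains_eq_zero (fun G hG hc => ?_) hw, map_zero]
  have := h.card_le _ hG.2
  rw [Finset.card_union_of_disjoint hG.1] at this
  omega

theorem DeletionData.exists_facet {d : ℕ} {K : Set (Finset V)} (h : DeletionData k d K)
    {F : Finset V} (hF : F ∈ K) : ∃ G, IsFacet K (d + 1) G ∧ F ⊆ G := by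
  obtain ⟨G, ⟨hG, hFG⟩, hmax⟩ := Set.Finite.exists_maximalFor Finset.card
    {G | G ∈ K ∧ F ⊆ G} (Set.toFinite _) ⟨F, hF, subset_rfl⟩
  refine ⟨G, ⟨hG, ?_⟩, hFG⟩
  by_contra hc
  have hlt : G.card < d + 1 := lt_of_le_of_ne (h.card_le G hG) hc
  obtain ⟨w, hw, hwz⟩ := h.lk_low (z := Finsupp.single ∅ 1) hG (j := 0) (by omega)
    (single_mem_chains (L := lk K G) _ ⟨by simp, by simpa using hG⟩ rfl) (by simp [bd_single])
  rw [chains_eq_zero (fun H hH hc => ?_) hw, map_zero] at hwz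
  · have := DFunLike.congr_fun hwz ∅
    simp at this
  · have h1 := hmax (j := G ∪ H) ⟨hH.2, hFG.trans Finset.subset_union_left⟩
      (Finset.card_le_card Finset.subset_union_left)
    rw [Finset.card_union_of_disjoint hH.1, hc] at h1
    omega

lemma bd_apply (z : Finset V →₀ k) (σ : Finset V) :
    bd k z σ = ∑ v ∈ σᶜ, z (insert v σ) := by
  have : (Finsupp.lapply σ).comp (bd k) =
      ∑ v ∈ σᶜ, (Finsupp.lapply (insert v σ) : (Finset V →₀ k) →ₗ[k] k) := by
    ext1 τ
    ext1
    simp only [LinearMap.comp_apply, Finsupp.lsingle_apply, bd_single, LinearMap.sum_apply,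
      Finsupp.lapply_apply, Finsupp.coe_finsetSum, Finset.sum_apply, Finsupp.single_apply]
    by_cases h : σ ⊆ τ ∧ σ.card + 1 = τ.card
    · obtain ⟨v, hv⟩ : ∃ v, τ \ σ = {v} := by
        rw [← Finset.card_eq_one, Finset.card_sdiff_of_subset h.1]; omega
      have hτ : τ = insert v σ := by
        rw [Finset.insert_eq, ← hv, Finset.sdiff_union_of_subset h.1]
      have hvσ : v ∉ σ := by
        have : v ∈ τ \ σ := by rw [hv]; simp
        exact (Finset.mem_sdiff.1 this).2
      rw [Finset.sum_eq_single v, Finset.sum_eq_single v, hτ, Finset.erase_insert hvσ]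
      · simp
      · intro w hw hwv
        rw [if_neg]
        rw [hτ]
        intro he
        have : w ∈ insert v σ := by rw [he]; simp
        simp only [Finset.mem_insert] at this
        simp only [Finset.mem_compl] at hw
        tauto
      · intro h; simp [hvσ] at h
      · intro w hw hwv
        rw [if_neg]
        intro he
        have hvw : v ∉ τ.erase w := by rw [he]; exact hvσ
        apply hvw
        rw [hτ]; simp [Ne.symm hwv]
      · intro h; exact absurd (by rw [hτ]; simp) h
    · rw [Finset.sum_eq_zero, Finset.sum_eq_zero]
      · intro v hv
        rw [if_neg]
        rintro rfl
        apply h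
        refine ⟨Finset.subset_insert _ _, ?_⟩
        rw [Finset.card_insert_of_notMem (by simpa using hv)]
      · intro v hv
        rw [if_neg]
        rintro rfl
        apply h
        refine ⟨Finset.erase_subset _ _, Finset.card_erase_add_one hv⟩
  have := LinearMap.congr_fun this z
  simpa using this

/-- A ridge lies in at most two facets. -/
theorem DeletionData.ridge_le_two {d : ℕ} {K : Set (Finset V)} (h : DeletionData k d K)
    {σ : Finset V} (hσ : σ.card = d) {a b c : V} (ha : a ∉ σ) (hb : b ∉ σ) (hc : c ∉ σ)
    (hab : a ≠ b) (hac : a ≠ c) (hbc : b ≠ c) (hA : insert a σ ∈ K) (hB : insert b σ ∈ K)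
    (hC : insert c σ ∈ K) : False := by
  have hσK : σ ∈ K := h.lower (Finset.subset_insert a σ) hA
  have hne : σ.Nonempty := by
    rw [← Finset.card_pos, hσ]; exact h.one_le
  have key : ∀ x : V, x ∉ σ → insert x σ ∈ K →
      (Finsupp.single {x} 1 : Finset V →₀ k) ∈ chains k (lk K σ) 1 := fun x hx hxK =>
    single_mem_chains (L := lk K σ) _ ⟨by simpa using hx, by rwa [Finset.union_comm, ← Finset.insert_eq]⟩
      (by simp)
  have hb1 : ∀ x : V, bd k (Finsupp.single {x} 1) = Finsupp.single ∅ (1 : k) := fun x => by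
    simp [bd_single]
  obtain ⟨α, β, hαβ, h0⟩ := h.lk_top hσK hne (j := 1) (by omega)
    (Submodule.add_mem _ (key a ha hA) (key b hb hB))
    (Submodule.add_mem _ (key b hb hB) (key c hc hC))
    (by rw [map_add, hb1, hb1, add_self_mod]) (by rw [map_add, hb1, hb1, add_self_mod])
  have h1 := DFunLike.congr_fun h0 {a}
  have h2 := DFunLike.congr_fun h0 {c}
  simp [hab.symm, hac.symm] at h1
  simp [hac, hbc] at h2
  tauto

/-- Facets containing a face are connected through ridges containing it. -/
theorem DeletionData.conn {d : ℕ} {K : Set (Finset V)} (h : DeletionData k d K) {X : Type*}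
    (f : Finset V → X) : ∀ (e : ℕ) (F : Finset V), F ∈ K → F.card + e = d + 1 →
    (∀ G₁ G₂, IsFacet K (d + 1) G₁ → IsFacet K (d + 1) G₂ → F ⊆ G₁ ∩ G₂ → (G₁ ∩ G₂).card = d →
      f G₁ = f G₂) →
    ∀ G₁ G₂, IsFacet K (d + 1) G₁ → IsFacet K (d + 1) G₂ → F ⊆ G₁ → F ⊆ G₂ → f G₁ = f G₂ := by
  intro e
  induction e with
  | zero =>
    intro F hF hc _ G₁ G₂ h₁ h₂ hF₁ hF₂
    rw [← Finset.eq_of_subset_of_card_le hF₁ (by rw [h₁.2]; omega),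
      ← Finset.eq_of_subset_of_card_le hF₂ (by rw [h₂.2]; omega)]
  | succ e ih =>
    intro F hF hc hadj G₁ G₂ h₁ h₂ hF₁ hF₂
    rcases Nat.eq_zero_or_pos e with rfl | he
    · by_cases hG : G₁ = G₂
      · rw [hG]
      refine hadj G₁ G₂ h₁ h₂ (Finset.subset_inter hF₁ hF₂) (le_antisymm ?_ ?_)
      · by_contra hlt
        push Not at hlt
        have e1 := Finset.eq_of_subset_of_card_le (Finset.inter_subset_left (s₁ := G₁) (s₂ := G₂))
          (by rw [h₁.2]; omega)
        have e2 := Finset.eq_of_subset_of_card_le (Finset.inter_subset_right (s₁ := G₁) (s₂ := G₂))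
          (by rw [h₂.2]; omega)
        exact hG (e1.symm.trans e2)
      · have := Finset.card_le_card (Finset.subset_inter hF₁ hF₂)
        omega
    have hex : ∀ v, ∃ x : X, ∀ G, IsFacet K (d + 1) G → F ⊆ G → v ∈ G → v ∉ F → f G = x := by
      intro v
      by_cases hv : ∃ G, IsFacet K (d + 1) G ∧ F ⊆ G ∧ v ∈ G ∧ v ∉ F
      · obtain ⟨G, hG, hFG, hvG, hvF⟩ := hv
        refine ⟨f G, fun G' hG' hFG' hvG' _ => ?_⟩
        have hsub : insert v F ⊆ G := Finset.insert_subset hvG hFG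
        refine ih (insert v F) (h.lower hsub hG.1) ?_ ?_ G' G hG' hG
          (Finset.insert_subset hvG' hFG') hsub
        · rw [Finset.card_insert_of_notMem hvF]; omega
        · exact fun A B hA hB hAB => hadj A B hA hB ((Finset.subset_insert _ _).trans hAB)
      · exact ⟨f ∅, fun G hG hFG hvG hvF => absurd ⟨G, hG, hFG, hvG, hvF⟩ hv⟩
    choose g hg using hex
    have hver : ∀ G, IsFacet K (d + 1) G → F ⊆ G → ∃ v ∈ G, v ∉ F := by
      intro G hG hFG
      by_contra hcon
      push Not at hcon
      have := Finset.card_le_card (show G ⊆ F from hcon)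
      rw [hG.2] at this; omega
    obtain ⟨v₁, hv₁, hv₁F⟩ := hver G₁ h₁ hF₁
    obtain ⟨v₂, hv₂, hv₂F⟩ := hver G₂ h₂ hF₂
    rw [hg v₁ G₁ h₁ hF₁ hv₁ hv₁F, hg v₂ G₂ h₂ hF₂ hv₂ hv₂F]
    classical
    have key : ∀ G, IsFacet K (d + 1) G → F ⊆ G → ∀ x ∈ G, x ∉ F →
        (Finsupp.single {x} 1 : Finset V →₀ k) ∈ chains k (lk K F) 1 := fun G hG hFG x hx hxF =>
      single_mem_chains (L := lk K F) _ ⟨by simpa using hxF,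
        h.lower (Finset.union_subset hFG (by simpa using hx)) hG.1⟩ (by simp)
    have hb1 : ∀ x : V, bd k (Finsupp.single {x} 1) = Finsupp.single ∅ (1 : k) := fun x => by
      simp [bd_single]
    obtain ⟨w, hw, hwz⟩ := h.lk_low hF (j := 1) (by omega)
      (Submodule.add_mem _ (key G₁ h₁ hF₁ v₁ hv₁ hv₁F) (key G₂ h₂ hF₂ v₂ hv₂ hv₂F))
      (by rw [map_add, hb1, hb1, add_self_mod])
    set φ : (Finset V →₀ k) →ₗ[k] k :=
      Finsupp.linearCombination k fun σ => if ∃ v ∈ σ, g v = g v₁ then 1 else 0 with hφ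
    have hφs : ∀ v, φ (Finsupp.single {v} 1) = if g v = g v₁ then 1 else 0 := fun v => by
      simp [hφ]
    have h0 : φ (bd k w) = 0 := by
      refine eq_of_chains (φ.comp (bd k)) 0 (fun σ hσ hc2 => ?_) hw
      obtain ⟨x, y, hxy, rfl⟩ := Finset.card_eq_two.1 hc2
      obtain ⟨G, hG, hFG⟩ := h.exists_facet hσ.2
      have hd := hσ.1
      have hgx : g x = g y := by
        have hx : x ∈ F ∪ {x, y} := by simp
        have hy : y ∈ F ∪ {x, y} := by simp
        have hFG' : F ⊆ G := Finset.subset_union_left.trans hFG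
        rw [← hg x G hG hFG' (hFG hx) (fun hxF => Finset.disjoint_left.1 hd hxF (by simp)),
          ← hg y G hG hFG' (hFG hy) (fun hxF => Finset.disjoint_left.1 hd hxF (by simp))]
      rw [LinearMap.comp_apply, bd_single, Finset.sum_pair hxy, map_add]
      have e1 : ({x, y} : Finset V).erase x = {y} := by
        ext t; simp only [Finset.mem_erase, Finset.mem_insert, Finset.mem_singleton]
        constructor
        · tauto
        · rintro rfl; exact ⟨hxy.symm, Or.inr rfl⟩
      have e2 : ({x, y} : Finset V).erase y = {x} := by
        ext t; simp only [Finset.mem_erase, Finset.mem_insert, Finset.mem_singleton]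
        constructor
        · tauto
        · rintro rfl; exact ⟨hxy, Or.inl rfl⟩
      rw [e1, e2, hφs, hφs, hgx, CharTwo.add_self_eq_zero]
      rfl
    rw [hwz, map_add, hφs, hφs, if_pos rfl] at h0
    by_contra hne
    rw [if_neg (Ne.symm hne)] at h0
    simp at h0

lemma exists_insert_of_ridge {n : ℕ} {σ G : Finset V} (h : σ ⊆ G) (hG : G.card = n)
    (hσ : σ.card + 1 = n) : ∃ v, v ∉ σ ∧ G = insert v σ := by
  obtain ⟨v, hv⟩ : ∃ v, G \ σ = {v} := by
    rw [← Finset.card_eq_one, Finset.card_sdiff_of_subset h]; omega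
  refine ⟨v, ?_, ?_⟩
  · have : v ∈ G \ σ := by rw [hv]; simp
    exact (Finset.mem_sdiff.1 this).2
  · rw [Finset.insert_eq, ← hv, Finset.sdiff_union_of_subset h]

/-- A ridge that is not in the boundary lies in exactly two facets. -/
theorem DeletionData.two_facets {d : ℕ} {K : Set (Finset V)} (h : DeletionData k d K)
    {σ : Finset V} (hσK : σ ∈ K) (hσ : σ.card = d) (hb : ¬ IsBdry K (d + 1) σ) :
    ∃ a b, a ≠ b ∧ a ∉ σ ∧ b ∉ σ ∧ insert a σ ∈ K ∧ insert b σ ∈ K ∧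
      ∀ c, c ∉ σ → insert c σ ∈ K → c = a ∨ c = b := by
  obtain ⟨G, hG, hσG⟩ := h.exists_facet hσK
  obtain ⟨a, ha, rfl⟩ := exists_insert_of_ridge hσG hG.2 (by omega)
  have : ∃ G', (IsFacet K (d + 1) G' ∧ σ ⊆ G') ∧ G' ≠ insert a σ := by
    by_contra hcon
    push Not at hcon
    exact hb ⟨σ, subset_rfl, hσK, by omega, insert a σ, ⟨hG, hσG⟩, fun G' hG' => hcon G' hG'⟩
  obtain ⟨G', ⟨hG', hσG'⟩, hne⟩ := this
  obtain ⟨b, hb', rfl⟩ := exists_insert_of_ridge hσG' hG'.2 (by omega)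
  have hab : a ≠ b := by rintro rfl; exact hne rfl
  refine ⟨a, b, hab, ha, hb', hG.1, hG'.1, fun c hc hcK => ?_⟩
  by_contra hcon
  push Not at hcon
  exact h.ridge_le_two hσ ha hb' hc hab hcon.1.symm hcon.2.symm hG.1 hG'.1 hcK

/-- There are no top-dimensional cycles in the link of a boundary face. -/
theorem DeletionData.lk_bdry {d : ℕ} {K : Set (Finset V)} (h : DeletionData k d K)
    {F : Finset V} (hF : IsBdry K (d + 1) F) {j : ℕ} (hj : j + F.card = d + 1)
    {z : Finset V →₀ k} (hz : z ∈ chains k (lk K F) j) (hbz : bd k z = 0) : z = 0 := by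
  obtain ⟨σ, hFσ, hσK, hσc, G₀, ⟨hG₀, hσG₀⟩, huniq⟩ := hF
  have hσd : σ.card = d := by omega
  have hFK : F ∈ K := h.lower hFσ hσK
  set f : Finset V → k := fun G => z (G \ F) with hf
  have hbda : ∀ τ, F ⊆ τ → ∑ v ∈ τᶜ, f (insert v τ) = 0 := by
    intro τ hFτ
    have h1 := bd_apply z (τ \ F)
    rw [hbz] at h1
    simp only [Finsupp.coe_zero, Pi.zero_apply] at h1
    rw [h1]
    have hs : τᶜ ⊆ (τ \ F)ᶜ := Finset.compl_subset_compl.2 Finset.sdiff_subset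
    rw [← Finset.sum_subset hs]
    · refine Finset.sum_congr rfl fun v hv => ?_
      simp only [hf]
      congr 1
      rw [Finset.insert_sdiff_of_notMem _ (fun hvF => by simpa using (Finset.mem_compl.1 hv) (hFτ hvF))]
    · intro v hv hv'
      by_contra h0
      have h2 := (mem_chains.1 hz _ h0).1.1
      have hvF : v ∈ F := by
        simp only [Finset.mem_compl, Finset.mem_sdiff, not_and, not_not] at hv hv'
        exact hv hv'
      exact Finset.disjoint_left.1 h2 hvF (by simp)
  have hfz : ∀ G, F ⊆ G → f G ≠ 0 → IsFacet K (d + 1) G := by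
    intro G hFG h0
    obtain ⟨h1, h2⟩ := mem_chains.1 hz _ h0
    have := h1.2
    rw [Finset.union_sdiff_of_subset hFG] at this
    refine ⟨this, ?_⟩
    rw [Finset.card_sdiff_of_subset hFG] at h2
    have := Finset.card_le_card hFG
    omega
  have hfG₀ : f G₀ = 0 := by
    obtain ⟨v, hv, rfl⟩ := exists_insert_of_ridge hσG₀ hG₀.2 hσc
    rw [← hbda σ hFσ]
    symm
    refine Finset.sum_eq_single v (fun w hw hwv => ?_) (fun hv' => by simp [hv] at hv')
    by_contra h0
    have := huniq _ ⟨hfz _ (hFσ.trans (Finset.subset_insert _ _)) h0, Finset.subset_insert _ _⟩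
    have hw' : w ∈ insert v σ := by rw [← this]; simp
    simp only [Finset.mem_insert, hwv, false_or] at hw'
    exact Finset.mem_compl.1 hw hw'
  have hconst := h.conn f j F hFK (by omega) (by
    intro G₁ G₂ h₁ h₂ hFτ hτ
    obtain ⟨a, ha, ea⟩ := exists_insert_of_ridge (Finset.inter_subset_left (s₁ := G₁) (s₂ := G₂))
      h₁.2 (by omega)
    obtain ⟨b, hb, eb⟩ := exists_insert_of_ridge (Finset.inter_subset_right (s₁ := G₁) (s₂ := G₂))
      h₂.2 (by omega)
    set τ := G₁ ∩ G₂ with hτd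
    have hab : a ≠ b := by
      rintro rfl
      have : τ = G₁ := by rw [hτd, eb, ea, Finset.inter_self]
      rw [this, h₁.2] at hτ
      omega
    have hs := hbda τ hFτ
    have h12 : ∑ v ∈ ({a, b} : Finset V), f (insert v τ) = ∑ v ∈ τᶜ, f (insert v τ) := by
      refine Finset.sum_subset ?_ ?_
      · intro x hx
        simp only [Finset.mem_insert, Finset.mem_singleton] at hx
        rcases hx with rfl | rfl <;> simpa
      · intro c hc hcab
        by_contra h0
        have hG := hfz _ (hFτ.trans (Finset.subset_insert _ _)) h0
        simp only [Finset.mem_insert, Finset.mem_singleton, not_or] at hcab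
        exact h.ridge_le_two hτ ha hb (by simpa using hc) hab (Ne.symm hcab.1) (Ne.symm hcab.2)
          (ea ▸ h₁.1) (eb ▸ h₂.1) hG.1
    rw [hs, Finset.sum_pair hab, ← ea, ← eb] at h12
    exact (CharTwo.add_eq_zero.1 h12))
  ext τ
  by_contra h0
  obtain ⟨⟨h1, h2⟩, h3⟩ := mem_chains.1 hz τ h0
  have hFG : F ⊆ F ∪ τ := Finset.subset_union_left
  have hτ : (F ∪ τ) \ F = τ := Finset.union_sdiff_cancel_left h1
  have := hconst (F ∪ τ) G₀ ⟨h2, by rw [Finset.card_union_of_disjoint h1]; omega⟩ hG₀ hFG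
    (hFσ.trans hσG₀)
  rw [hfG₀] at this
  simp only [hf, hτ] at this
  exact h0 this

/-- The boundary is not empty. -/
theorem DeletionData.isBdry_empty {d : ℕ} {K : Set (Finset V)} (h : DeletionData k d K) :
    IsBdry K (d + 1) ∅ := by
  classical
  by_contra hcon
  have hno : ∀ F, ¬ IsBdry K (d + 1) F := fun F ⟨σ, _, hσ⟩ => hcon ⟨σ, Finset.empty_subset _, hσ⟩
  set z : Finset V →₀ k := ∑ G ∈ Finset.univ.filter (IsFacet K (d + 1)), Finsupp.single G 1 with hz
  have hzv : ∀ G, z G = if IsFacet K (d + 1) G then 1 else 0 := fun G => by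
    simp only [hz, Finsupp.coe_finsetSum, Finset.sum_apply, Finsupp.single_apply]
    rw [Finset.sum_ite_eq']
    simp
  have hzc : z ∈ chains k K (d + 1) := mem_chains.2 fun σ hσ => by
    by_contra h'
    exact hσ ((hzv σ).trans (if_neg h'))
  have hbz : bd k z = 0 := by
    ext σ
    rw [bd_apply]
    simp only [hzv, Finsupp.coe_zero, Pi.zero_apply]
    by_cases hσ : σ ∈ K ∧ σ.card = d
    · obtain ⟨a, b, hab, ha, hb, haK, hbK, huniq⟩ := h.two_facets hσ.1 hσ.2 (hno σ)
      rw [← Finset.sum_subset (s₁ := {a, b}), Finset.sum_pair hab, if_pos, if_pos,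
        CharTwo.add_self_eq_zero]
      · exact ⟨hbK, by rw [Finset.card_insert_of_notMem hb, hσ.2]⟩
      · exact ⟨haK, by rw [Finset.card_insert_of_notMem ha, hσ.2]⟩
      · intro x hx
        simp only [Finset.mem_insert, Finset.mem_singleton] at hx
        rcases hx with rfl | rfl <;> simpa
      · intro c hc hcab
        rw [if_neg]
        intro hG
        simp only [Finset.mem_insert, Finset.mem_singleton] at hcab
        exact hcab (huniq c (by simpa using hc) hG.1)
    · refine Finset.sum_eq_zero fun v hv => ?_
      rw [if_neg]
      intro hG
      apply hσ
      refine ⟨h.lower (Finset.subset_insert _ _) hG.1, ?_⟩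
      have := hG.2
      rw [Finset.card_insert_of_notMem (by simpa using hv)] at this
      omega
  obtain ⟨w, hw, hwz⟩ := h.acyclic _ z hzc hbz
  rw [chains_eq_zero (fun G hG hc => by have := h.card_le G hG; omega) hw, map_zero] at hwz
  obtain ⟨G, hG, _⟩ := h.exists_facet h.empty_mem
  have := hzv G
  rw [← hwz, if_pos hG] at this
  simp at this

end Combinatorics
section FaceIdeals
open MvPolynomial
attribute [local instance] MvPolynomial.gradedAlgebra

variable {k : Type*} [Field k] {V : Type*} [Fintype V] [DecidableEq V]

/-- The linear form with given coefficients. -/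
noncomputable def lin (u : V → k) : MvPolynomial V k := ∑ v, C (u v) * X v

/-- The Stanley–Reisner ideal. -/
noncomputable def faceIdeal (k : Type*) [Field k] (Δ : Set (Finset V)) :
    Ideal (MvPolynomial V k) :=
  Ideal.span ((fun m => monomial m (1 : k)) '' {m | m.support ∉ Δ})

/-- The Stanley–Reisner ideal together with the first `s` linear forms. -/
noncomputable def AI (Δ : Set (Finset V)) (l : ℕ → V → k) (s : ℕ) : Ideal (MvPolynomial V k) :=
  faceIdeal k Δ ⊔ Ideal.span ((fun i => lin (l i)) '' {i | i < s})

lemma mem_faceIdeal {Δ : Set (Finset V)} (hΔ : IsLowerSet Δ) {p : MvPolynomial V k} :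
    p ∈ faceIdeal k Δ ↔ ∀ m, m.support ∈ Δ → coeff m p = 0 := by
  rw [faceIdeal, mem_ideal_span_monomial_image]
  constructor
  · intro h m hm
    by_contra h0
    obtain ⟨m', hm', hle⟩ := h m (mem_support_iff.2 h0)
    exact hm' (hΔ (Finsupp.support_mono hle) hm)
  · intro h m hm
    exact ⟨m, fun h' => mem_support_iff.1 hm (h m h'), le_rfl⟩

lemma faceIdeal_anti {Δ Δ' : Set (Finset V)} (h : Δ ⊆ Δ') : faceIdeal k Δ' ≤ faceIdeal k Δ :=
  Ideal.span_mono (Set.image_mono fun _ hm h' => hm (h h'))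

lemma AI_anti {Δ Δ' : Set (Finset V)} (h : Δ ⊆ Δ') (l : ℕ → V → k) (s : ℕ) :
    AI Δ' l s ≤ AI Δ l s :=
  sup_le_sup_right (faceIdeal_anti h) _

lemma AI_zero (Δ : Set (Finset V)) (l : ℕ → V → k) : AI Δ l 0 = faceIdeal k Δ := by
  simp [AI]

lemma AI_succ (Δ : Set (Finset V)) (l : ℕ → V → k) (s : ℕ) :
    AI Δ l (s + 1) = AI Δ l s ⊔ Ideal.span {lin (l s)} := by
  have : {i | i < s + 1} = {i | i < s} ∪ {s} := by
    ext i; simp only [Set.mem_ofPred_eq, Set.mem_union, Set.mem_singleton_iff]; omega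
  rw [AI, AI, this, Set.image_union, Set.image_singleton, Ideal.span_union, sup_assoc]

lemma AI_mono (Δ : Set (Finset V)) (l : ℕ → V → k) {s t : ℕ} (h : s ≤ t) : AI Δ l s ≤ AI Δ l t :=
  sup_le_sup_left (Ideal.span_mono (Set.image_mono fun _ hi => lt_of_lt_of_le hi h)) _

lemma faceIdeal_le_AI (Δ : Set (Finset V)) (l : ℕ → V → k) (s : ℕ) : faceIdeal k Δ ≤ AI Δ l s :=
  le_sup_left

lemma lin_mem_AI (Δ : Set (Finset V)) (l : ℕ → V → k) {i s : ℕ} (h : i < s) :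
    lin (l i) ∈ AI Δ l s :=
  Ideal.mem_sup_right (Ideal.subset_span ⟨i, h, rfl⟩)

lemma AI_eq_top {Δ : Set (Finset V)} (h : ∅ ∉ Δ) (l : ℕ → V → k) (s : ℕ) : AI Δ l s = ⊤ := by
  rw [Ideal.eq_top_iff_one]
  refine faceIdeal_le_AI _ _ _ (Ideal.subset_span ⟨0, by simpa using h, ?_⟩)
  simp

lemma isHomogeneous_lin (u : V → k) : (lin u).IsHomogeneous 1 :=
  IsHomogeneous.sum _ _ _ fun _ _ => isHomogeneous_C_mul_X _ _

lemma lin_sub_smul (u w : V → k) (c : k) : lin (fun v => u v - c * w v) = lin u - C c * lin w := by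
  simp only [lin, Finset.mul_sum, ← Finset.sum_sub_distrib]
  refine Finset.sum_congr rfl fun v _ => ?_
  rw [C_sub, C_mul]; ring

lemma isHomogeneous_AI (Δ : Set (Finset V)) (l : ℕ → V → k) (s : ℕ) :
    (AI Δ l s).IsHomogeneous (homogeneousSubmodule V k) := by
  refine Ideal.IsHomogeneous.sup (Ideal.homogeneous_span _ _ ?_) (Ideal.homogeneous_span _ _ ?_)
  · rintro _ ⟨m, _, rfl⟩
    exact ⟨m.degree, isHomogeneous_monomial _ rfl⟩
  · rintro _ ⟨i, _, rfl⟩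
    exact ⟨1, isHomogeneous_lin _⟩

lemma homogeneousComponent_mem_AI {Δ : Set (Finset V)} {l : ℕ → V → k} {s : ℕ}
    {p : MvPolynomial V k} (hp : p ∈ AI Δ l s) (j : ℕ) : homogeneousComponent j p ∈ AI Δ l s :=
  homogeneousComponent_mem_of_mem (isHomogeneous_AI Δ l s) hp j

lemma mem_AI_of_homogeneousComponent {Δ : Set (Finset V)} {l : ℕ → V → k} {s : ℕ}
    {p : MvPolynomial V k} (hp : ∀ j, homogeneousComponent j p ∈ AI Δ l s) : p ∈ AI Δ l s := by
  rw [← sum_homogeneousComponent p]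
  exact Ideal.sum_mem _ fun j _ => hp j

lemma homogeneousComponent_mul_lin (u : V → k) (e : MvPolynomial V k) (j : ℕ) :
    homogeneousComponent (j + 1) (lin u * e) = lin u * homogeneousComponent j e := by
  have := DirectSum.coe_decompose_mul_add_of_left_mem (homogeneousSubmodule V k) (i := 1) (j := j)
    (b := e) (isHomogeneous_lin u)
  rw [add_comm, ← decomposition.decompose'_apply, ← decomposition.decompose'_apply]
  exact this

lemma homogeneousComponent_zero_mul_lin (u : V → k) (e : MvPolynomial V k) :
    homogeneousComponent 0 (lin u * e) = 0 := by
  rw [homogeneousComponent_zero]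
  simp [lin, constantCoeff_eq.symm]

lemma exists_of_mem_AI_succ {Δ : Set (Finset V)} {l : ℕ → V → k} {s j : ℕ}
    {p : MvPolynomial V k} (hp : p ∈ AI Δ l (s + 1)) (hj : p.IsHomogeneous (j + 1)) :
    ∃ e, e.IsHomogeneous j ∧ p - lin (l s) * e ∈ AI Δ l s := by
  rw [AI_succ, Submodule.mem_sup] at hp
  obtain ⟨q, hq, r, hr, rfl⟩ := hp
  obtain ⟨e, rfl⟩ := Ideal.mem_span_singleton'.1 hr
  refine ⟨homogeneousComponent j e, homogeneousComponent_isHomogeneous _ _, ?_⟩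
  have := homogeneousComponent_mem_AI hq (j + 1)
  rw [← homogeneousComponent_mul_lin]
  nth_rewrite 1 [← homogeneousComponent_eq_self hj]
  rw [map_add, mul_comm e]
  simpa using this

lemma mem_AI_of_mem_AI_succ {Δ : Set (Finset V)} {l : ℕ → V → k} {s : ℕ}
    {p : MvPolynomial V k} (hp : p ∈ AI Δ l (s + 1)) (hj : p.IsHomogeneous 0) :
    p ∈ AI Δ l s := by
  rw [AI_succ, Submodule.mem_sup] at hp
  obtain ⟨q, hq, r, hr, rfl⟩ := hp
  obtain ⟨e, rfl⟩ := Ideal.mem_span_singleton'.1 hr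
  have := homogeneousComponent_mem_AI hq 0
  rw [← homogeneousComponent_eq_self hj, map_add, mul_comm e, homogeneousComponent_zero_mul_lin]
  simpa using this

/-- Linear forms all of whose leading minors on `X` are nonsingular. -/
def Flag (X : Finset V) (n : ℕ) (l : ℕ → V → k) : Prop :=
  ∀ s ≤ n, ∀ S ⊆ X, S.card = s → ∀ c : ℕ → k,
    (∀ v ∈ S, ∑ i ∈ Finset.range s, c i * l i v = 0) → ∀ i < s, c i = 0

/-- Elimination of a vertex by means of the first linear form. -/
noncomputable def elim (l : ℕ → V → k) (v : V) (i : ℕ) (w : V) : k :=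
  l (i + 1) w - l (i + 1) v / l 0 v * l 0 w

lemma Flag.ne_zero {X : Finset V} {n : ℕ} {l : ℕ → V → k} (h : Flag X n l) (hn : 1 ≤ n) {v : V}
    (hv : v ∈ X) : l 0 v ≠ 0 := by
  intro h0
  have := h 1 hn {v} (by simpa using hv) (by simp) (fun _ => 1) (by simp [h0]) 0 one_pos
  exact one_ne_zero this

lemma elim_self {l : ℕ → V → k} {v : V} (h : l 0 v ≠ 0) (i : ℕ) : elim l v i v = 0 := by
  rw [elim, div_mul_cancel₀ _ h, sub_self]

lemma Flag.elim {X : Finset V} {n : ℕ} {l : ℕ → V → k} (h : Flag X (n + 1) l) {v : V}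
    (hv : v ∈ X) : Flag (X.erase v) n (elim l v) := by
  have h0 := h.ne_zero (by omega) hv
  intro s hs S hS hc c hc0 i hi
  have hvS : v ∉ S := fun hvS => by simpa using hS hvS
  set C : ℕ → k := fun i => if i = 0 then -∑ i ∈ Finset.range s, c i * (l (i + 1) v / l 0 v)
    else c (i - 1) with hC
  have key : ∀ w, ∑ i ∈ Finset.range (s + 1), C i * l i w =
      ∑ i ∈ Finset.range s, c i * UBT.elim l v i w := fun w => by
    rw [Finset.sum_range_succ']
    simp only [hC, if_pos, Nat.add_eq_zero_iff, one_ne_zero, and_false, if_false,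
      Nat.add_sub_cancel, neg_mul, Finset.sum_mul, UBT.elim]
    rw [← sub_eq_add_neg, ← Finset.sum_sub_distrib]
    refine Finset.sum_congr rfl fun j _ => ?_
    ring
  have := h (s + 1) (by omega) (insert v S)
    (Finset.insert_subset hv (hS.trans (Finset.erase_subset _ _)))
    (by rw [Finset.card_insert_of_notMem hvS, hc]) C (fun w hw => by
      rw [key]
      rcases Finset.mem_insert.1 hw with rfl | hw
      · exact Finset.sum_eq_zero fun j _ => by rw [elim_self h0, mul_zero]
      · exact hc0 w hw) (i + 1) (by omega)
  simpa [hC] using this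

/-- The substitution eliminating the variable of `v`. -/
noncomputable def elimHom (l : ℕ → V → k) (v : V) : MvPolynomial V k →ₐ[k] MvPolynomial V k :=
  aeval fun w => if w = v then X v - C (l 0 v)⁻¹ * lin (l 0) else X w

lemma elimHom_X_self (l : ℕ → V → k) (v : V) :
    elimHom l v (X v) = X v - C (l 0 v)⁻¹ * lin (l 0) := by
  simp [elimHom]

lemma elimHom_X_of_ne (l : ℕ → V → k) {v w : V} (h : w ≠ v) : elimHom l v (X w) = X w := by
  simp [elimHom, h]

lemma elimHom_lin (l : ℕ → V → k) (v : V) (u : V → k) :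
    elimHom l v (lin u) = lin u - C (u v / l 0 v) * lin (l 0) := by
  have h1 : elimHom l v (lin u) = ∑ w, (C (u w) * X w -
      if w = v then C (u v / l 0 v) * lin (l 0) else 0) := by
    rw [lin, map_sum]
    refine Finset.sum_congr rfl fun w _ => ?_
    rw [map_mul, ← algebraMap_eq, AlgHom.commutes]
    by_cases h : w = v
    · subst h
      rw [elimHom_X_self, if_pos rfl, mul_sub, algebraMap_eq, ← mul_assoc, ← C_mul, div_eq_mul_inv]
    · rw [elimHom_X_of_ne _ h, if_neg h, sub_zero]
  rw [h1, Finset.sum_sub_distrib, Finset.sum_ite_eq' Finset.univ v]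
  simp [lin]

lemma elimHom_lin_zero {l : ℕ → V → k} {v : V} (h : l 0 v ≠ 0) : elimHom l v (lin (l 0)) = 0 := by
  rw [elimHom_lin, div_self h]; simp

lemma elimHom_lin_succ (l : ℕ → V → k) (v : V) (i : ℕ) :
    elimHom l v (lin (l (i + 1))) = lin (elim l v i) := by
  rw [elimHom_lin]
  unfold elim
  rw [lin_sub_smul]

lemma isHomogeneous_elimHom (l : ℕ → V → k) (v : V) {p : MvPolynomial V k} {j : ℕ}
    (hp : p.IsHomogeneous j) : (elimHom l v p).IsHomogeneous j := by
  have : (elimHom l v p).IsHomogeneous (1 * j) := by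
    refine hp.aeval _ fun w => ?_
    by_cases h : w = v
    · rw [if_pos h]
      refine (isHomogeneous_X _ _).sub ?_
      exact (isHomogeneous_lin _).C_mul _
    · rw [if_neg h]; exact isHomogeneous_X _ _
  rwa [one_mul] at this

/-- The substitution of zero for the variable of `v`. -/
noncomputable def killHom (k : Type*) [Field k] (v : V) : MvPolynomial V k →ₐ[k] MvPolynomial V k :=
  aeval fun w => if w = v then 0 else X w

lemma killHom_lin (v : V) {u : V → k} (h : u v = 0) : killHom k v (lin u) = lin u := by
  rw [lin, map_sum]
  refine Finset.sum_congr rfl fun w _ => ?_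
  rw [map_mul, ← algebraMap_eq, AlgHom.commutes, killHom, aeval_X]
  by_cases hw : w = v
  · rw [if_pos hw, hw, h]; simp
  · rw [if_neg hw]

lemma killHom_elimHom {l : ℕ → V → k} {v : V} (h : l 0 v ≠ 0) (p : MvPolynomial V k) :
    killHom k v (elimHom l v p) = elimHom l v p := by
  have hv : killHom k v (elimHom l v (X v)) = elimHom l v (X v) := by
    have e : elimHom l v (X v) = lin (fun w => (if w = v then 1 else 0) - (l 0 v)⁻¹ * l 0 w) := by
      rw [elimHom_X_self, lin_sub_smul]
      congr 1
      simp [lin]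
    rw [e]
    exact killHom_lin v (by rw [if_pos rfl, inv_mul_cancel₀ h, sub_self])
  have : (killHom k v).comp (elimHom l v) = elimHom l v := by
    ext1 w
    rw [AlgHom.comp_apply]
    by_cases hw : w = v
    · rw [hw, hv]
    · rw [elimHom_X_of_ne _ hw]
      simp [killHom, hw]
  exact DFunLike.congr_fun this p

lemma sub_elimHom_mem (l : ℕ → V → k) (v : V) (p : MvPolynomial V k) :
    p - elimHom l v p ∈ Ideal.span {lin (l 0)} := by
  rw [← Ideal.Quotient.eq]
  have : (Ideal.Quotient.mkₐ k (Ideal.span {lin (l 0)})) =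
      (Ideal.Quotient.mkₐ k (Ideal.span {lin (l 0)})).comp (elimHom l v) := by
    ext1 w
    rw [AlgHom.comp_apply]
    by_cases hw : w = v
    · rw [hw, elimHom_X_self]
      refine Ideal.Quotient.eq.2 ?_
      rw [sub_sub_cancel]
      exact Ideal.mul_mem_left _ _ (Ideal.mem_span_singleton_self _)
    · rw [elimHom_X_of_ne _ hw]
  exact DFunLike.congr_fun this p

lemma monomial_one_eq (m : V →₀ ℕ) : monomial m (1 : k) = ∏ v, X v ^ m v := by
  rw [monomial_eq, C_1, one_mul, Finsupp.prod_fintype]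
  simp

lemma monomial_eq_mul_erase (m : V →₀ ℕ) (v : V) :
    monomial m (1 : k) = X v ^ m v * monomial (m.erase v) 1 := by
  rw [X_pow_eq_monomial, monomial_mul, one_mul, Finsupp.single_add_erase]

/-- Membership in the ideal of a cone can be tested after eliminating the apex. -/
theorem mem_AI_cone {Δ Δ' : Set (Finset V)} {v : V} (hcone : ∀ H, H ∈ Δ ↔ H.erase v ∈ Δ')
    (l : ℕ → V → k) (h0 : l 0 v ≠ 0) (s : ℕ) (p : MvPolynomial V k) :
    p ∈ AI Δ l (s + 1) ↔ elimHom l v p ∈ AI Δ' (elim l v) s := by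
  constructor
  · intro hp
    suffices h : AI Δ l (s + 1) ≤ (AI Δ' (UBT.elim l v) s).comap (elimHom l v) from h hp
    refine sup_le (Ideal.span_le.2 ?_) (Ideal.span_le.2 ?_)
    · rintro _ ⟨m, hm, rfl⟩
      simp only [SetLike.mem_coe, Ideal.mem_comap]
      rw [monomial_eq_mul_erase m v, map_mul]
      refine Ideal.mul_mem_left _ _ ?_
      have : elimHom l v (monomial (m.erase v) 1) = monomial (m.erase v) 1 := by
        rw [monomial_one_eq, map_prod]
        refine Finset.prod_congr rfl fun w _ => ?_
        rw [map_pow]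
        by_cases hw : w = v
        · rw [hw]; simp
        · rw [elimHom_X_of_ne _ hw]
      rw [this]
      refine faceIdeal_le_AI _ _ _ (Ideal.subset_span ⟨_, ?_, rfl⟩)
      rw [Set.mem_ofPred_eq, Finsupp.support_erase]
      exact fun h' => hm ((hcone _).2 h')
    · rintro _ ⟨i, hi, rfl⟩
      simp only [SetLike.mem_coe, Ideal.mem_comap]
      rcases i with _ | i
      · rw [elimHom_lin_zero h0]; exact Ideal.zero_mem _
      · rw [elimHom_lin_succ]
        exact lin_mem_AI _ _ (Nat.lt_of_succ_lt_succ hi)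
  · intro hp
    suffices h : AI Δ' (UBT.elim l v) s ≤ (AI Δ l (s + 1)).comap (killHom k v) by
      have h1 := h hp
      rw [Ideal.mem_comap, killHom_elimHom h0] at h1
      have h2 : p - elimHom l v p ∈ AI Δ l (s + 1) :=
        (Ideal.span_le.2 (by
          rw [Set.singleton_subset_iff]
          exact lin_mem_AI _ _ (Nat.succ_pos s)) : Ideal.span {lin (l 0)} ≤ _)
          (sub_elimHom_mem l v p)
      have := Ideal.add_mem _ h2 h1
      rwa [sub_add_cancel] at this
    refine sup_le (Ideal.span_le.2 ?_) (Ideal.span_le.2 ?_)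
    · rintro _ ⟨m, hm, rfl⟩
      simp only [SetLike.mem_coe, Ideal.mem_comap]
      by_cases hv : v ∈ m.support
      · rw [monomial_eq_mul_erase m v, map_mul, map_pow]
        rw [show killHom k v (X v) = 0 by simp [killHom], zero_pow (Finsupp.mem_support_iff.1 hv),
          zero_mul]
        exact Ideal.zero_mem _
      · have : killHom k v (monomial m 1) = monomial m 1 := by
          rw [monomial_one_eq, map_prod]
          refine Finset.prod_congr rfl fun w _ => ?_
          rw [map_pow]
          by_cases hw : w = v
          · rw [hw, Finsupp.notMem_support_iff.1 hv]; simp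
          · simp [killHom, hw]
        rw [this]
        refine faceIdeal_le_AI _ _ _ (Ideal.subset_span ⟨_, fun h' => hm ?_, rfl⟩)
        have := (hcone _).1 h'
        rwa [Finset.erase_eq_of_notMem hv] at this
    · rintro _ ⟨i, hi, rfl⟩
      simp only [SetLike.mem_coe, Ideal.mem_comap]
      rw [killHom_lin v (elim_self h0 i)]
      unfold UBT.elim
      rw [lin_sub_smul]
      exact Ideal.sub_mem _ (lin_mem_AI _ _ (Nat.succ_lt_succ hi))
        (Ideal.mul_mem_left _ _ (lin_mem_AI _ _ (Nat.succ_pos s)))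

/-- The closed star of a face. -/
def st (Δ : Set (Finset V)) (G : Finset V) : Set (Finset V) := {H | H ∪ G ∈ Δ}

lemma isLowerSet_st {Δ : Set (Finset V)} (h : IsLowerSet Δ) (G : Finset V) :
    IsLowerSet (st Δ G) := fun _ _ hle hH => h (Finset.union_subset_union_left hle) hH

lemma st_empty (Δ : Set (Finset V)) : st Δ ∅ = Δ := by
  ext H; simp [st]

lemma st_st (Δ : Set (Finset V)) (G H : Finset V) : st (st Δ G) H = st Δ (G ∪ H) := by
  ext A
  simp only [st, Set.mem_ofPred_eq]
  rw [Finset.union_assoc, Finset.union_comm H G]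

lemma st_anti {Δ : Set (Finset V)} (h : IsLowerSet Δ) {G G' : Finset V} (hG : G ⊆ G') :
    st Δ G' ⊆ st Δ G := fun _ hH => h (Finset.union_subset_union_right hG) hH

lemma st_insert_iff {Δ : Set (Finset V)} {F : Finset V} {u : V} (hu : u ∉ F) (H : Finset V) :
    H ∈ st Δ (insert u F) ↔ H.erase u ∈ st (lk Δ {u}) F := by
  simp only [st, lk, Set.mem_ofPred_eq, Finset.disjoint_singleton_left, Finset.mem_union,
    Finset.mem_erase, hu, ne_eq, not_true_eq_false, false_and, or_self, not_false_eq_true,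
    true_and]
  have : H ∪ insert u F = {u} ∪ (H.erase u ∪ F) := by
    ext x
    simp only [Finset.mem_union, Finset.mem_insert, Finset.mem_singleton, Finset.mem_erase]
    tauto
  rw [this]

lemma lk_lk {Δ : Set (Finset V)} {F : Finset V} {u : V} (hu : u ∉ F) :
    lk (lk Δ {u}) F = lk Δ (insert u F) := by
  ext H
  simp only [lk, Set.mem_ofPred_eq, Finset.disjoint_insert_left, Finset.disjoint_singleton_left,
    Finset.mem_union, hu, false_or, Finset.insert_union, Finset.singleton_union]
  tauto

/-- Every flag of linear forms is a regular sequence. -/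
def RegAll (k : Type*) [Field k] (Δ : Set (Finset V)) (X : Finset V) (n : ℕ) : Prop :=
  ∀ l : ℕ → V → k, Flag X n l → ∀ s < n, ∀ p, lin (l s) * p ∈ AI Δ l s → p ∈ AI Δ l s

/-- Restriction of polynomials to a coordinate subspace. -/
noncomputable def restr (k : Type*) [Field k] (F : Finset V) :
    MvPolynomial V k →ₐ[k] MvPolynomial V k :=
  aeval fun w => if w ∈ F then X w else 0

lemma restr_monomial (F : Finset V) (m : V →₀ ℕ) (c : k) :
    restr k F (monomial m c) = if m.support ⊆ F then monomial m c else 0 := by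
  rw [monomial_eq, map_mul, ← algebraMap_eq, AlgHom.commutes, algebraMap_eq, ← monomial_eq,
    Finsupp.prod_fintype _ _ (by simp), map_prod]
  by_cases h : m.support ⊆ F
  · rw [if_pos h, monomial_eq, Finsupp.prod_fintype _ _ (by simp)]
    congr 1
    refine Finset.prod_congr rfl fun v _ => ?_
    rw [map_pow]
    by_cases hv : v ∈ F
    · simp [restr, hv]
    · rw [show m v = 0 by by_contra h0; exact hv (h (Finsupp.mem_support_iff.2 h0))]; simp
  · rw [if_neg h]
    obtain ⟨v, hv, hvF⟩ := Finset.not_subset.1 h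
    rw [Finset.prod_eq_zero (Finset.mem_univ v), mul_zero]
    rw [map_pow]
    simp only [restr, aeval_X, if_neg hvF]
    exact zero_pow (Finsupp.mem_support_iff.1 hv)

lemma coeff_restr (F : Finset V) (m : V →₀ ℕ) (p : MvPolynomial V k) :
    coeff m (restr k F p) = if m.support ⊆ F then coeff m p else 0 := by
  induction p using MvPolynomial.induction_on' with
  | monomial m' c =>
    rw [restr_monomial, coeff_monomial]
    by_cases h : m' = m
    · subst h
      by_cases h' : m'.support ⊆ F
      · simp [h']
      · simp [h']
    · rw [if_neg h]
      by_cases h' : m'.support ⊆ F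
      · simp [h', h]
      · simp [h']
  | add p q hp hq =>
    rw [map_add, coeff_add, hp, hq, coeff_add]
    by_cases h' : m.support ⊆ F
    · simp [h']
    · simp [h']

lemma coeff_single_lin (u : V → k) (v : V) : coeff (Finsupp.single v 1) (lin u) = u v := by
  rw [lin, coeff_sum, Finset.sum_eq_single v]
  · rw [coeff_C_mul, coeff_X, if_pos rfl, mul_one]
  · intro w _ hw
    rw [coeff_C_mul, coeff_X, if_neg, mul_zero]
    intro h
    exact hw (Finsupp.single_left_injective one_ne_zero h)
  · simp

/-- The first form of a flag is regular modulo the face ideal. -/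
lemma regular_zero {Δ : Set (Finset V)} (hΔ : IsLowerSet Δ) {u : V → k}
    (hu : ∀ T ∈ Δ, ∃ v, u v ≠ 0 ∧ insert v T ∈ Δ) {p : MvPolynomial V k}
    (hp : lin u * p ∈ faceIdeal k Δ) : p ∈ faceIdeal k Δ := by
  rw [mem_faceIdeal hΔ] at hp ⊢
  intro m hm
  obtain ⟨v, huv, hT⟩ := hu _ hm
  set T := insert v m.support with hTd
  have h1 : restr k T (lin u * p) = 0 := by
    ext m'
    rw [coeff_restr, coeff_zero]
    by_cases h : m'.support ⊆ T
    · rw [if_pos h, hp _ (hΔ h hT)]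
    · rw [if_neg h]
  rw [map_mul] at h1
  rcases mul_eq_zero.1 h1 with h2 | h2
  · have := congrArg (coeff (Finsupp.single v 1)) h2
    rw [coeff_restr, coeff_single_lin, if_pos, coeff_zero] at this
    · exact absurd this huv
    · rw [Finsupp.support_single _ one_ne_zero]; simp [hTd]
  · have := congrArg (coeff m) h2
    rw [coeff_restr, if_pos (Finset.subset_insert _ _), coeff_zero] at this
    exact this

lemma regAll_cone {Δ Δ' : Set (Finset V)} (hΔ : IsLowerSet Δ) {v : V}
    (hcone : ∀ H, H ∈ Δ ↔ H.erase v ∈ Δ') {X : Finset V}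
    (hv : v ∈ X) {n : ℕ} (h : RegAll k Δ' (X.erase v) n) : RegAll k Δ X (n + 1) := by
  intro l hl s hs p hp
  have h0 := hl.ne_zero (by omega) hv
  rcases s with _ | s
  · rw [AI_zero] at hp ⊢
    refine regular_zero hΔ (fun T hT => ⟨v, h0, ?_⟩) hp
    rw [hcone] at hT ⊢
    rwa [Finset.erase_insert_eq_erase]
  · rw [mem_AI_cone hcone l h0, map_mul, elimHom_lin_succ] at hp
    rw [mem_AI_cone hcone l h0]
    exact h _ (hl.elim hv) s (by omega) _ hp

theorem regAll_st (F : Finset V) : ∀ (Δ : Set (Finset V)), IsLowerSet Δ → ∀ (X : Finset V),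
    F ⊆ X → ∀ n, RegAll k (lk Δ F) (X \ F) n → RegAll k (st Δ F) X (n + F.card) := by
  induction F using Finset.induction_on with
  | empty =>
    intro Δ _ X _ n h
    rw [st_empty]
    rwa [lk_empty, Finset.sdiff_empty] at h
  | insert u F hu ih =>
    intro Δ hΔ X hX n h
    rw [Finset.card_insert_of_notMem hu, ← add_assoc]
    refine regAll_cone (isLowerSet_st hΔ _) (st_insert_iff hu) (hX (Finset.mem_insert_self _ _))
      (ih _ (isLowerSet_lk hΔ _) _ ?_ n ?_)
    · intro x hx
      exact Finset.mem_erase.2 ⟨fun e => hu (e ▸ hx), hX (Finset.mem_insert_of_mem hx)⟩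
    · rw [lk_lk hu]
      convert h using 1
      ext x
      simp only [Finset.mem_sdiff, Finset.mem_erase, Finset.mem_insert]
      tauto

end FaceIdeals

section CechExactness

open MvPolynomial

variable {k : Type*} [Field k] [CharP k 2] {V : Type*} [Fintype V] [DecidableEq V]

/-- The Čech coboundary in characteristic two. -/
def cob {M : Type*} [AddCommMonoid M] (c : Finset V → M) (G : Finset V) : M :=
  ∑ v ∈ G, c (G.erase v)

lemma cob_cob {M : Type*} [AddCommMonoid M] (h2 : ∀ x : M, x + x = 0) (c : Finset V → M)
    (G : Finset V) : cob (cob c) G = 0 := by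
  unfold cob
  rw [Finset.sum_sigma' G fun v => G.erase v]
  refine Finset.sum_involution (fun x _ => ⟨x.2, x.1⟩) ?_ ?_ ?_ ?_
  · rintro ⟨v, u⟩ h
    simp only [Finset.erase_right_comm (a := u) (b := v)]
    exact h2 _
  · rintro ⟨v, u⟩ h _ he
    simp only [Finset.mem_sigma, Finset.mem_erase] at h
    simp only [Sigma.mk.injEq] at he
    exact h.2.1 he.1
  · rintro ⟨v, u⟩ h
    simp only [Finset.mem_sigma, Finset.mem_erase] at h ⊢
    exact ⟨h.2.2, fun e => h.2.1 e.symm, h.1⟩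
  · rintro ⟨v, u⟩ h
    rfl

/-- Exactness of the Čech complex of stars modulo linear forms. -/
def Exact (Δ : Set (Finset V)) (l : ℕ → V → k) (s a j : ℕ) : Prop :=
  ∀ c : Finset V → MvPolynomial V k, (∀ G, (c G).IsHomogeneous j) →
    (∀ G, G.card = a + 1 → cob c G ∈ AI (st Δ G) l s) →
    ∃ b : Finset V → MvPolynomial V k, (∀ G, (b G).IsHomogeneous j) ∧
      ∀ G, G.card = a → c G - cob b G ∈ AI (st Δ G) l s

/-- Vanishing of homology in the degree of faces with `j` elements. -/
def HVan (k : Type*) [Field k] (Δ : Set (Finset V)) (j : ℕ) : Prop :=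
  ∀ z ∈ chains k Δ j, bd k z = 0 → z ∈ bdry k Δ j

lemma exists_comp_eq_of_ker {A B : Type*} [AddCommGroup A] [Module k A] [AddCommGroup B]
    [Module k B] (f : A →ₗ[k] B) (γ : A →ₗ[k] k) (h : ∀ x, f x = 0 → γ x = 0) :
    ∃ β : B →ₗ[k] k, β.comp f = γ := by
  have : γ ∈ LinearMap.range f.dualMap := by
    rw [LinearMap.range_dualMap_eq_dualAnnihilator_ker, Submodule.mem_dualAnnihilator]
    exact fun x hx => h x hx
  exact this

lemma HVan.exists_cob {Δ : Set (Finset V)} {a : ℕ} (h : HVan k Δ a) {γ : Finset V → k}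
    (hγ : ∀ G ∈ Δ, G.card = a + 1 → cob γ G = 0) :
    ∃ β : Finset V → k, ∀ G ∈ Δ, G.card = a → γ G = cob β G := by
  let γ' : (Finset V →₀ k) →ₗ[k] k := Finsupp.linearCombination k γ
  have hγ1 : ∀ G, γ' (Finsupp.single G 1) = γ G := fun G => by
    simp [γ']
  have hγb : ∀ G, γ' (bd k (Finsupp.single G 1)) = cob γ G := fun G => by
    rw [bd_single, map_sum]
    exact Finset.sum_congr rfl fun v _ => hγ1 _
  let f : chains k Δ a →ₗ[k] (Finset V →₀ k) := (bd k).comp (chains k Δ a).subtype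
  obtain ⟨β, hβ⟩ : ∃ β : (Finset V →₀ k) →ₗ[k] k,
      β.comp f = γ'.comp (chains k Δ a).subtype := by
    refine exists_comp_eq_of_ker (k := k) (A := chains k Δ a) (B := Finset V →₀ k) f _ ?_
    rintro ⟨z, hz⟩ hfz
    obtain ⟨w, hw, rfl⟩ := h z hz hfz
    change (γ'.comp (bd k)) w = 0
    have : ∀ w ∈ chains k Δ (a + 1), (γ'.comp (bd k)) w = (0 : (Finset V →₀ k) →ₗ[k] k) w := by
      intro w hw
      refine eq_of_chains _ _ (fun G hG hc => ?_) hw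
      rw [LinearMap.comp_apply, hγb, hγ G hG hc, LinearMap.zero_apply]
    rw [this w hw, LinearMap.zero_apply]
  refine ⟨fun H => β (Finsupp.single H 1), fun G hG hc => ?_⟩
  have := LinearMap.congr_fun hβ ⟨Finsupp.single G 1, single_mem_chains (L := Δ) 1 hG hc⟩
  rw [← hγ1]
  refine this.symm.trans ?_
  change β (bd k (Finsupp.single G 1)) = _
  rw [bd_single, map_sum]
  rfl

lemma exists_coeff_homogeneous (j : ℕ) (f : (V →₀ ℕ) → k) :
    ∃ p : MvPolynomial V k, p.IsHomogeneous j ∧ ∀ m, m.degree = j → coeff m p = f m := by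
  classical
  refine ⟨∑ m ∈ Finset.univ.finsuppAntidiag j, monomial m (f m),
    IsHomogeneous.sum _ _ _ fun m hm => isHomogeneous_monomial _ ?_, fun m hm => ?_⟩
  · rw [Finset.mem_finsuppAntidiag'] at hm
    rw [← hm.1]; rfl
  · rw [coeff_sum, Finset.sum_eq_single m]
    · simp
    · intro m' _ hne
      rw [coeff_monomial, if_neg hne]
    · intro hne
      exact absurd (Finset.mem_finsuppAntidiag'.2 ⟨hm, Finset.subset_univ _⟩) hne

lemma coeff_cob (c : Finset V → MvPolynomial V k) (G : Finset V) (m : V →₀ ℕ) :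
    coeff m (cob c G) = cob (fun H => coeff m (c H)) G := by
  rw [cob, coeff_sum]; rfl

lemma exists_cob_of_mem_support {Δ : Set (Finset V)} {T : Finset V} {v : V} (hv : v ∈ T) {a : ℕ}
    {γ : Finset V → k} (hγ : ∀ G, G.card = a + 1 → T ∪ G ∈ Δ → cob γ G = 0) {G : Finset V}
    (hG : G.card = a) (hTG : T ∪ G ∈ Δ) :
    γ G = cob (fun H => if v ∈ H then 0 else γ (insert v H)) G := by
  unfold cob
  by_cases hvG : v ∈ G
  · rw [Finset.sum_eq_single v]
    · beta_reduce
      rw [if_neg (Finset.notMem_erase v G), Finset.insert_erase hvG]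
    · intro u _ hu
      beta_reduce
      rw [if_pos (Finset.mem_erase.2 ⟨hu.symm, hvG⟩)]
    · intro h; exact absurd hvG h
  · have h := hγ (insert v G) (by rw [Finset.card_insert_of_notMem hvG, hG]) (by
      rw [Finset.union_insert, Finset.insert_eq_of_mem (Finset.mem_union_left _ hv)]; exact hTG)
    rw [cob, Finset.sum_insert hvG, Finset.erase_insert hvG] at h
    rw [CharTwo.add_eq_zero.1 h]
    refine Finset.sum_congr rfl fun u hu => ?_
    beta_reduce
    rw [if_neg (fun h => hvG (Finset.mem_of_mem_erase h)), Finset.erase_insert_of_ne]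
    rintro rfl; exact hvG hu

lemma exact_zero {Δ : Set (Finset V)} (hΔ : IsLowerSet Δ) (l : ℕ → V → k) {a j : ℕ}
    (h : j = 0 → HVan k Δ a) : Exact Δ l 0 a j := by
  classical
  intro c hc hcob
  simp only [AI_zero] at hcob ⊢
  have hco : ∀ m : V →₀ ℕ, ∀ G, G.card = a + 1 → m.support ∪ G ∈ Δ →
      cob (fun H => coeff m (c H)) G = 0 := fun m G hG hm => by
    rw [← coeff_cob]
    exact (mem_faceIdeal (isLowerSet_st hΔ G)).1 (hcob G hG) m hm
  have hex : ∀ m : V →₀ ℕ, m.degree = j → ∃ β : Finset V → k, ∀ G, G.card = a →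
      m.support ∪ G ∈ Δ → coeff m (c G) = cob β G := by
    intro m hm
    rcases m.support.eq_empty_or_nonempty with h0 | ⟨v, hv⟩
    · have hm0 : m = 0 := by simpa using h0
      obtain ⟨β, hβ⟩ := HVan.exists_cob (γ := fun G => coeff m (c G)) (h (by rw [← hm, hm0]; simp))
        (fun G hG hcard => hco m G hcard (by rwa [h0, Finset.empty_union]))
      exact ⟨β, fun G hG hmG => hβ G (by rwa [h0, Finset.empty_union] at hmG) hG⟩
    · exact ⟨_, fun G hG hmG => exists_cob_of_mem_support hv (hco m) hG hmG⟩
  choose! β hβ using hex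
  choose b hb hb' using fun G : Finset V => exists_coeff_homogeneous j fun m => β m G
  refine ⟨b, hb, fun G hG => (mem_faceIdeal (isLowerSet_st hΔ G)).2 fun m hm => ?_⟩
  by_cases hd : m.degree = j
  · rw [coeff_sub, coeff_cob, hβ m hd G hG hm, sub_eq_zero]
    exact Finset.sum_congr rfl fun v _ => (hb' _ m hd).symm
  · rw [coeff_sub, (hc G).coeff_eq_zero hd, coeff_cob]
    rw [cob, Finset.sum_eq_zero fun v _ => (hb _).coeff_eq_zero hd, sub_zero]

lemma AI_st_eq_top {Δ : Set (Finset V)} {G : Finset V} (h : G ∉ Δ) (l : ℕ → V → k) (s : ℕ) :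
    AI (st Δ G) l s = ⊤ :=
  AI_eq_top (fun h' => h (by simpa [st] using h')) l s

lemma isHomogeneous_cob {c : Finset V → MvPolynomial V k} {j : ℕ}
    (h : ∀ G, (c G).IsHomogeneous j) (G : Finset V) : (cob c G).IsHomogeneous j :=
  IsHomogeneous.sum _ _ _ fun _ _ => h _

lemma cob_mem {Δ : Set (Finset V)} (hΔ : IsLowerSet Δ) {l : ℕ → V → k} {s a : ℕ}
    {c : Finset V → MvPolynomial V k} (h : ∀ G, G.card = a → c G ∈ AI (st Δ G) l s)
    {G : Finset V} (hG : G.card = a + 1) : cob c G ∈ AI (st Δ G) l s :=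
  Ideal.sum_mem _ fun v hv => AI_anti (st_anti hΔ (Finset.erase_subset v G)) l s
    (h _ (by rw [Finset.card_erase_of_mem hv, hG]; rfl))

lemma cob_sub_mul (c : Finset V → MvPolynomial V k) (t : MvPolynomial V k)
    (e : Finset V → MvPolynomial V k) (G : Finset V) :
    cob (fun H => c H - t * e H) G = cob c G - t * cob e G := by
  simp only [cob, Finset.sum_sub_distrib, Finset.mul_sum]

lemma exact_succ {Δ : Set (Finset V)} (hΔ : IsLowerSet Δ) {l : ℕ → V → k} {s a j : ℕ}
    (hreg : ∀ G, G.card = a + 2 → ∀ p, lin (l s) * p ∈ AI (st Δ G) l s → p ∈ AI (st Δ G) l s)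
    (h1 : Exact Δ l s (a + 1) j) (h2 : Exact Δ l s a (j + 1)) : Exact Δ l (s + 1) a (j + 1) := by
  intro c hc hcob
  have hex : ∀ G : Finset V, ∃ e : MvPolynomial V k, e.IsHomogeneous j ∧
      (G.card = a + 1 → cob c G - lin (l s) * e ∈ AI (st Δ G) l s) := by
    intro G
    by_cases hG : G.card = a + 1
    · obtain ⟨e, he, he'⟩ := exists_of_mem_AI_succ (hcob G hG) (isHomogeneous_cob hc G)
      exact ⟨e, he, fun _ => he'⟩
    · exact ⟨0, isHomogeneous_zero _ _ _, fun h => absurd h hG⟩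
  choose e he he' using hex
  have hde : ∀ G, G.card = a + 1 + 1 → cob e G ∈ AI (st Δ G) l s := fun G hG => by
    refine hreg G hG _ ?_
    have := cob_mem hΔ he' hG
    rw [cob_sub_mul, cob_cob (fun x => CharTwo.add_self_eq_zero x), zero_sub] at this
    exact neg_mem_iff.1 this
  obtain ⟨b', hb', hb'e⟩ := h1 e he hde
  obtain ⟨b, hb, hbc⟩ := h2 (fun H => c H - lin (l s) * b' H)
    (fun G => (hc G).sub (by rw [add_comm]; exact (isHomogeneous_lin _).mul (hb' G)))
    (fun G hG => by
      rw [cob_sub_mul]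
      have := Ideal.add_mem _ (he' G hG) (Ideal.mul_mem_left _ (lin (l s)) (hb'e G hG))
      rw [mul_sub, sub_add_sub_cancel] at this
      exact this)
  refine ⟨b, hb, fun G hG => ?_⟩
  have h3 := AI_mono (st Δ G) l (Nat.le_succ s) (hbc G hG)
  have h4 := Ideal.mul_mem_right (b' G) _ (lin_mem_AI (st Δ G) l (Nat.lt_succ_self s))
  have := Ideal.add_mem _ h3 h4
  rwa [sub_right_comm, sub_add_cancel] at this

lemma exact_succ_zero {Δ : Set (Finset V)} {l : ℕ → V → k} {s a : ℕ}
    (h : Exact Δ l s a 0) : Exact Δ l (s + 1) a 0 := by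
  intro c hc hcob
  obtain ⟨b, hb, hbc⟩ := h c hc fun G hG =>
    mem_AI_of_mem_AI_succ (hcob G hG) (isHomogeneous_cob hc G)
  exact ⟨b, hb, fun G hG => AI_mono (st Δ G) l (Nat.le_succ s) (hbc G hG)⟩

/-- Cohen–Macaulay complexes with `n`-element facets on the vertex set `X`. -/
structure CM (k : Type*) [Field k] (n : ℕ) (Δ : Set (Finset V)) (X : Finset V) : Prop where
  lower : IsLowerSet Δ
  card_le : ∀ G ∈ Δ, G.card ≤ n
  subset : ∀ G ∈ Δ, G ⊆ X
  low : ∀ F ∈ Δ, ∀ j, j + F.card < n → HVan k (lk Δ F) j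

lemma lk_lk_of_mem {Δ : Set (Finset V)} {G F : Finset V} (h : F ∈ lk Δ G) :
    lk (lk Δ G) F = lk Δ (G ∪ F) := by
  ext H
  simp only [lk, Set.mem_ofPred_eq, Finset.disjoint_union_right, Finset.disjoint_union_left,
    Finset.union_assoc]
  have := h.1
  tauto

lemma CM.lk {n : ℕ} {Δ : Set (Finset V)} {X : Finset V} (h : CM k n Δ X)
    (G : Finset V) : CM k (n - G.card) (lk Δ G) (X \ G) where
  lower := isLowerSet_lk h.lower G
  card_le H hH := by
    have := h.card_le _ hH.2
    rw [Finset.card_union_of_disjoint hH.1] at this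
    omega
  subset H hH := Finset.subset_sdiff.2
    ⟨Finset.subset_union_right.trans (h.subset _ hH.2), hH.1.symm⟩
  low F hF j hj := by
    rw [lk_lk_of_mem hF]
    refine h.low _ hF.2 j ?_
    rw [Finset.card_union_of_disjoint hF.1]
    omega

lemma CM.exact {n : ℕ} {Δ : Set (Finset V)} {X : Finset V} (h : CM k n Δ X) (h0 : ∅ ∈ Δ)
    (l : ℕ → V → k) : ∀ s ≤ n,
    (∀ t < s, ∀ G : Finset V, G.Nonempty →
      ∀ p, lin (l t) * p ∈ AI (st Δ G) l t → p ∈ AI (st Δ G) l t) →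
    ∀ a j, (j + a ≠ n ∨ a + s < n ∨ HVan k Δ n) → Exact Δ l s a j := by
  intro s
  induction s with
  | zero =>
    intro _ _ a j haj
    by_cases ha : n < a
    · intro c _ _
      refine ⟨0, fun _ => isHomogeneous_zero _ _ _, fun G hG => ?_⟩
      rw [AI_st_eq_top (fun hG' => by have := h.card_le G hG'; omega)]
      trivial
    · refine exact_zero h.lower l fun hj => ?_
      by_cases han : a = n
      · subst han
        exact (haj.resolve_left (by omega)).resolve_left (by omega)
      · have := h.low ∅ h0 a (by rw [Finset.card_empty]; omega)
        rwa [lk_empty] at this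
  | succ s ih =>
    intro hs hreg a j haj
    have ih' := ih (by omega) fun t ht => hreg t (by omega)
    cases j with
    | zero => exact exact_succ_zero (ih' a 0 (Or.imp_right (Or.imp_left fun _ => by omega) haj))
    | succ j =>
      refine exact_succ h.lower (fun G hG => hreg s (by omega) G ?_)
        (ih' _ _ (haj.imp (fun _ => by omega) (Or.imp_left fun _ => by omega)))
        (ih' _ _ (haj.imp (fun _ => by omega) (Or.imp_left fun _ => by omega)))
      rw [← Finset.card_pos]; omega

lemma cob_singleton {M : Type*} [AddCommMonoid M] (c : Finset V → M) (v : V) :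
    cob c {v} = c ∅ := by
  simp [cob]

lemma Exact.mem {Δ : Set (Finset V)} {l : ℕ → V → k} {s j : ℕ} (h : Exact Δ l s 0 j)
    {p : MvPolynomial V k} (hp : p.IsHomogeneous j) (hv : ∀ v, p ∈ AI (st Δ {v}) l s) :
    p ∈ AI Δ l s := by
  obtain ⟨b, -, hb⟩ := h (fun _ => p) (fun _ => hp) fun G hG => by
    obtain ⟨v, rfl⟩ := Finset.card_eq_one.1 hG
    rw [cob_singleton]; exact hv v
  simpa [cob, st_empty] using hb ∅ rfl

lemma RegAll.mem {Δ : Set (Finset V)} {X : Finset V} {n : ℕ} (h : RegAll k Δ X n) {l : ℕ → V → k}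
    (hl : Flag X n l) {s : ℕ} (hs : s < n) {p : MvPolynomial V k} (hp : lin (l s) * p ∈ AI Δ l s) :
    p ∈ AI Δ l s := h l hl s hs p hp

lemma CM.regAll_st_of {n : ℕ} {Δ : Set (Finset V)} {X : Finset V} (h : CM k n Δ X)
    {G : Finset V} (hG : G ∈ Δ)
    (hr : RegAll k (UBT.lk Δ G) (X \ G) (n - G.card)) :
    RegAll k (st Δ G) X n := by
  have := regAll_st G Δ h.lower X (h.subset G hG) _ hr
  rwa [Nat.sub_add_cancel (h.card_le G hG)] at this

theorem CM.regAll : ∀ {n : ℕ} {Δ : Set (Finset V)} {X : Finset V}, CM k n Δ X → RegAll k Δ X n := by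
  intro n
  induction n using Nat.strong_induction_on with
  | _ n ih =>
    intro Δ X h l hl
    by_cases h0 : ∅ ∈ Δ
    swap
    · intro s _ p _
      rw [AI_eq_top h0]; trivial
    have hst : ∀ t < n, ∀ G : Finset V, G.Nonempty →
        ∀ p, lin (l t) * p ∈ AI (st Δ G) l t → p ∈ AI (st Δ G) l t := by
      intro t ht G hG p hp
      by_cases hGΔ : G ∈ Δ
      · have := hG.card_pos
        exact (h.regAll_st_of hGΔ (ih _ (by omega) (h.lk G))).mem hl ht hp
      · rw [AI_st_eq_top hGΔ]; trivial
    intro s hs p hp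
    refine mem_AI_of_homogeneousComponent fun j => ?_
    refine (h.exact h0 l s hs.le (fun t ht => hst t (by omega)) 0 j (by omega)).mem
      (homogeneousComponent_isHomogeneous j p) fun v => ?_
    refine hst s hs {v} (Finset.singleton_nonempty v) _ ?_
    rw [← homogeneousComponent_mul_lin]
    refine AI_anti ?_ l s (homogeneousComponent_mem_AI hp _)
    rw [← st_empty Δ, st_st]
    exact st_anti h.lower (by simp)

lemma CM.mem_of_star {n : ℕ} {Δ : Set (Finset V)} {X : Finset V} (h : CM k n Δ X) {l : ℕ → V → k}
    (hl : Flag X n l) {j : ℕ} (hj : j ≠ n ∨ HVan k Δ n) {p : MvPolynomial V k}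
    (hp : p.IsHomogeneous j) (hv : ∀ v, p ∈ AI (st Δ {v}) l n) : p ∈ AI Δ l n := by
  by_cases h0 : ∅ ∈ Δ
  swap
  · rw [AI_eq_top h0]; trivial
  refine (h.exact h0 l n le_rfl (fun t ht G _ p hp => ?_) 0 j
    (hj.imp (fun _ => by omega) Or.inr)).mem hp hv
  by_cases hGΔ : G ∈ Δ
  · exact (h.regAll_st_of hGΔ (h.lk G).regAll).mem hl ht hp
  · rw [AI_st_eq_top hGΔ]; trivial

/-- Membership in the star ideal of a face can be tested on larger stars. -/
theorem mem_AI_st_of_insert (F : Finset V) : ∀ {Δ : Set (Finset V)}, IsLowerSet Δ →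
    ∀ {X : Finset V}, F ⊆ X → ∀ {n : ℕ}, CM k n (lk Δ F) (X \ F) → ∀ {l : ℕ → V → k},
    Flag X (n + F.card) l → ∀ {j : ℕ}, (j ≠ n ∨ HVan k (lk Δ F) n) → ∀ {p : MvPolynomial V k},
    p.IsHomogeneous j → (∀ v ∉ F, p ∈ AI (st Δ (insert v F)) l (n + F.card)) →
    p ∈ AI (st Δ F) l (n + F.card) := by
  induction F using Finset.induction_on with
  | empty =>
    intro Δ hΔ X _ n h l hl j hj p hp hv
    rw [lk_empty, Finset.sdiff_empty] at h
    rw [lk_empty] at hj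
    rw [st_empty]
    exact h.mem_of_star hl hj hp fun v => hv v (Finset.notMem_empty v)
  | insert u F hu ih =>
    intro Δ hΔ X hF n h l hl j hj p hp hv
    rw [Finset.card_insert_of_notMem hu, ← add_assoc] at hl hv ⊢
    have huX : u ∈ X := hF (Finset.mem_insert_self u F)
    have hl0 : l 0 u ≠ 0 := hl.ne_zero (by omega) huX
    rw [← lk_lk hu] at h hj
    rw [mem_AI_cone (st_insert_iff hu) l hl0]
    refine ih (isLowerSet_lk hΔ {u}) (X := X.erase u) ?_ ?_ (hl.elim huX) hj
      (isHomogeneous_elimHom l u hp) fun v hvF => ?_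
    · exact Finset.subset_erase.2 ⟨(Finset.subset_insert u F).trans hF, hu⟩
    · have : X \ insert u F = X.erase u \ F := by
        ext x; simp only [Finset.mem_sdiff, Finset.mem_insert, Finset.mem_erase]; tauto
      rwa [this] at h
    · by_cases hvu : v = u
      · subst hvu
        rw [AI_st_eq_top]
        · trivial
        · intro hmem
          exact Finset.disjoint_left.1 hmem.1 (Finset.mem_singleton_self v)
            (Finset.mem_insert_self v F)
      · have huv : u ∉ insert v F := by
          rw [Finset.mem_insert]; rintro (rfl | h')
          · exact hvu rfl
          · exact hu h'
        rw [← mem_AI_cone (st_insert_iff huv) l hl0, Finset.insert_comm]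
        exact hv v (by rw [Finset.mem_insert]; tauto)

end CechExactness

section GenericPoints

open MvPolynomial

variable {k : Type*} [Field k] {V : Type*} [Fintype V] [DecidableEq V] {n : ℕ}

/-- The matrix with columns of `a` indexed by `g`. -/
def cmat (a : Fin n → Option V → k) (g : Fin n → Option V) : Matrix (Fin n) (Fin n) k :=
  Matrix.of fun s t => a s (g t)

/-- All maximal minors are nonzero. -/
def Gen (a : Fin n → Option V → k) : Prop :=
  ∀ g : Fin n → Option V, Function.Injective g → (cmat a g).det ≠ 0

open Classical in
/-- An enumeration of a set with `n` elements. -/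
noncomputable def enum (n : ℕ) (F : Finset V) : Fin n → Option V :=
  if h : F.card = n then fun t => some ((F.equivFinOfCardEq h).symm t) else fun _ => none

lemma enum_injective {F : Finset V} (h : F.card = n) : Function.Injective (enum n F) := by
  intro s t hst
  rw [enum, dif_pos h] at hst
  have := Option.some_injective _ hst
  exact (F.equivFinOfCardEq h).symm.injective (Subtype.ext this)

lemma enum_mem {F : Finset V} (h : F.card = n) (t : Fin n) : ∃ v ∈ F, enum n F t = some v := by
  rw [enum, dif_pos h]
  exact ⟨_, ((F.equivFinOfCardEq h).symm t).2, rfl⟩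

lemma exists_enum {F : Finset V} (h : F.card = n) {v : V} (hv : v ∈ F) :
    ∃ t, enum n F t = some v := by
  rw [enum, dif_pos h]
  exact ⟨F.equivFinOfCardEq h ⟨v, hv⟩, by simp⟩

lemma sum_enum {M : Type*} [AddCommMonoid M] {F : Finset V} (h : F.card = n) (f : V → M)
    (hf : ∀ v ∉ F, f v = 0) : ∑ v, f v = ∑ t, (enum n F t).elim 0 f := by
  classical
  rw [← Finset.sum_subset (Finset.subset_univ F) fun v _ hv => hf v hv, ← Finset.sum_coe_sort,
    ← (F.equivFinOfCardEq h).symm.sum_comp]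
  refine Finset.sum_congr rfl fun t _ => ?_
  rw [enum, dif_pos h]
  rfl

/-- The coordinates, on all columns, of the vector with coordinates `x` on the columns of `F`. -/
noncomputable def spread (n : ℕ) (F : Finset V) (x : Fin n → k) (o : Option V) : k :=
  ∑ t, if enum n F t = o then x t else 0

lemma spread_enum {F : Finset V} (h : F.card = n) (x : Fin n → k) (t : Fin n) :
    spread n F x (enum n F t) = x t := by
  rw [spread, Finset.sum_eq_single t]
  · rw [if_pos rfl]
  · intro s _ hs
    rw [if_neg fun e => hs (enum_injective h e)]
  · intro h; exact absurd (Finset.mem_univ t) h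

lemma spread_of_notMem {F : Finset V} (h : F.card = n) (x : Fin n → k) {v : V} (hv : v ∉ F) :
    spread n F x (some v) = 0 :=
  Finset.sum_eq_zero fun t _ => by
    obtain ⟨u, hu, hut⟩ := enum_mem h t
    rw [hut, if_neg]
    intro e
    rw [Option.some_inj.1 e] at hu
    exact hv hu

lemma sum_mul_spread {F : Finset V} (h : F.card = n) (a : Fin n → Option V → k) (x : Fin n → k)
    (s : Fin n) : ∑ v, a s (some v) * spread n F x (some v) =
      (cmat a (enum n F)).mulVec x s := by
  rw [sum_enum h _ fun v hv => by rw [spread_of_notMem h x hv, mul_zero]]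
  refine Finset.sum_congr rfl fun t _ => ?_
  obtain ⟨v, -, hv⟩ := enum_mem h t
  rw [hv, Option.elim_some, ← hv, spread_enum h]
  rfl

/-- The point attached to a facet: it spans the kernel of `a` on the columns of `F` and `none`. -/
noncomputable def pt (a : Fin n → Option V → k) (F : Finset V) (o : Option V) : k :=
  (if o = none then 1 else 0) +
    spread n F ((cmat a (enum n F))⁻¹.mulVec fun s => a s none) o

lemma pt_some (a : Fin n → Option V → k) (F : Finset V) (v : V) : pt a F (some v) =
    spread n F ((cmat a (enum n F))⁻¹.mulVec fun s => a s none) (some v) := by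
  rw [pt, if_neg (Option.some_ne_none v), zero_add]

lemma pt_of_notMem (a : Fin n → Option V → k) {F : Finset V} (h : F.card = n) {v : V}
    (hv : v ∉ F) : pt a F (some v) = 0 := by
  rw [pt_some, spread_of_notMem h _ hv]

lemma Gen.isUnit {a : Fin n → Option V → k} (ha : Gen a) {F : Finset V} (h : F.card = n) :
    IsUnit (cmat a (enum n F)).det := (ha _ (enum_injective h)).isUnit

lemma Gen.sum_pt {a : Fin n → Option V → k} (ha : Gen a) {F : Finset V} (h : F.card = n)
    (s : Fin n) : ∑ v, a s (some v) * pt a F (some v) = a s none := by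
  simp only [pt_some]
  rw [sum_mul_spread h, Matrix.mulVec_mulVec, Matrix.mul_nonsing_inv _ (ha.isUnit h),
    Matrix.one_mulVec]

lemma Gen.det_mul_pt {a : Fin n → Option V → k} (ha : Gen a) {F : Finset V} (h : F.card = n)
    {v : V} {t : Fin n} (ht : enum n F t = some v) :
    (cmat a (enum n F)).det * pt a F (some v) =
      (cmat a (Function.update (enum n F) t none)).det := by
  rw [pt_some, ← ht, spread_enum h]
  have h1 : (cmat a (enum n F)).det * ((cmat a (enum n F))⁻¹.mulVec fun s => a s none) t =
      Matrix.cramer (cmat a (enum n F)) (fun s => a s none) t := by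
    have := Matrix.det_smul_inv_mulVec_eq_cramer (cmat a (enum n F)) (fun s => a s none)
      (ha.isUnit h)
    rw [← this]; rfl
  rw [h1, Matrix.cramer_apply]
  congr 1
  ext s t'
  rw [Matrix.updateCol_apply, cmat, cmat, Matrix.of_apply, Matrix.of_apply, Function.update_apply]
  split_ifs <;> rfl

lemma Gen.pt_ne_zero {a : Fin n → Option V → k} (ha : Gen a) {F : Finset V} (h : F.card = n)
    {v : V} (hv : v ∈ F) : pt a F (some v) ≠ 0 := by
  obtain ⟨t, ht⟩ := exists_enum h hv
  have h1 := ha.det_mul_pt h ht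
  refine right_ne_zero_of_mul (h1 ▸ ha _ ?_)
  intro s s' hs
  rw [Function.update_apply, Function.update_apply] at hs
  split_ifs at hs with h1 h2 h2
  · rw [h1, h2]
  · obtain ⟨u, -, hu⟩ := enum_mem h s'
    rw [hu] at hs; exact absurd hs.symm (Option.some_ne_none u)
  · obtain ⟨u, -, hu⟩ := enum_mem h s
    rw [hu] at hs; exact absurd hs (Option.some_ne_none u)
  · exact enum_injective h hs

lemma det_cmat_eq [CharP k 2] (a : Fin n → Option V → k) {g g' : Fin n → Option V}
    (hg : Function.Injective g) (hg' : Function.Injective g') (h : Set.range g = Set.range g') :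
    (cmat a g).det = (cmat a g').det := by
  let e : Equiv.Perm (Fin n) := (Equiv.ofInjective g hg).trans
    ((Equiv.setCongr h).trans (Equiv.ofInjective g' hg').symm)
  have he : ∀ t, g' (e t) = g t := fun t => by
    have := Equiv.apply_ofInjective_symm hg' (Equiv.setCongr h (Equiv.ofInjective g hg t))
    exact this
  have hm : cmat a g = (cmat a g').submatrix id e := by
    ext s t
    simp [cmat, he]
  rw [hm, Matrix.det_permute']
  rcases Int.units_eq_one_or (Equiv.Perm.sign e) with h1 | h1 <;> rw [h1] <;>
    simp [CharTwo.neg_eq]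

lemma Gen.exists_functional {a : Fin n → Option V → k} (ha : Gen a)
    (hV : n ≤ Fintype.card (Option V)) {S : Finset (Option V)} (hS : S.card ≤ n) {v : Option V}
    (hv : v ∈ S) : ∃ x : Fin n → k, ∑ s, x s * a s v = 1 ∧
      ∀ u ∈ S, u ≠ v → ∑ s, x s * a s u = 0 := by
  obtain ⟨T, hST, -, hT⟩ := Finset.exists_subsuperset_card_eq (Finset.subset_univ S) hS
    (by rwa [Finset.card_univ])
  let e := T.equivFinOfCardEq hT
  let g : Fin n → Option V := fun t => e.symm t
  have hg : Function.Injective g := fun s t h => e.symm.injective (Subtype.ext h)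
  have hge : ∀ o (h : o ∈ T), g (e ⟨o, h⟩) = o := fun o h => by simp [g]
  have hinv := Matrix.nonsing_inv_mul (cmat a g) (ha g hg).isUnit
  have key : ∀ t t', ∑ s, (cmat a g)⁻¹ t s * a s (g t') = (1 : Matrix (Fin n) (Fin n) k) t t' := by
    intro t t'
    rw [← hinv]; rfl
  refine ⟨(cmat a g)⁻¹ (e ⟨v, hST hv⟩), ?_, fun u hu huv => ?_⟩
  · have := key (e ⟨v, hST hv⟩) (e ⟨v, hST hv⟩)
    rwa [hge, Matrix.one_apply_eq] at this
  · have := key (e ⟨v, hST hv⟩) (e ⟨u, hST hu⟩)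
    rwa [hge, Matrix.one_apply_ne] at this
    intro h
    exact huv (congrArg Subtype.val (e.injective h)).symm

/-- The linear forms given by the rows of `a`. -/
def lf (a : Fin n → Option V → k) (i : ℕ) (v : V) : k :=
  if h : i < n then a ⟨i, h⟩ (some v) else 0

lemma lin_eq_sum (a : Fin n → Option V → k) (x : Fin n → k) :
    lin (fun v => ∑ s, x s * a s (some v)) = ∑ s : Fin n, C (x s) * lin (lf a s) := by
  simp only [lin, map_sum, Finset.sum_mul, Finset.mul_sum]
  rw [Finset.sum_comm]
  refine Finset.sum_congr rfl fun s _ => Finset.sum_congr rfl fun v _ => ?_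
  rw [lf, dif_pos s.2, C_mul, mul_assoc]

lemma lin_comb_mem (a : Fin n → Option V → k) (x : Fin n → k) (Δ : Set (Finset V)) :
    lin (fun v => ∑ s, x s * a s (some v)) ∈ AI Δ (lf a) n := by
  rw [lin_eq_sum]
  exact Ideal.sum_mem _ fun s _ => Ideal.mul_mem_left _ _ (lin_mem_AI _ _ s.2)

/-- Evaluation at the point of a facet. -/
noncomputable def ev (a : Fin n → Option V → k) (F : Finset V) : MvPolynomial V k →ₐ[k] k :=
  aeval fun v => pt a F (some v)

lemma Gen.ev_lin {a : Fin n → Option V → k} (ha : Gen a) {F : Finset V} (h : F.card = n)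
    (s : Fin n) : ev a F (lin (lf a s)) = a s none := by
  rw [← ha.sum_pt h s, lin, map_sum]
  refine Finset.sum_congr rfl fun v _ => ?_
  rw [map_mul, ev, aeval_C, aeval_X, lf, dif_pos s.2]
  rfl

lemma ev_monomial (a : Fin n → Option V → k) (F : Finset V) (m : V →₀ ℕ) :
    ev a F (monomial m 1) = ∏ v, pt a F (some v) ^ m v := by
  rw [monomial_one_eq, map_prod]
  refine Finset.prod_congr rfl fun v _ => ?_
  rw [map_pow, ev, aeval_X]

lemma ev_monomial_eq_zero (a : Fin n → Option V → k) {F : Finset V} (h : F.card = n) {m : V →₀ ℕ}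
    (hm : ¬ m.support ⊆ F) : ev a F (monomial m 1) = 0 := by
  obtain ⟨v, hv, hvF⟩ := Finset.not_subset.1 hm
  rw [ev_monomial]
  refine Finset.prod_eq_zero (Finset.mem_univ v) ?_
  rw [pt_of_notMem a h hvF, zero_pow (Finsupp.mem_support_iff.1 hv)]

open Classical in
/-- The facets of a complex, as a finite set. -/
noncomputable def fct (K : Set (Finset V)) (n : ℕ) : Finset (Finset V) :=
  Finset.univ.filter (IsFacet K n)

lemma mem_fct {K : Set (Finset V)} {F : Finset V} : F ∈ fct K n ↔ IsFacet K n F := by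
  classical
  simp [fct]

/-- The weight of a facet in the degree map. -/
noncomputable def wt (a : Fin n → Option V → k) (F : Finset V) : k :=
  ((cmat a (enum n F)).det * ∏ v ∈ F, pt a F (some v))⁻¹

/-- The degree map. -/
noncomputable def dg (K : Set (Finset V)) (a : Fin n → Option V → k) : MvPolynomial V k →ₗ[k] k :=
  ∑ F ∈ fct K n, wt a F • (ev a F).toLinearMap

lemma dg_apply (K : Set (Finset V)) (a : Fin n → Option V → k) (p : MvPolynomial V k) :
    dg K a p = ∑ F ∈ fct K n, wt a F * ev a F p := by
  simp [dg, LinearMap.sum_apply]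

lemma dg_monomial_eq_zero {K : Set (Finset V)} (hK : IsLowerSet K) (a : Fin n → Option V → k)
    {m : V →₀ ℕ} (hm : m.support ∉ K) : dg K a (monomial m 1) = 0 := by
  rw [dg_apply]
  refine Finset.sum_eq_zero fun F hF => ?_
  have hF' := mem_fct.1 hF
  rw [ev_monomial_eq_zero a hF'.2 fun h => hm (hK h hF'.1), mul_zero]

lemma Gen.dg_lin_mul {K : Set (Finset V)} {a : Fin n → Option V → k} (ha : Gen a) (s : Fin n)
    (p : MvPolynomial V k) : dg K a (lin (lf a s) * p) = a s none * dg K a p := by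
  rw [dg_apply, dg_apply, Finset.mul_sum]
  refine Finset.sum_congr rfl fun F hF => ?_
  rw [map_mul, ha.ev_lin (mem_fct.1 hF).2, mul_left_comm]

/-- The exponent of a squarefree monomial. -/
noncomputable def ind (G : Finset V) : V →₀ ℕ := Finsupp.indicator G fun _ _ => 1

lemma ind_apply (G : Finset V) (v : V) : ind G v = if v ∈ G then 1 else 0 := by
  rw [ind, Finsupp.indicator_apply]
  split_ifs <;> rfl

lemma support_ind (G : Finset V) : (ind G).support = G := by
  ext v; rw [Finsupp.mem_support_iff, ind_apply]; split_ifs <;> simp_all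

lemma degree_ind (G : Finset V) : (ind G).degree = G.card := by
  rw [Finsupp.degree_apply, support_ind, Finset.card_eq_sum_ones]
  exact Finset.sum_congr rfl fun v hv => by rw [ind_apply, if_pos hv]

lemma Gen.wt_mul_ev_ind {a : Fin n → Option V → k} (ha : Gen a) {F : Finset V} (h : F.card = n) :
    wt a F * ev a F (monomial (ind F) 1) = ((cmat a (enum n F)).det)⁻¹ := by
  have h1 : ev a F (monomial (ind F) 1) = ∏ v ∈ F, pt a F (some v) := by
    rw [ev_monomial, ← Finset.prod_subset (Finset.subset_univ F)]
    · exact Finset.prod_congr rfl fun v hv => by rw [ind_apply, if_pos hv, pow_one]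
    · intro v _ hv
      rw [ind_apply, if_neg hv, pow_zero]
  have h2 : ∏ v ∈ F, pt a F (some v) ≠ 0 :=
    Finset.prod_ne_zero_iff.2 fun v hv => ha.pt_ne_zero h hv
  rw [h1, wt, mul_inv, mul_assoc, inv_mul_cancel₀ h2, mul_one]

lemma Gen.dg_ind {K : Set (Finset V)} {a : Fin n → Option V → k} (ha : Gen a) {F : Finset V}
    (hF : IsFacet K n F) : dg K a (monomial (ind F) 1) = ((cmat a (enum n F)).det)⁻¹ := by
  rw [dg_apply, Finset.sum_eq_single F, ha.wt_mul_ev_ind hF.2]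
  · intro G hG hne
    have hG' := mem_fct.1 hG
    rw [ev_monomial_eq_zero a hG'.2, mul_zero]
    rw [support_ind]
    intro h
    exact hne (Finset.eq_of_subset_of_card_le h (by rw [hG'.2, hF.2])).symm
  · intro h
    exact absurd (mem_fct.2 hF) h

end GenericPoints

section Duality

open MvPolynomial

variable {k : Type*} [Field k] {V : Type*} [Fintype V] [DecidableEq V] {n : ℕ}

lemma IsBdry.anti {K : Set (Finset V)} {F G : Finset V} (h : IsBdry K n G) (hFG : F ⊆ G) :
    IsBdry K n F := by
  obtain ⟨σ, hσ, h'⟩ := h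
  exact ⟨σ, hFG.trans hσ, h'⟩

lemma exists_repeated {F : Finset V} {m : V →₀ ℕ} (h : (F ∪ m.support).card < F.card + m.degree) :
    ∃ v ∈ m.support, v ∈ F ∨ 2 ≤ m v := by
  by_contra hcon
  push Not at hcon
  have hd : Disjoint F m.support := by
    rw [Finset.disjoint_right]
    exact fun v hv => (hcon v hv).1
  have hs : m.degree = m.support.card := by
    rw [Finsupp.degree_apply, Finset.card_eq_sum_ones]
    refine Finset.sum_congr rfl fun v hv => ?_
    have h1 := (hcon v hv).2
    have h2 := Finsupp.mem_support_iff.1 hv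
    omega
  rw [Finset.card_union_of_disjoint hd, hs] at h
  exact lt_irrefl _ h

lemma union_support_replace {F : Finset V} {m : V →₀ ℕ} {v : V} (hv : v ∈ m.support)
    (h : v ∈ F ∨ 2 ≤ m v) (u : V) :
    F ∪ (m - Finsupp.single v 1 + Finsupp.single u 1).support = insert u (F ∪ m.support) := by
  ext w
  simp only [Finset.mem_union, Finset.mem_insert, Finsupp.mem_support_iff, Finsupp.add_apply,
    Finsupp.tsub_apply, Finsupp.single_apply]
  have hv' := Finsupp.mem_support_iff.1 hv
  by_cases hvw : v = w
  · subst hvw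
    by_cases huv : u = v
    · subst huv; simp
    · rw [if_pos rfl, if_neg huv]
      constructor
      · intro _; right; right; exact hv'
      · intro _
        rcases h with h | h
        · exact Or.inl h
        · right; omega
  · rw [if_neg hvw]
    by_cases huw : u = w
    · subst huw; simp
    · rw [if_neg huw]
      constructor
      · rintro (h | h)
        · exact Or.inr (Or.inl h)
        · right; right; omega
      · rintro (h | h | h)
        · exact absurd h.symm huw
        · exact Or.inl h
        · right; omega

lemma sub_single_add_single {m : V →₀ ℕ} {v : V} (hv : v ∈ m.support) :
    m - Finsupp.single v 1 + Finsupp.single v 1 = m := by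
  refine tsub_add_cancel_of_le ?_
  rw [Finsupp.single_le_iff]
  exact Nat.one_le_iff_ne_zero.2 (Finsupp.mem_support_iff.1 hv)

lemma degree_replace {m : V →₀ ℕ} {v : V} (hv : v ∈ m.support) (u : V) :
    (m - Finsupp.single v 1 + Finsupp.single u 1).degree = m.degree := by
  conv_rhs => rw [← sub_single_add_single hv]
  rw [map_add, map_add, Finsupp.degree_single, Finsupp.degree_single]

lemma lin_mul_monomial (c : V → k) (m : V →₀ ℕ) {T : Finset V} {v : V} (hv : v ∈ T)
    (h1 : c v = 1) (h0 : ∀ u ∈ T, u ≠ v → c u = 0) : lin c * monomial m 1 =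
      monomial (m + Finsupp.single v 1) 1 +
        ∑ u ∈ Tᶜ, C (c u) * monomial (m + Finsupp.single u 1) 1 := by
  have hx : ∀ u, C (c u) * X u * monomial m (1 : k) =
      C (c u) * monomial (m + Finsupp.single u 1) 1 := fun u => by
    rw [mul_assoc, X, monomial_mul, one_mul, add_comm]
  rw [lin, Finset.sum_mul, ← Finset.sum_add_sum_compl T, Finset.sum_eq_single_of_mem v hv]
  · rw [hx, h1, C_1, one_mul]
    congr 1
    exact Finset.sum_congr rfl fun u _ => hx u
  · intro u hu huv
    rw [h0 u hu huv, C_0, zero_mul, zero_mul]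

lemma Gen.exists_rel {a : Fin n → Option V → k} (ha : Gen a) (hV : n ≤ Fintype.card (Option V))
    {T : Finset V} (hT : T.card ≤ n) {v : V} (hv : v ∈ T) :
    ∃ x : Fin n → k, ∑ s, x s * a s (some v) = 1 ∧
      (∀ u ∈ T, u ≠ v → ∑ s, x s * a s (some u) = 0) := by
  obtain ⟨x, hx, h0⟩ := ha.exists_functional hV (S := T.map Function.Embedding.some) (v := some v)
    (by rwa [Finset.card_map]) (Finset.mem_map_of_mem _ hv)
  exact ⟨x, hx, fun u hu huv => h0 _ (Finset.mem_map_of_mem _ hu) fun e => huv (Option.some_inj.1 e)⟩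

lemma Gen.exists_rel_none {a : Fin n → Option V → k} (ha : Gen a)
    (hV : n ≤ Fintype.card (Option V)) {T : Finset V} (hT : T.card < n) {v : V} (hv : v ∈ T) :
    ∃ x : Fin n → k, ∑ s, x s * a s (some v) = 1 ∧
      (∀ u ∈ T, u ≠ v → ∑ s, x s * a s (some u) = 0) ∧ ∑ s, x s * a s none = 0 := by
  have hn : none ∉ T.map Function.Embedding.some := by simp
  obtain ⟨x, hx, h0⟩ := ha.exists_functional hV
    (S := insert none (T.map Function.Embedding.some)) (v := some v)
    (by rw [Finset.card_insert_of_notMem hn, Finset.card_map]; exact hT)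
    (Finset.mem_insert_of_mem (Finset.mem_map_of_mem _ hv))
  exact ⟨x, hx, fun u hu huv => h0 _ (Finset.mem_insert_of_mem (Finset.mem_map_of_mem _ hu))
    fun e => huv (Option.some_inj.1 e), h0 _ (Finset.mem_insert_self _ _) (Option.some_ne_none v).symm⟩

lemma Gen.dg_lin_comb {K : Set (Finset V)} {a : Fin n → Option V → k} (ha : Gen a) (x : Fin n → k)
    (hx : ∑ s, x s * a s none = 0) (p : MvPolynomial V k) :
    dg K a (lin (fun v => ∑ s, x s * a s (some v)) * p) = 0 := by
  rw [lin_eq_sum, Finset.sum_mul, map_sum]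
  have : ∀ s : Fin n, dg K a (C (x s) * lin (lf a s) * p) = x s * a s none * dg K a p := by
    intro s
    rw [mul_assoc, ← smul_eq_C_mul, map_smul, ha.dg_lin_mul, smul_eq_mul, mul_assoc]
  rw [Finset.sum_congr rfl fun s _ => this s, ← Finset.sum_mul, hx, zero_mul]

variable [CharP k 2]

lemma DeletionData.card_option {d : ℕ} {K : Set (Finset V)} (h : DeletionData k d K) :
    d + 1 ≤ Fintype.card (Option V) := by
  obtain ⟨G, hG, -⟩ := h.exists_facet h.empty_mem
  have := Finset.card_le_univ G
  rw [Fintype.card_option]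
  have := hG.2
  omega

lemma Gen.wt_mul_ev_ridge {d : ℕ} {a : Fin (d + 1) → Option V → k} (ha : Gen a) {σ : Finset V}
    {u : V} (hu : u ∉ σ) (hσ : σ.card = d) {t : Fin (d + 1)}
    (ht : enum (d + 1) (insert u σ) t = some u) :
    wt a (insert u σ) * ev a (insert u σ) (monomial (ind σ) 1) =
      ((cmat a (Function.update (enum (d + 1) (insert u σ)) t none)).det)⁻¹ := by
  have hc : (insert u σ).card = d + 1 := by rw [Finset.card_insert_of_notMem hu, hσ]
  have h1 : ev a (insert u σ) (monomial (ind σ) 1) = ∏ v ∈ σ, pt a (insert u σ) (some v) := by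
    rw [ev_monomial, ← Finset.prod_subset (Finset.subset_univ σ)]
    · exact Finset.prod_congr rfl fun v hv => by rw [ind_apply, if_pos hv, pow_one]
    · intro v _ hv
      rw [ind_apply, if_neg hv, pow_zero]
  have h2 : ∏ v ∈ σ, pt a (insert u σ) (some v) ≠ 0 :=
    Finset.prod_ne_zero_iff.2 fun v hv => ha.pt_ne_zero hc (Finset.mem_insert_of_mem hv)
  rw [h1, wt, Finset.prod_insert hu, ← mul_assoc, mul_inv, ha.det_mul_pt hc ht, mul_assoc,
    inv_mul_cancel₀ h2, mul_one]

lemma range_update_enum {σ : Finset V} {u : V} (hu : u ∉ σ) (hc : (insert u σ).card = n)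
    {t : Fin n} (ht : enum n (insert u σ) t = some u) :
    Function.Injective (Function.update (enum n (insert u σ)) t none) ∧
    Set.range (Function.update (enum n (insert u σ)) t none) = insert none (some '' (σ : Set V)) := by
  refine ⟨?_, ?_⟩
  · intro s s' hs
    rw [Function.update_apply, Function.update_apply] at hs
    split_ifs at hs with h1 h2 h2
    · rw [h1, h2]
    · obtain ⟨w, -, hw⟩ := enum_mem hc s'
      rw [hw] at hs; exact absurd hs.symm (Option.some_ne_none w)
    · obtain ⟨w, -, hw⟩ := enum_mem hc s
      rw [hw] at hs; exact absurd hs (Option.some_ne_none w)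
    · exact enum_injective hc hs
  · ext o
    constructor
    · rintro ⟨s, rfl⟩
      rw [Function.update_apply]
      split_ifs with h
      · exact Set.mem_insert _ _
      · obtain ⟨w, hw, hws⟩ := enum_mem hc s
        rw [hws]
        refine Set.mem_insert_of_mem _ ⟨w, ?_, rfl⟩
        rcases Finset.mem_insert.1 hw with rfl | h'
        · exact absurd (enum_injective hc (hws.trans ht.symm)) h
        · exact h'
    · rintro (rfl | ⟨w, hw, rfl⟩)
      · exact ⟨t, Function.update_self _ _ _⟩
      · obtain ⟨s, hs⟩ := exists_enum hc (Finset.mem_insert_of_mem (Finset.mem_coe.1 hw))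
        refine ⟨s, ?_⟩
        rw [Function.update_of_ne, hs]
        rintro rfl
        rw [hs, Option.some_inj] at ht
        exact hu (ht ▸ Finset.mem_coe.1 hw)

lemma eq_ind {m : V →₀ ℕ} (h : m.degree = m.support.card) : m = ind m.support := by
  have key : ¬ ∃ v ∈ m.support, 2 ≤ m v := by
    rintro ⟨v, hv, h2⟩
    have h3 : m.support.card < m.degree := by
      rw [Finsupp.degree_apply, Finset.card_eq_sum_ones]
      refine Finset.sum_lt_sum (fun u hu => ?_) ⟨v, hv, h2⟩
      exact Nat.one_le_iff_ne_zero.2 (Finsupp.mem_support_iff.1 hu)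
    omega
  ext v
  rw [ind_apply]
  split_ifs with hv
  · have h1 := Finsupp.mem_support_iff.1 hv
    have h2 : ¬ 2 ≤ m v := fun h => key ⟨v, hv, h⟩
    omega
  · exact Finsupp.notMem_support_iff.1 hv

lemma card_support_le_degree (m : V →₀ ℕ) : m.support.card ≤ m.degree := by
  rw [Finsupp.degree_apply, Finset.card_eq_sum_ones]
  exact Finset.sum_le_sum fun u hu => Nat.one_le_iff_ne_zero.2 (Finsupp.mem_support_iff.1 hu)

theorem DeletionData.dg_ridge {d : ℕ} {K : Set (Finset V)} (h : DeletionData k d K)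
    {a : Fin (d + 1) → Option V → k} (ha : Gen a) {σ : Finset V} (hσ : σ.card = d)
    (hb : ¬ IsBdry K (d + 1) σ) : dg K a (monomial (ind σ) 1) = 0 := by
  by_cases hσK : σ ∈ K
  swap
  · exact dg_monomial_eq_zero h.lower a (by rwa [support_ind])
  obtain ⟨u, v, huv, hu, hv, huK, hvK, huniq⟩ := h.two_facets hσK hσ hb
  have hcu : (insert u σ).card = d + 1 := by rw [Finset.card_insert_of_notMem hu, hσ]
  have hcv : (insert v σ).card = d + 1 := by rw [Finset.card_insert_of_notMem hv, hσ]
  have hne : insert u σ ≠ insert v σ := fun e => by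
    have : u ∈ insert v σ := e ▸ Finset.mem_insert_self u σ
    rcases Finset.mem_insert.1 this with h1 | h1
    · exact huv h1
    · exact hu h1
  have hsub : ({insert u σ, insert v σ} : Finset (Finset V)) ⊆ fct K (d + 1) := by
    intro F hF
    rcases Finset.mem_insert.1 hF with rfl | hF
    · exact mem_fct.2 ⟨huK, hcu⟩
    · rw [Finset.mem_singleton.1 hF]
      exact mem_fct.2 ⟨hvK, hcv⟩
  rw [dg_apply, ← Finset.sum_subset hsub, Finset.sum_pair hne]
  · obtain ⟨t, ht⟩ := exists_enum hcu (Finset.mem_insert_self u σ)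
    obtain ⟨t', ht'⟩ := exists_enum hcv (Finset.mem_insert_self v σ)
    obtain ⟨i1, r1⟩ := range_update_enum hu hcu ht
    obtain ⟨i2, r2⟩ := range_update_enum hv hcv ht'
    rw [ha.wt_mul_ev_ridge hu hσ ht, ha.wt_mul_ev_ridge hv hσ ht',
      det_cmat_eq a i1 i2 (r1.trans r2.symm)]
    exact CharTwo.add_self_eq_zero _
  · intro F hF hF'
    have hFf := mem_fct.1 hF
    rw [ev_monomial_eq_zero a hFf.2, mul_zero]
    rw [support_ind]
    intro hσF
    obtain ⟨c, hc, rfl⟩ := exists_insert_of_ridge hσF hFf.2 (by omega)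
    refine hF' ?_
    rcases huniq c hc hFf.1 with rfl | rfl
    · exact Finset.mem_insert_self _ _
    · exact Finset.mem_insert_of_mem (Finset.mem_singleton_self _)

/-- Interior monomials of submaximal degree have degree-map zero. -/
theorem DeletionData.dg_low {d : ℕ} {K : Set (Finset V)} (h : DeletionData k d K)
    {a : Fin (d + 1) → Option V → k} (ha : Gen a) : ∀ (e : ℕ) (m : V →₀ ℕ), m.degree = d →
    d ≤ m.support.card + e → ¬ IsBdry K (d + 1) m.support → dg K a (monomial m 1) = 0 := by
  intro e
  induction e with
  | zero =>
    intro m hm he hb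
    have h1 := card_support_le_degree m
    have h2 := eq_ind (m := m) (by omega)
    rw [h2]
    exact h.dg_ridge ha (by omega) hb
  | succ e ih =>
    intro m hm he hb
    by_cases hlt : d ≤ m.support.card + e
    · exact ih m hm hlt hb
    obtain ⟨v, hv, hv2⟩ := exists_repeated (F := ∅) (m := m) (by
      rw [Finset.empty_union, Finset.card_empty]; omega)
    obtain ⟨x, hx1, hx0, hxn⟩ := ha.exists_rel_none h.card_option (T := m.support) (by omega) hv
    have h1 := ha.dg_lin_comb (K := K) x hxn (monomial (m - Finsupp.single v 1) 1)
    rw [lin_mul_monomial _ _ hv hx1 hx0, sub_single_add_single hv, map_add, map_sum,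
      Finset.sum_eq_zero, add_zero] at h1
    · exact h1
    · intro u hu
      have hs := union_support_replace (F := ∅) hv hv2 u
      rw [Finset.empty_union, Finset.empty_union] at hs
      rw [← smul_eq_C_mul, map_smul, ih _ ((degree_replace hv u).trans hm), smul_zero]
      · rw [hs, Finset.card_insert_of_notMem (Finset.mem_compl.1 hu)]; omega
      · rw [hs]
        exact fun hb' => hb (hb'.anti (Finset.subset_insert _ _))

lemma eq_sum_C_mul_monomial (p : MvPolynomial V k) :
    p = ∑ m ∈ p.support, C (coeff m p) * monomial m 1 := by
  conv_lhs => rw [p.as_sum]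
  exact Finset.sum_congr rfl fun m _ => by rw [C_mul_monomial, mul_one]

lemma degree_eq_of_mem_support {p : MvPolynomial V k} {j : ℕ} (hp : p.IsHomogeneous j)
    {m : V →₀ ℕ} (hm : m ∈ p.support) : m.degree = j := by
  by_contra hne
  exact (mem_support_iff.1 hm) (hp.coeff_eq_zero hne)

/-- The degree map kills interior multiples of the linear forms. -/
theorem DeletionData.dg_monomial_mul {d : ℕ} {K : Set (Finset V)} (h : DeletionData k d K)
    {a : Fin (d + 1) → Option V → k} (ha : Gen a) {m₀ : V →₀ ℕ}
    (hb : ¬ IsBdry K (d + 1) m₀.support) : ∀ (s : ℕ), s ≤ d + 1 → ∀ (j : ℕ) (r : MvPolynomial V k),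
    m₀.degree + j = d + 1 → r.IsHomogeneous j → r ∈ AI (st K m₀.support) (lf a) s →
    dg K a (monomial m₀ 1 * r) = 0 := by
  intro s
  induction s with
  | zero =>
    intro _ j r _ _ hr
    rw [AI_zero, mem_faceIdeal (isLowerSet_st h.lower _)] at hr
    rw [eq_sum_C_mul_monomial r, Finset.mul_sum, map_sum]
    refine Finset.sum_eq_zero fun m hm => ?_
    rw [mul_left_comm, ← smul_eq_C_mul, map_smul, monomial_mul, one_mul, dg_monomial_eq_zero h.lower,
      smul_zero]
    intro hK
    refine (mem_support_iff.1 hm) (hr m ?_)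
    rw [Finsupp.support_add_eq_union, Finset.union_comm] at hK
    exact hK
  | succ s ih =>
    intro hs j r hj hr hrs
    cases j with
    | zero => exact ih (by omega) 0 r hj hr (mem_AI_of_mem_AI_succ hrs hr)
    | succ j =>
      obtain ⟨e, he, hre⟩ := exists_of_mem_AI_succ hrs hr
      have h1 := ih (by omega) (j + 1) _ hj
        (hr.sub (by rw [add_comm j 1]; exact (isHomogeneous_lin _).mul he)) hre
      have h2 : dg K a (monomial m₀ 1 * e) = 0 := by
        rw [eq_sum_C_mul_monomial e, Finset.mul_sum, map_sum]
        refine Finset.sum_eq_zero fun m hm => ?_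
        rw [mul_left_comm, ← smul_eq_C_mul, map_smul, monomial_mul, one_mul,
          h.dg_low ha d _ _ (by omega), smul_zero]
        · rw [Finsupp.support_add_eq_union]
          exact fun hb' => hb (hb'.anti Finset.subset_union_left)
        · rw [map_add, degree_eq_of_mem_support he hm]; omega
      have h3 : monomial m₀ 1 * r = monomial m₀ 1 * (r - lin (lf a s) * e) +
          lin (lf a ((⟨s, by omega⟩ : Fin (d + 1)) : ℕ)) * (monomial m₀ 1 * e) := by
        simp only [mul_sub]; ring
      rw [h3, map_add, h1, ha.dg_lin_mul, h2, mul_zero, add_zero]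

lemma ind_add_single {G : Finset V} {u : V} (hu : u ∉ G) :
    ind G + Finsupp.single u 1 = ind (insert u G) := by
  ext v
  rw [Finsupp.add_apply, ind_apply, ind_apply, Finsupp.single_apply]
  by_cases hvu : u = v
  · subst hvu
    rw [if_neg hu, if_pos rfl, if_pos (Finset.mem_insert_self u G)]
  · rw [if_neg hvu, add_zero]
    by_cases hv : v ∈ G
    · rw [if_pos hv, if_pos (Finset.mem_insert_of_mem hv)]
    · rw [if_neg hv, if_neg]
      rw [Finset.mem_insert]; rintro (h | h)
      · exact hvu h.symm
      · exact hv h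

lemma monomial_mem_AI_st {K : Set (Finset V)} {F : Finset V} {m : V →₀ ℕ}
    (h : F ∪ m.support ∉ K) (l : ℕ → V → k) (s : ℕ) : monomial m (1 : k) ∈ AI (st K F) l s := by
  refine faceIdeal_le_AI _ _ _ (Ideal.subset_span ⟨m, fun hm => h ?_, rfl⟩)
  rwa [Finset.union_comm]

/-- Adjacent facets have proportional squarefree monomials. -/
lemma DeletionData.adjacent {d : ℕ} {K : Set (Finset V)} (h : DeletionData k d K)
    {a : Fin (d + 1) → Option V → k} (ha : Gen a) {F G₁ G₂ : Finset V} (hG₁ : IsFacet K (d + 1) G₁)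
    (hG₂ : IsFacet K (d + 1) G₂) (hF : F ⊆ G₁ ∩ G₂) (hc : (G₁ ∩ G₂).card = d) :
    ∃ c : k, monomial (ind (G₁ \ F)) 1 - C c * monomial (ind (G₂ \ F)) 1 ∈
      AI (st K F) (lf a) (d + 1) := by
  set σ := G₁ ∩ G₂ with hσ
  obtain ⟨g₁, hg₁, e₁⟩ := exists_insert_of_ridge (σ := σ) Finset.inter_subset_left hG₁.2 (by omega)
  obtain ⟨g₂, hg₂, e₂⟩ := exists_insert_of_ridge (σ := σ) Finset.inter_subset_right hG₂.2 (by omega)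
  have hne : g₁ ≠ g₂ := by
    rintro rfl
    have : G₁ = G₂ := e₁.trans e₂.symm
    rw [this, Finset.inter_self] at hσ
    have := hG₂.2
    rw [← hσ] at this
    omega
  clear_value σ
  subst e₁ e₂
  have hins : ∀ g, g ∉ σ → insert g σ \ F = insert g (σ \ F) := fun g hg =>
    Finset.insert_sdiff_of_notMem _ fun h' => hg (hF h')
  have hnm : ∀ g, g ∉ σ → g ∉ σ \ F := fun g hg h' => hg (Finset.mem_sdiff.1 h').1
  obtain ⟨x, hx1, hx0⟩ := ha.exists_rel h.card_option (T := insert g₁ σ) (by rw [hG₁.2])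
    (Finset.mem_insert_self g₁ σ)
  have hmem := Ideal.mul_mem_right (monomial (ind (σ \ F)) 1) _ (lin_comb_mem a x (st K F))
  have hg2 : g₂ ∈ (insert g₁ σ)ᶜ := by
    rw [Finset.mem_compl, Finset.mem_insert]
    rintro (h' | h')
    · exact hne h'.symm
    · exact hg₂ h'
  rw [lin_mul_monomial _ _ (Finset.mem_insert_self g₁ σ) hx1 hx0, ind_add_single (hnm _ hg₁),
    ← hins _ hg₁, ← Finset.add_sum_erase _ _ hg2, ind_add_single (hnm _ hg₂), ← hins _ hg₂,
    ← add_assoc] at hmem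
  refine ⟨∑ s, x s * a s (some g₂), ?_⟩
  have hrest : ∑ u ∈ (insert g₁ σ)ᶜ.erase g₂, C (∑ s, x s * a s (some u)) *
      monomial (ind (σ \ F) + Finsupp.single u 1) 1 ∈ AI (st K F) (lf a) (d + 1) := by
    refine Ideal.sum_mem _ fun u hu => Ideal.mul_mem_left _ _ (monomial_mem_AI_st ?_ _ _)
    rw [Finset.mem_erase, Finset.mem_compl, Finset.mem_insert, not_or] at hu
    obtain ⟨hu2, hu1, huσ⟩ := hu
    rw [ind_add_single (hnm u huσ), support_ind, Finset.union_insert, Finset.union_sdiff_of_subset hF]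
    intro hK
    exact h.ridge_le_two hc hg₁ hg₂ huσ hne (Ne.symm hu1) (Ne.symm hu2) hG₁.1 hG₂.1 hK
  have := (Submodule.add_mem_iff_left _ hrest).1 hmem
  rwa [CharTwo.sub_eq_add]

lemma DeletionData.proportional {d : ℕ} {K : Set (Finset V)} (h : DeletionData k d K)
    {a : Fin (d + 1) → Option V → k} (ha : Gen a) {F G₀ : Finset V} (hFK : F ∈ K)
    (hG₀ : IsFacet K (d + 1) G₀) (hFG₀ : F ⊆ G₀) {G : Finset V} (hG : IsFacet K (d + 1) G)
    (hFG : F ⊆ G) :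
    ∃ c : k, monomial (ind (G \ F)) 1 - C c * monomial (ind (G₀ \ F)) 1 ∈
      AI (st K F) (lf a) (d + 1) := by
  let P : Finset V → Prop := fun G => ∃ c : k, monomial (ind (G \ F)) 1 -
    C c * monomial (ind (G₀ \ F)) 1 ∈ AI (st K F) (lf a) (d + 1)
  have hadj : ∀ G₁ G₂, IsFacet K (d + 1) G₁ → IsFacet K (d + 1) G₂ → F ⊆ G₁ ∩ G₂ →
      (G₁ ∩ G₂).card = d → P G₂ → P G₁ := by
    rintro G₁ G₂ h₁ h₂ hF hc ⟨c, hc'⟩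
    obtain ⟨c₁, hc₁⟩ := h.adjacent ha h₁ h₂ hF hc
    refine ⟨c₁ * c, ?_⟩
    have := Ideal.add_mem _ hc₁ (Ideal.mul_mem_left _ (C c₁) hc')
    rwa [mul_sub, sub_add_sub_cancel, ← mul_assoc, ← C_mul] at this
  have hle : F.card ≤ d + 1 := h.card_le F hFK
  have := h.conn P (d + 1 - F.card) F hFK (by omega)
    (fun G₁ G₂ h₁ h₂ hF hc => propext ⟨hadj G₂ G₁ h₂ h₁ (by rwa [Finset.inter_comm])
      (by rwa [Finset.inter_comm]), hadj G₁ G₂ h₁ h₂ hF hc⟩) G G₀ hG hG₀ hFG hFG₀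
  change P G
  rw [this]
  exact ⟨1, by rw [C_1, one_mul, sub_self]; exact zero_mem _⟩

/-- The top degree of a star ring is spanned by the monomial of a facet. -/
lemma DeletionData.top_monomial {d : ℕ} {K : Set (Finset V)} (h : DeletionData k d K)
    {a : Fin (d + 1) → Option V → k} (ha : Gen a) {F G₀ : Finset V} (hFK : F ∈ K)
    (hG₀ : IsFacet K (d + 1) G₀) (hFG₀ : F ⊆ G₀) : ∀ (e : ℕ) (m : V →₀ ℕ),
    F.card + m.degree = d + 1 → d + 1 ≤ (F ∪ m.support).card + e →
    ∃ c : k, monomial m 1 - C c * monomial (ind (G₀ \ F)) 1 ∈ AI (st K F) (lf a) (d + 1) := by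
  intro e
  induction e with
  | zero =>
    intro m hm he
    by_cases hK : F ∪ m.support ∈ K
    · have h1 := Finset.card_union_le F m.support
      have h2 := card_support_le_degree m
      have h3 : (F ∪ m.support).card = d + 1 := by omega
      have hd : Disjoint F m.support := by
        rw [← Finset.card_union_eq_card_add_card]; omega
      have h4 := eq_ind (m := m) (by omega)
      have h5 : m.support = (F ∪ m.support) \ F := by
        rw [Finset.union_sdiff_left, Finset.sdiff_eq_self_of_disjoint hd.symm]
      rw [h4, h5]
      exact h.proportional ha hFK hG₀ hFG₀ ⟨hK, h3⟩ Finset.subset_union_left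
    · exact ⟨0, by rw [C_0, zero_mul, sub_zero]; exact monomial_mem_AI_st hK _ _⟩
  | succ e ih =>
    intro m hm he
    by_cases hlt : d + 1 ≤ (F ∪ m.support).card + e
    · exact ih m hm hlt
    obtain ⟨v, hv, hv2⟩ := exists_repeated (F := F) (m := m) (by omega)
    obtain ⟨x, hx1, hx0⟩ := ha.exists_rel h.card_option (T := F ∪ m.support) (by omega)
      (Finset.mem_union_right _ hv)
    have hmem := Ideal.mul_mem_right (monomial (m - Finsupp.single v 1) 1) _
      (lin_comb_mem a x (st K F))
    rw [lin_mul_monomial _ _ (Finset.mem_union_right _ hv) hx1 hx0, sub_single_add_single hv] at hmem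
    have hex : ∀ u : V, ∃ c : k, u ∈ (F ∪ m.support)ᶜ →
        monomial (m - Finsupp.single v 1 + Finsupp.single u 1) 1 - C c * monomial (ind (G₀ \ F)) 1 ∈
          AI (st K F) (lf a) (d + 1) := by
      intro u
      by_cases hu : u ∈ (F ∪ m.support)ᶜ
      · obtain ⟨c, hc⟩ := ih (m - Finsupp.single v 1 + Finsupp.single u 1)
          (by rw [degree_replace hv]; exact hm)
          (by rw [union_support_replace hv hv2,
                Finset.card_insert_of_notMem (Finset.mem_compl.1 hu)]; omega)
        exact ⟨c, fun _ => hc⟩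
      · exact ⟨0, fun h => absurd h hu⟩
    choose c hc using hex
    refine ⟨-∑ u ∈ (F ∪ m.support)ᶜ, (∑ s, x s * a s (some u)) * c u, ?_⟩
    have hs : ∑ u ∈ (F ∪ m.support)ᶜ, C (∑ s, x s * a s (some u)) *
        (monomial (m - Finsupp.single v 1 + Finsupp.single u 1) 1 -
          C (c u) * monomial (ind (G₀ \ F)) 1) ∈ AI (st K F) (lf a) (d + 1) :=
      Ideal.sum_mem _ fun u hu => Ideal.mul_mem_left _ _ (hc u hu)
    have := Ideal.sub_mem _ hmem hs
    convert this using 1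
    simp only [mul_sub, Finset.sum_sub_distrib, ← mul_assoc, ← C_mul]
    rw [← Finset.sum_mul, ← map_sum, C_neg]
    ring

lemma DeletionData.top_spanned {d : ℕ} {K : Set (Finset V)} (h : DeletionData k d K)
    {a : Fin (d + 1) → Option V → k} (ha : Gen a) {F G₀ : Finset V} (hFK : F ∈ K)
    (hG₀ : IsFacet K (d + 1) G₀) (hFG₀ : F ⊆ G₀) {j : ℕ} (hj : F.card + j = d + 1)
    {p : MvPolynomial V k} (hp : p.IsHomogeneous j) :
    ∃ c : k, p - C c * monomial (ind (G₀ \ F)) 1 ∈ AI (st K F) (lf a) (d + 1) := by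
  have hex : ∀ m : V →₀ ℕ, ∃ c : k, m ∈ p.support →
      monomial m 1 - C c * monomial (ind (G₀ \ F)) 1 ∈ AI (st K F) (lf a) (d + 1) := by
    intro m
    by_cases hm : m ∈ p.support
    · obtain ⟨c, hc⟩ := h.top_monomial ha hFK hG₀ hFG₀ (d + 1) m
        (by rw [degree_eq_of_mem_support hp hm]; exact hj) (by omega)
      exact ⟨c, fun _ => hc⟩
    · exact ⟨0, fun h => absurd h hm⟩
  choose c hc using hex
  refine ⟨∑ m ∈ p.support, coeff m p * c m, ?_⟩
  have hs : ∑ m ∈ p.support, C (coeff m p) *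
      (monomial m 1 - C (c m) * monomial (ind (G₀ \ F)) 1) ∈ AI (st K F) (lf a) (d + 1) :=
    Ideal.sum_mem _ fun m hm => Ideal.mul_mem_left _ _ (hc m hm)
  convert hs using 1
  simp only [mul_sub, Finset.sum_sub_distrib, ← mul_assoc, ← C_mul]
  rw [← Finset.sum_mul, ← map_sum, ← eq_sum_C_mul_monomial]

lemma DeletionData.cm_lk {d : ℕ} {K : Set (Finset V)} (h : DeletionData k d K)
    (F : Finset V) : CM k (d + 1 - F.card) (lk K F) (Finset.univ \ F) := by
  refine CM.lk ⟨h.lower, h.card_le, fun _ _ => Finset.subset_univ _, fun G hG j hj z hz hbz => ?_⟩ F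
  exact h.lk_low hG hj hz hbz

/-- Nondegeneracy of the pairing between a star ring and the interior ideal. -/
theorem DeletionData.mem_of_dg {d : ℕ} {K : Set (Finset V)} (h : DeletionData k d K)
    {a : Fin (d + 1) → Option V → k} (ha : Gen a) (hfl : Flag Finset.univ (d + 1) (lf a)) :
    ∀ (e : ℕ) (F : Finset V), F ∈ K → F.card + e = d + 1 → ∀ (j : ℕ) (p : MvPolynomial V k),
    p.IsHomogeneous j → (∀ m : V →₀ ℕ, m.degree + F.card + j = d + 1 →
      ¬ IsBdry K (d + 1) (F ∪ m.support) → dg K a (monomial (ind F + m) 1 * p) = 0) →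
    p ∈ AI (st K F) (lf a) (d + 1) := by
  intro e
  induction e with
  | zero => ?_
  | succ e ih => ?_
  all_goals
    intro F hF hFe j p hp hdg
    by_cases hcase : j ≠ d + 1 - F.card ∨ IsBdry K (d + 1) F
    swap
    · push Not at hcase
      obtain ⟨hj, hb⟩ := hcase
      obtain ⟨G₀, hG₀, hFG₀⟩ := h.exists_facet hF
      obtain ⟨c, hc⟩ := h.top_spanned ha hF hG₀ hFG₀ (j := j) (by omega) hp
      have hcard : (G₀ \ F).card = j := by
        rw [Finset.card_sdiff_of_subset hFG₀, hG₀.2, hj]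
      have h1 := h.dg_monomial_mul ha (m₀ := ind F) (by rwa [support_ind]) (d + 1) le_rfl j _
        (by rw [degree_ind]; omega) (hp.sub (by
          have := (isHomogeneous_C V c).mul
            (isHomogeneous_monomial (1 : k) (degree_ind (G₀ \ F)))
          rwa [zero_add, hcard] at this)) (by rwa [support_ind])
      have h2 := hdg 0 (by rw [map_zero]; omega) (by rwa [Finsupp.support_zero, Finset.union_empty])
      have h3 : ind F + ind (G₀ \ F) = ind G₀ := by
        ext v
        rw [Finsupp.add_apply, ind_apply, ind_apply, ind_apply]
        by_cases hvF : v ∈ F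
        · rw [if_pos hvF, if_pos (hFG₀ hvF), if_neg fun h => (Finset.mem_sdiff.1 h).2 hvF]
        · by_cases hvG : v ∈ G₀
          · rw [if_neg hvF, if_pos (Finset.mem_sdiff.2 ⟨hvG, hvF⟩), if_pos hvG]
          · rw [if_neg hvF, if_neg hvG, if_neg fun h => hvG (Finset.mem_sdiff.1 h).1]
      rw [add_zero] at h2
      rw [mul_sub, map_sub, h2, zero_sub, neg_eq_zero, mul_left_comm, ← smul_eq_C_mul, map_smul,
        monomial_mul, one_mul, h3, ha.dg_ind hG₀, smul_eq_mul, mul_eq_zero] at h1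
      have hc0 := h1.resolve_right (inv_ne_zero (ha _ (enum_injective hG₀.2)))
      rwa [hc0, C_0, zero_mul, sub_zero] at hc
    have hle := h.card_le F hF
    have hadd : d + 1 - F.card + F.card = d + 1 := by omega
    have key := mem_AI_st_of_insert F h.lower (Finset.subset_univ F) (h.cm_lk F) (l := lf a)
      (by rwa [hadd]) (j := j) (hcase.imp_right fun hb z hz hbz => by
        rw [h.lk_bdry hb hadd hz hbz]; exact zero_mem _) hp
    rw [hadd] at key
    refine key fun v hv => ?_
    by_cases hvK : insert v F ∈ K
    swap
    · rw [AI_st_eq_top hvK]; trivial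
    have hcard := Finset.card_insert_of_notMem hv
    first
    | (exfalso
       have := h.card_le _ hvK
       omega)
    | (refine ih (insert v F) hvK (by omega) j p hp fun m hm hb => ?_
       rw [← ind_add_single hv, add_assoc]
       refine hdg _ ?_ ?_
       · rw [map_add, Finsupp.degree_single]; omega
       · rw [Finsupp.support_add_eq_union, Finsupp.support_single _ one_ne_zero]
         rwa [Finset.insert_union, Finset.insert_eq, Finset.union_left_comm] at hb)

end Duality

section Derivations

open MvPolynomial

/-- Additive maps satisfying the Leibniz rule. -/
structure Der (A : Type*) [CommRing A] extends A →+ A where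
  leibniz' : ∀ x y, toFun (x * y) = x * toFun y + y * toFun x

instance {A : Type*} [CommRing A] : FunLike (Der A) A A where
  coe D := D.toFun
  coe_injective D E h := by
    obtain ⟨D, _⟩ := D
    obtain ⟨E, _⟩ := E
    congr
    exact DFunLike.coe_injective h

instance {A : Type*} [CommRing A] : AddMonoidHomClass (Der A) A A where
  map_add D := D.map_add'
  map_zero D := D.map_zero'

lemma Der.map_one {A : Type*} [CommRing A] (D : Der A) : D 1 = 0 := by
  have h := D.leibniz' 1 1
  rw [one_mul, one_mul, left_eq_add] at h
  exact h

lemma Der.leibniz {A : Type*} [CommRing A] (D : Der A) (x y : A) :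
    D (x * y) = x * D y + y * D x := D.leibniz' x y

/-- A derivation from a section of the dual numbers. -/
def derivOfSection {A : Type*} [CommRing A] (f : A →+* TrivSqZeroExt A A)
    (hf : ∀ x, (f x).fst = x) : Der A where
  toAddMonoidHom := (TrivSqZeroExt.sndHom A A).toAddMonoidHom.comp f.toAddMonoidHom
  leibniz' x y := by
    change (f (x * y)).snd = x • (f y).snd + y • (f x).snd
    rw [map_mul, TrivSqZeroExt.snd_mul, hf, hf, op_smul_eq_smul]

lemma derivOfSection_apply {A : Type*} [CommRing A] (f : A →+* TrivSqZeroExt A A)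
    (hf : ∀ x, (f x).fst = x) (x : A) : derivOfSection f hf x = (f x).snd := rfl

lemma exists_derivation_fractionRing {σ k : Type*} [Field k] [Algebra (ZMod 2) k]
    [Algebra (MvPolynomial σ (ZMod 2)) k] [IsScalarTower (ZMod 2) (MvPolynomial σ (ZMod 2)) k]
    [IsFractionRing (MvPolynomial σ (ZMod 2)) k] (x : σ → k) :
    ∃ D : Der k, ∀ i, D (algebraMap (MvPolynomial σ (ZMod 2)) k (X i)) = x i := by
  let g : MvPolynomial σ (ZMod 2) →ₐ[ZMod 2] TrivSqZeroExt k k :=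
    aeval fun i => TrivSqZeroExt.inl (algebraMap (MvPolynomial σ (ZMod 2)) k (X i)) + TrivSqZeroExt.inr (x i)
  have hg : ∀ p, (g p).fst = algebraMap _ k p := by
    intro p
    have : (TrivSqZeroExt.fstHom (ZMod 2) k k).comp g =
        IsScalarTower.toAlgHom (ZMod 2) (MvPolynomial σ (ZMod 2)) k := by
      ext i
      simp [g]
    exact DFunLike.congr_fun this p
  have hu : ∀ y : nonZeroDivisors (MvPolynomial σ (ZMod 2)), IsUnit (g y) := by
    intro y
    rw [TrivSqZeroExt.isUnit_iff_isUnit_fst, hg]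
    exact IsLocalization.map_units k y
  let f : k →+* TrivSqZeroExt k k := IsLocalization.lift (M := nonZeroDivisors _) (g := g.toRingHom) hu
  have hf : ∀ p, f (algebraMap _ k p) = g p := fun p => IsLocalization.lift_eq _ p
  have hfst : ∀ y, (f y).fst = y := by
    intro y
    have : (TrivSqZeroExt.fstHom (ZMod 2) k k).toRingHom.comp f = RingHom.id k := by
      refine IsLocalization.ringHom_ext (nonZeroDivisors (MvPolynomial σ (ZMod 2))) ?_
      refine RingHom.ext fun p => ?_
      change (f (algebraMap _ k p)).fst = algebraMap _ k p
      rw [hf, hg]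
    exact DFunLike.congr_fun this y
  refine ⟨derivOfSection f hfst, fun i => ?_⟩
  rw [derivOfSection_apply, hf]
  simp [g]

/-- The section of the dual numbers attached to a derivation acting on coefficients. -/
noncomputable def coeffSection {k : Type*} [Field k] {V : Type*} (D : Der k) :
    MvPolynomial V k →+* TrivSqZeroExt (MvPolynomial V k) (MvPolynomial V k) :=
  eval₂Hom
    { toFun := fun x => TrivSqZeroExt.inl (C x) + TrivSqZeroExt.inr (C (D x))
      map_one' := by simp [D.map_one]
      map_zero' := by simp
      map_add' := fun x y => by
        ext <;> simp
      map_mul' := fun x y => by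
        ext <;> simp [mul_comm, D.leibniz] }
    fun v => TrivSqZeroExt.inl (X v)

lemma fst_coeffSection {k : Type*} [Field k] {V : Type*} (D : Der k)
    (p : MvPolynomial V k) : (coeffSection D p).fst = p := by
  have : (TrivSqZeroExt.fstHom ℤ (MvPolynomial V k) (MvPolynomial V k)).toRingHom.comp
      (coeffSection D) = RingHom.id (MvPolynomial V k) := by
    ext <;> simp [coeffSection]
  exact DFunLike.congr_fun this p

/-- The derivation acting on coefficients. -/
noncomputable def coeffDer {k : Type*} [Field k] {V : Type*} (D : Der k) :
    Der (MvPolynomial V k) :=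
  derivOfSection (coeffSection D) (fst_coeffSection D)

lemma coeffDer_C {k : Type*} [Field k] {V : Type*} (D : Der k) (x : k) :
    coeffDer D (C x : MvPolynomial V k) = C (D x) := by
  rw [coeffDer, derivOfSection_apply, coeffSection, coe_eval₂Hom, eval₂_C]
  simp

lemma coeffDer_X {k : Type*} [Field k] {V : Type*} (D : Der k) (v : V) :
    coeffDer D (X v : MvPolynomial V k) = 0 := by
  rw [coeffDer, derivOfSection_apply, coeffSection, coe_eval₂Hom, eval₂_X]
  simp

end Derivations

section GenericMatrix

open MvPolynomial

theorem exists_generic.{u} (V : Type u) [Fintype V] [DecidableEq V] (n : ℕ) : ∃ (k : Type u) (_ : Field k) (_ : CharP k 2) (a : Fin n → Option V → k)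
    (δ : Fin n → V → Der k), Gen a ∧ Flag Finset.univ n (lf a) ∧
    ∀ s v t o, δ s v (a t o) = if t = s ∧ o = some v then 1 else 0 := by
  let R := MvPolynomial (Fin n × Option V) (ZMod 2)
  let k := FractionRing R
  have hinj : Function.Injective (algebraMap R k) := IsFractionRing.injective R k
  have hchar : CharP k 2 := charP_of_injective_algebraMap hinj 2
  have hdet : ∀ {N : ℕ} (f : Fin N → Fin n) (g : Fin N → Option V), Function.Injective f →
      Function.Injective g →
      (Matrix.of fun s t => algebraMap R k (X (f s, g t))).det ≠ 0 := by
    intro N f g hf hg h0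
    have h1 : (Matrix.of fun s t => (X (f s, g t) : R)).det = 0 := by
      apply hinj
      rw [map_zero, ← h0, RingHom.map_det]
      rfl
    classical
    let φ : R →ₐ[ZMod 2] ZMod 2 :=
      aeval fun q => if ∃ s, f s = q.1 ∧ g s = q.2 then 1 else 0
    have h2 := congrArg φ h1
    rw [map_zero, AlgHom.map_det] at h2
    have h3 : φ.mapMatrix (Matrix.of fun s t => (X (f s, g t) : R)) = 1 := by
      ext s t
      rw [AlgHom.mapMatrix_apply, Matrix.map_apply, Matrix.of_apply, aeval_X, Matrix.one_apply]
      refine if_congr ⟨?_, ?_⟩ rfl rfl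
      · rintro ⟨u, hu, hu'⟩
        rw [← hf hu, ← hg hu']
      · rintro rfl
        exact ⟨s, rfl, rfl⟩
    rw [h3, Matrix.det_one] at h2
    exact one_ne_zero h2
  choose D hD using fun (s : Fin n) (v : V) => exists_derivation_fractionRing
    (σ := Fin n × Option V) (k := k) fun q => if q.1 = s ∧ q.2 = some v then 1 else 0
  refine ⟨k, inferInstance, hchar, fun s o => algebraMap R k (X (s, o)), D, ?_, ?_, ?_⟩
  · intro g hg
    exact hdet id g Function.injective_id hg
  · intro s hs S _ hS c hc i hi
    have hd := hdet (N := s) (Fin.castLE hs)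
      (fun t => some ((S.equivFinOfCardEq hS).symm t : V)) (Fin.castLE_injective hs)
      (fun t u htu => by
        have := Subtype.ext (Option.some_injective _ htu)
        exact (S.equivFinOfCardEq hS).symm.injective this)
    have hv := Matrix.eq_zero_of_vecMul_eq_zero hd (v := fun i : Fin s => c i) (by
      ext t
      rw [Matrix.vecMul, Pi.zero_apply, dotProduct,
        ← hc _ ((S.equivFinOfCardEq hS).symm t).2, Finset.sum_range]
      refine Finset.sum_congr rfl fun j _ => ?_
      rw [lf, dif_pos (lt_of_lt_of_le j.2 hs)]
      rfl)
    exact congrFun hv ⟨i, hi⟩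
  · intro s v t o
    exact hD s v (t, o)

end GenericMatrix

section Iterated

open MvPolynomial

lemma Der.sum {A ι : Type*} [CommRing A] (D : Der A) (s : Finset ι) (f : ι → A) :
    D (∑ i ∈ s, f i) = ∑ i ∈ s, D (f i) := map_sum D f s

lemma Der.prod_eq_zero {A ι : Type*} [CommRing A] (D : Der A) (s : Finset ι) (f : ι → A)
    (h : ∀ i ∈ s, D (f i) = 0) : D (∏ i ∈ s, f i) = 0 := by
  classical
  induction s using Finset.induction_on with
  | empty => rw [Finset.prod_empty, D.map_one]
  | insert i s hi ih =>
    rw [Finset.prod_insert hi, D.leibniz, h i (Finset.mem_insert_self i s),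
      ih fun j hj => h j (Finset.mem_insert_of_mem hj), mul_zero, mul_zero, add_zero]

lemma Der.det_eq_zero {A : Type*} [CommRing A] (D : Der A) {n : ℕ} (M : Matrix (Fin n) (Fin n) A)
    (h : ∀ i j, D (M i j) = 0) : D M.det = 0 := by
  rw [Matrix.det_apply, D.sum]
  refine Finset.sum_eq_zero fun σ _ => ?_
  have hp : D (∏ i, M (σ i) i) = 0 := D.prod_eq_zero _ _ fun i _ => h _ _
  rcases Int.units_eq_one_or (Equiv.Perm.sign σ) with hs | hs
  · rw [hs, one_smul, hp]
  · rw [hs, Units.neg_smul, one_smul, map_neg, hp, neg_zero]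

lemma Der.det {A : Type*} [CommRing A] (D : Der A) {n : ℕ} (M : Matrix (Fin n) (Fin n) A)
    (r : Fin n) (h : ∀ i j, i ≠ r → D (M i j) = 0) :
    D M.det = ∑ j, D (M r j) * M.adjugate j r := by
  rw [Matrix.det_eq_sum_mul_adjugate_row M r, D.sum]
  refine Finset.sum_congr rfl fun j _ => ?_
  have : D (M.adjugate j r) = 0 := by
    rw [Matrix.adjugate_apply]
    refine D.det_eq_zero _ fun i l => ?_
    by_cases hi : i = r
    · subst hi
      rw [Matrix.updateRow_self, Pi.single_apply]
      rcases eq_or_ne l j with hl | hl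
      · rw [if_pos hl, D.map_one]
      · rw [if_neg hl, map_zero]
    · rw [Matrix.updateRow_ne hi]
      exact h i l hi
  rw [D.leibniz, this, mul_zero, zero_add, mul_comm]

variable {k : Type*} [Field k] [CharP k 2] {V : Type*} [Fintype V] [DecidableEq V] {n : ℕ}

/-- The columns of the inverse matrix. -/
noncomputable def bvec (a : Fin n → Option V → k) (F : Finset V) (s : Fin n) (v : V) : k :=
  spread n F (fun t => (cmat a (enum n F))⁻¹ t s) (some v)

variable {a : Fin n → Option V → k} {F : Finset V}

lemma bvec_of_notMem (h : F.card = n) (s : Fin n) {v : V} (hv : v ∉ F) : bvec a F s v = 0 :=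
  spread_of_notMem h _ hv

lemma Gen.sum_bvec (ha : Gen a) (h : F.card = n) (s t : Fin n) :
    ∑ v, a t (some v) * bvec a F s v = if t = s then 1 else 0 := by
  have h1 := sum_mul_spread h a (fun t => (cmat a (enum n F))⁻¹ t s) t
  have h2 : (cmat a (enum n F)).mulVec (fun t => (cmat a (enum n F))⁻¹ t s) t =
      (cmat a (enum n F) * (cmat a (enum n F))⁻¹) t s := rfl
  rw [Matrix.mul_nonsing_inv _ (ha.isUnit h), Matrix.one_apply] at h2
  rw [← h2, ← h1]
  rfl

lemma Gen.eq_zero_of_sum (ha : Gen a) (h : F.card = n) {x : V → k} (hx : ∀ v ∉ F, x v = 0)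
    (hs : ∀ t, ∑ v, a t (some v) * x v = 0) (v : V) : x v = 0 := by
  by_cases hv : v ∈ F
  · obtain ⟨t, ht⟩ := exists_enum h hv
    have h1 := Matrix.eq_zero_of_mulVec_eq_zero (ha _ (enum_injective h))
      (v := fun t => (enum n F t).elim 0 x) (by
        ext t
        have h3 := sum_enum (M := k) h (fun v => a t (some v) * x v)
          (fun v hv => by rw [hx v hv, mul_zero])
        rw [Pi.zero_apply, ← hs t, h3, Matrix.mulVec, dotProduct]
        refine Finset.sum_congr rfl fun u _ => ?_
        obtain ⟨w, _, hw⟩ := enum_mem h u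
        simp [cmat, hw])
    have h2 := congrFun h1 t
    rw [ht] at h2
    exact h2
  · exact hx v hv

variable {δ : Fin n → Der k} {I : Fin n → V}
  (hδ : ∀ r t o, δ r (a t o) = if t = r ∧ o = some (I r) then 1 else 0)

include hδ

lemma sum_mul_der (r t : Fin n) (x : V → k) :
    ∑ v, x v * δ r (a t (some v)) = if t = r then x (I r) else 0 := by
  simp only [hδ, Option.some_inj]
  split_ifs with htr
  · rw [Finset.sum_eq_single (I r)]
    · simp [htr]
    · intro v _ hv
      simp [hv]
    · intro hv
      exact absurd (Finset.mem_univ _) hv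
  · simp [htr]

lemma Gen.der_aux (ha : Gen a) (h : F.card = n) (r : Fin n) {x : V → k} (hx : ∀ v ∉ F, x v = 0)
    (hs : ∀ t, δ r (∑ v, a t (some v) * x v) = 0) (v : V) :
    δ r (x v) = x (I r) * bvec a F r v := by
  rw [← sub_eq_zero]
  refine ha.eq_zero_of_sum h (x := fun v => δ r (x v) - x (I r) * bvec a F r v) ?_ ?_ v
  · intro w hw
    simp only [hx w hw, bvec_of_notMem h r hw, map_zero, mul_zero, sub_zero]
  · intro t
    have h1 := hs t
    rw [Der.sum] at h1
    simp only [Der.leibniz, Finset.sum_add_distrib, sum_mul_der hδ] at h1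
    simp only [mul_sub, Finset.sum_sub_distrib, mul_left_comm _ (x (I r)), ← Finset.mul_sum,
      ha.sum_bvec h, mul_ite, mul_one, mul_zero]
    rw [CharTwo.sub_eq_add]
    exact h1

lemma Gen.der_pt (ha : Gen a) (h : F.card = n) (r : Fin n) (v : V) :
    δ r (pt a F (some v)) = pt a F (some (I r)) * bvec a F r v := by
  refine ha.der_aux hδ h r (x := fun v => pt a F (some v)) (fun v hv => pt_of_notMem a h hv) ?_ v
  intro t
  rw [ha.sum_pt h, hδ, if_neg]
  simp

lemma Gen.der_bvec (ha : Gen a) (h : F.card = n) (r s : Fin n) (v : V) :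
    δ r (bvec a F s v) = bvec a F s (I r) * bvec a F r v := by
  refine ha.der_aux hδ h r (x := bvec a F s) (fun v hv => bvec_of_notMem h s hv) ?_ v
  intro t
  rw [ha.sum_bvec h]
  split_ifs
  · exact (δ r).map_one
  · exact map_zero _

lemma Gen.der_det (ha : Gen a) (h : F.card = n) (r : Fin n) :
    δ r (cmat a (enum n F)).det = (cmat a (enum n F)).det * bvec a F r (I r) := by
  rw [Der.det _ _ r, bvec, spread, Finset.mul_sum]
  · refine Finset.sum_congr rfl fun j _ => ?_
    have he : δ r (cmat a (enum n F) r j) = if enum n F j = some (I r) then 1 else 0 := by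
      simp [cmat, hδ]
    rw [he]
    split_ifs
    · rw [Matrix.inv_def, Matrix.smul_apply, smul_eq_mul, ← mul_assoc,
        Ring.mul_inverse_cancel _ (ha.isUnit h), one_mul]
    · rw [zero_mul, mul_zero]
  · intro i j hi
    simp [cmat, hδ, hi]

omit hδ

/-- The directional derivatives along `bvec`. -/
noncomputable def Db (a : Fin n → Option V → k) (F : Finset V) (s : Fin n) :
    Derivation k (MvPolynomial V k) (MvPolynomial V k) :=
  mkDerivation k fun v => C (bvec a F s v)

lemma Db_X (s : Fin n) (v : V) : Db a F s (X v) = C (bvec a F s v) := mkDerivation_X _ _ _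

lemma Db_C (s : Fin n) (x : k) : Db a F s (C x) = 0 := derivation_C _ _

lemma Db_comm (s t : Fin n) (p : MvPolynomial V k) :
    Db a F s (Db a F t p) = Db a F t (Db a F s p) := by
  induction p using MvPolynomial.induction_on with
  | C x => simp only [Db_C, map_zero]
  | add p q hp hq => simp only [map_add, hp, hq]
  | mul_X p v hp =>
    simp only [Derivation.leibniz, map_add, Db_X, smul_eq_mul, Db_C, hp]
    ring

/-- Iterated directional derivatives. -/
noncomputable def opD (a : Fin n → Option V → k) (F : Finset V) (L : List (Fin n))
    (p : MvPolynomial V k) : MvPolynomial V k :=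
  L.foldr (fun s p => Db a F s p) p

lemma opD_cons (s : Fin n) (L : List (Fin n)) (p : MvPolynomial V k) :
    opD a F (s :: L) p = Db a F s (opD a F L p) := rfl

include hδ

lemma coeffDer_Db (ha : Gen a) (h : F.card = n) (r s : Fin n) (p : MvPolynomial V k) :
    coeffDer (δ r) (Db a F s p) =
      Db a F s (coeffDer (δ r) p) + C (bvec a F s (I r)) * Db a F r p := by
  induction p using MvPolynomial.induction_on with
  | C x => simp only [Db_C, coeffDer_C, map_zero, mul_zero, add_zero]
  | add p q hp hq =>
    simp only [map_add, hp, hq]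
    ring
  | mul_X p v hp =>
    simp only [Derivation.leibniz, Der.leibniz, map_add, Db_X, smul_eq_mul, coeffDer_C,
      coeffDer_X, hp, ha.der_bvec hδ h, map_mul, mul_zero, zero_add]
    ring

lemma Db_opD_mul (ha : Gen a) (h : F.card = n) (r : Fin n) (L : List (Fin n))
    {p : MvPolynomial V k} (hp : coeffDer (δ r) p = 0) :
    Db a F r (X (I r) * opD a F L p) + coeffDer (δ r) (opD a F L p) =
      Db a F r (opD a F L (X (I r) * p)) := by
  induction L with
  | nil =>
    change _ + coeffDer (δ r) p = _
    rw [hp, add_zero]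
    rfl
  | cons s L ih =>
    rw [opD_cons, opD_cons, Db_comm r s, ← ih, coeffDer_Db hδ ha h, map_add, Db_comm s r]
    simp only [Derivation.leibniz, map_add, Db_X, smul_eq_mul, Db_C]
    ring

lemma Gen.der_ev (ha : Gen a) (h : F.card = n) (r : Fin n) (p : MvPolynomial V k) :
    δ r (ev a F p) = ev a F (coeffDer (δ r) p + X (I r) * Db a F r p) := by
  have hX : ∀ v, ev a F (X v) = pt a F (some v) := fun v => aeval_X _ _
  have hC : ∀ x, ev a F (C x) = x := fun x => aeval_C _ _
  induction p using MvPolynomial.induction_on with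
  | C x => simp only [Db_C, coeffDer_C, mul_zero, add_zero, hC]
  | add p q hp hq =>
    simp only [map_add, hp, hq, mul_add]
    ring
  | mul_X p v hp =>
    simp only [map_mul, Derivation.leibniz, Der.leibniz, hp, hX, ha.der_pt hδ h, map_add, Db_X,
      smul_eq_mul, coeffDer_X, hC, mul_zero, zero_add]
    ring

lemma Gen.foldr_der (ha : Gen a) (h : F.card = n) (L : List (Fin n)) {p : MvPolynomial V k}
    (hp : ∀ r, coeffDer (δ r) p = 0) :
    L.foldr (fun r x => δ r x) ((cmat a (enum n F)).det * ev a F p) =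
      (cmat a (enum n F)).det * ev a F (opD a F L ((L.map fun r => X (I r)).prod * p)) := by
  induction L with
  | nil => simp [opD]
  | cons r L ih =>
    have hq : coeffDer (δ r) ((L.map fun r => (X (I r) : MvPolynomial V k)).prod * p) = 0 := by
      clear ih
      induction L with
      | nil => rw [List.map_nil, List.prod_nil, one_mul, hp]
      | cons s L ih =>
        rw [List.map_cons, List.prod_cons, mul_assoc, Der.leibniz, ih, coeffDer_X, mul_zero,
          mul_zero, add_zero]
    have h1 := Db_opD_mul hδ ha h r L hq
    rw [List.foldr_cons, ih, Der.leibniz, ha.der_det hδ h, ha.der_ev hδ h, List.map_cons,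
      List.prod_cons, opD_cons, mul_assoc (X (I r)), ← h1]
    have hX : ∀ v, ev a F (X v) = pt a F (some v) := fun v => aeval_X _ _
    have hC : ∀ x, ev a F (C x) = x := fun x => aeval_C _ _
    simp only [map_add, Derivation.leibniz, Db_X, smul_eq_mul, map_mul, hX, hC]
    ring

end Iterated

section Anisotropy

open MvPolynomial

lemma exists_le_degree_eq {V : Type*} [DecidableEq V] (L : V →₀ ℕ) (j : ℕ) (hj : j ≤ L.degree) :
    ∃ J ≤ L, J.degree = j := by
  induction j with
  | zero => exact ⟨0, zero_le, map_zero _⟩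
  | succ j ih =>
    obtain ⟨J, hJ, hJd⟩ := ih (by omega)
    obtain ⟨v, hv⟩ : ∃ v, J v < L v := by
      by_contra! hc
      have : J = L := le_antisymm hJ hc
      rw [this] at hJd
      omega
    refine ⟨J + Finsupp.single v 1, fun w => ?_, ?_⟩
    · rw [Finsupp.add_apply, Finsupp.single_apply]
      split_ifs with h
      · subst h
        exact hv
      · exact hJ w
    · rw [map_add, hJd, Finsupp.degree_single]

lemma exists_sum_single {V : Type*} [DecidableEq V] (n : ℕ) (M : V →₀ ℕ) (hM : M.degree = n) :
    ∃ I : Fin n → V, ∑ r, Finsupp.single (I r) 1 = M := by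
  induction n generalizing M with
  | zero =>
    refine ⟨Fin.elim0, ?_⟩
    rw [Finset.univ_eq_empty, Finset.sum_empty]
    exact ((Finsupp.degree_eq_zero_iff M).1 hM).symm
  | succ n ih =>
    obtain ⟨J, hJ, hJd⟩ := exists_le_degree_eq M n (by omega)
    obtain ⟨I, hI⟩ := ih J hJd
    obtain ⟨v, hv⟩ : ∃ v, M - J = Finsupp.single v 1 := by
      have : (M - J).degree = 1 := by
        have := congrArg Finsupp.degree (tsub_add_cancel_of_le hJ)
        rw [map_add] at this
        omega
      obtain ⟨v, hv⟩ : ∃ v, (M - J) v ≠ 0 := by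
        by_contra! hc
        rw [show M - J = 0 from Finsupp.ext hc, map_zero] at this
        exact zero_ne_one this
      have hle : Finsupp.single v 1 ≤ M - J := by
        rw [Finsupp.single_le_iff]
        omega
      have h0 := congrArg Finsupp.degree (tsub_add_cancel_of_le hle)
      rw [map_add, this, Finsupp.degree_single, Nat.add_eq_right,
        Finsupp.degree_eq_zero_iff] at h0
      refine ⟨v, ?_⟩
      rw [← tsub_add_cancel_of_le hle, h0, zero_add]
    refine ⟨Fin.cons v I, ?_⟩
    rw [Fin.sum_univ_succ]
    simp only [Fin.cons_zero, Fin.cons_succ]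
    rw [hI, ← hv, tsub_add_cancel_of_le hJ]

variable {k : Type*} [Field k] [CharP k 2] {V : Type*} [Fintype V] [DecidableEq V]

lemma foldl_sum_mul_C {S ι : Type*} (D : S → Derivation k (MvPolynomial V k) (MvPolynomial V k))
    (L : List S) (s : Finset ι) (p : ι → MvPolynomial V k) (c : ι → k) :
    L.foldl (fun q r => D r q) (∑ i ∈ s, p i * C (c i)) =
      ∑ i ∈ s, L.foldl (fun q r => D r q) (p i) * C (c i) := by
  induction L generalizing p with
  | nil => rfl
  | cons r L ih =>
    rw [List.foldl_cons, map_sum]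
    have : ∀ i, D r (p i * C (c i)) = D r (p i) * C (c i) := fun i => by
      rw [Derivation.leibniz, derivation_C, smul_zero, zero_add, smul_eq_mul, mul_comm]
    simp only [this]
    exact ih _

lemma derivation_prod {N : ℕ} (D : Derivation k (MvPolynomial V k) (MvPolynomial V k))
    (x : Fin (N + 1) → MvPolynomial V k) :
    D (∏ j, x j) = ∑ j, (∏ i, x (j.succAbove i)) * D (x j) := by
  induction N with
  | zero => simp
  | succ N ih =>
    rw [Fin.prod_univ_succ, Derivation.leibniz, ih,
      Fin.sum_univ_succ (fun j => (∏ i, x (j.succAbove i)) * D (x j)), smul_eq_mul, smul_eq_mul,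
      Finset.mul_sum, add_comm]
    congr 1
    · refine Finset.sum_congr rfl fun j _ => ?_
      rw [Fin.prod_univ_succ (fun i => x (j.succ.succAbove i))]
      simp only [Fin.succ_succAbove_zero, Fin.succ_succAbove_succ]
      ring

lemma foldl_prod {N : ℕ} (D : Fin N → Derivation k (MvPolynomial V k) (MvPolynomial V k))
    (x : Fin N → MvPolynomial V k) (β : Matrix (Fin N) (Fin N) k)
    (h : ∀ s t, D s (x t) = C (β s t)) :
    (List.finRange N).foldl (fun q r => D r q) (∏ j, x j) = C β.det := by
  induction N with
  | zero => simp
  | succ N ih =>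
    rw [List.finRange_succ, List.foldl_cons, List.foldl_map, derivation_prod, Matrix.det_succ_row_zero]
    simp only [h]
    rw [foldl_sum_mul_C (fun r => D (Fin.succ r)), map_sum]
    refine Finset.sum_congr rfl fun j _ => ?_
    rw [ih (fun r => D r.succ) (fun i => x (j.succAbove i)) (β.submatrix Fin.succ j.succAbove)
      fun s t => h _ _, CharTwo.neg_eq, one_pow, one_mul, map_mul, mul_comm]

variable {n : ℕ} {a : Fin n → Option V → k} {F : Finset V}

lemma prod_X_enum (h : F.card = n) :
    (monomial (ind F) 1 : MvPolynomial V k) = ∏ t, (enum n F t).elim 0 X := by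
  rw [monomial_one_eq]
  have : ∀ v, (X v ^ ind F v : MvPolynomial V k) = if v ∈ F then X v else 1 := fun v => by
    rw [ind_apply]
    split_ifs
    · rw [pow_one]
    · rw [pow_zero]
  simp only [this]
  rw [Finset.prod_ite_mem, Finset.univ_inter, ← Finset.prod_coe_sort,
    ← (F.equivFinOfCardEq h).symm.prod_comp]
  refine Finset.prod_congr rfl fun t _ => ?_
  rw [enum, dif_pos h]
  rfl

lemma opD_ind (h : F.card = n) :
    opD a F (List.finRange n).reverse (monomial (ind F) 1) =
      C (cmat a (enum n F)).det⁻¹ := by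
  rw [opD, List.foldr_reverse, prod_X_enum h,
    foldl_prod _ _ (cmat a (enum n F))⁻¹.transpose, Matrix.det_transpose,
    Matrix.det_nonsing_inv, Ring.inverse_eq_inv']
  intro s t
  obtain ⟨v, -, hv⟩ := enum_mem h t
  rw [hv, Option.elim_some, Db_X, bvec, ← hv, spread_enum h]
  rfl

lemma opD_sq_mul (L : List (Fin n)) (p q : MvPolynomial V k) :
    opD a F L (p ^ 2 * q) = p ^ 2 * opD a F L q := by
  induction L with
  | nil => rfl
  | cons s L ih =>
    have h2 : (2 : MvPolynomial V k) = 0 := CharTwo.two_eq_zero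
    rw [opD_cons, ih, Derivation.leibniz, sq, Derivation.leibniz, opD_cons, smul_eq_mul,
      smul_eq_mul, smul_eq_mul]
    linear_combination opD a F L q * p * Db a F s p * h2

/-- Iterated derivations of the field. -/
def iterDer (δ : Fin n → Der k) (x : k) : k := (List.finRange n).reverse.foldr (fun r x => δ r x) x

lemma iterDer_mul_sq (δ : Fin n → Der k) (x y : k) :
    iterDer δ (x * y ^ 2) = iterDer δ x * y ^ 2 := by
  unfold iterDer
  generalize (List.finRange n).reverse = L
  induction L with
  | nil => rfl
  | cons r L ih =>
    have h2 : (2 : k) = 0 := CharTwo.two_eq_zero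
    rw [List.foldr_cons, ih, Der.leibniz, sq, Der.leibniz, List.foldr_cons]
    linear_combination L.foldr (fun r x => δ r x) x * y * δ r y * h2

lemma iterDer_sum (δ : Fin n → Der k) {ι : Type*} (s : Finset ι) (f : ι → k) :
    iterDer δ (∑ i ∈ s, f i) = ∑ i ∈ s, iterDer δ (f i) := by
  unfold iterDer
  generalize (List.finRange n).reverse = L
  induction L with
  | nil => rfl
  | cons r L ih => simp only [List.foldr_cons, ih, Der.sum]

lemma iterDer_zero (δ : Fin n → Der k) : iterDer δ 0 = 0 := by
  have := iterDer_sum δ (∅ : Finset (Fin n)) fun _ => 0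
  simpa using this

variable {δ : Fin n → Der k} {I : Fin n → V}
  (hδ : ∀ r t o, δ r (a t o) = if t = r ∧ o = some (I r) then 1 else 0)

include hδ

lemma Gen.iterDer_wt (ha : Gen a) (h : F.card = n) (J H : V →₀ ℕ)
    (hJ : ∑ r, Finsupp.single (I r) 1 + J = H + H) :
    iterDer δ (wt a F * ev a F (monomial J 1)) = (wt a F * ev a F (monomial H 1)) ^ 2 := by
  have hD : (cmat a (enum n F)).det ≠ 0 := ha _ (enum_injective h)
  have hP : ∏ v ∈ F, pt a F (some v) ≠ 0 :=
    Finset.prod_ne_zero_iff.2 fun v hv => ha.pt_ne_zero h hv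
  have hind : ev a F (monomial (ind F) 1) = ∏ v ∈ F, pt a F (some v) := by
    rw [ev_monomial]
    have : ∀ v, pt a F (some v) ^ ind F v = if v ∈ F then pt a F (some v) else 1 := fun v => by
      rw [ind_apply]
      split_ifs
      · rw [pow_one]
      · rw [pow_zero]
    simp only [this]
    rw [Finset.prod_ite_mem, Finset.univ_inter]
  have h1 : wt a F * ev a F (monomial J 1) =
      (cmat a (enum n F)).det * ev a F (monomial (J + ind F) 1) * wt a F ^ 2 := by
    have : (monomial (J + ind F) 1 : MvPolynomial V k) = monomial J 1 * monomial (ind F) 1 := by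
      rw [monomial_mul, one_mul]
    rw [this, map_mul, hind, wt]
    generalize ∏ v ∈ F, pt a F (some v) = P at *
    field_simp
  have hcoeff : ∀ r, coeffDer (δ r) (monomial (J + ind F) 1 : MvPolynomial V k) = 0 := by
    intro r
    rw [monomial_one_eq]
    refine Der.prod_eq_zero _ _ _ fun v _ => ?_
    generalize (J + ind F) v = e
    induction e with
    | zero => rw [pow_zero, Der.map_one]
    | succ e ih => rw [pow_succ, Der.leibniz, ih, coeffDer_X, mul_zero, mul_zero, add_zero]
  have hprod : (((List.finRange n).reverse.map fun r => (X (I r) : MvPolynomial V k)).prod *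
      monomial (J + ind F) 1) = monomial H 1 ^ 2 * monomial (ind F) 1 := by
    rw [List.map_reverse, List.prod_reverse, ← Fin.prod_univ_def]
    have : ∏ r, (X (I r) : MvPolynomial V k) = monomial (∑ r, Finsupp.single (I r) 1) 1 := by
      rw [monomial_sum_one]
      rfl
    rw [this, monomial_mul, ← add_assoc, hJ, sq, monomial_mul, monomial_mul, one_mul, one_mul]
  have h2 := ha.foldr_der hδ h (List.finRange n).reverse hcoeff
  rw [h1, iterDer_mul_sq]
  unfold iterDer
  rw [h2, hprod, opD_sq_mul, opD_ind h, map_mul, map_pow]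
  have hC : ∀ x, ev a F (C x) = x := fun x => aeval_C _ _
  rw [hC]
  field_simp

lemma Gen.iterDer_dg (ha : Gen a) (K : Set (Finset V)) (J H : V →₀ ℕ)
    (hJ : ∑ r, Finsupp.single (I r) 1 + J = H + H) :
    iterDer δ (dg K a (monomial J 1)) = dg K a (monomial H 1) ^ 2 := by
  rw [dg_apply, dg_apply, iterDer_sum, CharTwo.sum_sq]
  exact Finset.sum_congr rfl fun F hF => ha.iterDer_wt hδ (mem_fct.1 hF).2 J H hJ

omit hδ

/-- Anisotropy of the degree map over a generic field of characteristic two. -/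
theorem Gen.dg_eq_zero_of_sq (ha : Gen a) (K : Set (Finset V)) {δ : Fin n → V → Der k}
    (hδ : ∀ s v t o, δ s v (a t o) = if t = s ∧ o = some v then 1 else 0)
    (g : MvPolynomial V k) (L : V →₀ ℕ) (j : ℕ) (hj : j ≤ L.degree) (hn : 2 * L.degree = n + j)
    (hg : ∀ J : V →₀ ℕ, J.degree = j → dg K a (g * (g * monomial J 1)) = 0) :
    dg K a (g * monomial L 1) = 0 := by
  obtain ⟨J, hJ, hJd⟩ := exists_le_degree_eq L j hj
  obtain ⟨I, hI⟩ := exists_sum_single n (L + (L - J)) (by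
    have := congrArg Finsupp.degree (tsub_add_cancel_of_le hJ)
    rw [map_add] at this ⊢
    omega)
  have hI' : ∀ m : V →₀ ℕ, ∑ r, Finsupp.single (I r) 1 + (m + m + J) = (m + L) + (m + L) := by
    intro m
    rw [hI]
    have := tsub_add_cancel_of_le hJ
    generalize L - J = R at this
    rw [← this]
    abel
  have hsq : g * (g * monomial J 1) =
      ∑ m ∈ g.support, monomial (m + m + J) (coeff m g ^ 2) := by
    rw [← mul_assoc, ← sq]
    conv_lhs => rw [g.as_sum]
    rw [CharTwo.sum_sq, Finset.sum_mul]
    refine Finset.sum_congr rfl fun m _ => ?_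
    rw [sq, monomial_mul, monomial_mul, mul_one, sq]
  have hlin : g * monomial L 1 = ∑ m ∈ g.support, monomial (m + L) (coeff m g) := by
    conv_lhs => rw [g.as_sum]
    rw [Finset.sum_mul]
    refine Finset.sum_congr rfl fun m _ => ?_
    rw [monomial_mul, mul_one]
  have hsmul : ∀ (m : V →₀ ℕ) (c : k), dg K a (monomial m c) = dg K a (monomial m 1) * c := by
    intro m c
    rw [← mul_one c, ← smul_eq_mul, ← smul_monomial, map_smul, smul_eq_mul, smul_eq_mul, mul_one,
      mul_comm]
  have h0 := congrArg (iterDer fun r => δ r (I r)) (hg J hJd)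
  rw [iterDer_zero, hsq, map_sum, iterDer_sum] at h0
  rw [hlin, map_sum, ← sq_eq_zero_iff, CharTwo.sum_sq, ← h0]
  refine Finset.sum_congr rfl fun m _ => ?_
  rw [hsmul, hsmul _ (_ ^ 2), iterDer_mul_sq,
    ha.iterDer_dg (I := I) (fun r t o => hδ r (I r) t o) K _ _ (hI' m), mul_pow]

end Anisotropy

section Counting

open MvPolynomial Module

variable {k : Type*} [Field k] [CharP k 2] {V : Type*} [Fintype V] [DecidableEq V] {n : ℕ}

instance (j : ℕ) : FiniteDimensional k (homogeneousSubmodule V k j) :=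
  Module.Finite.iff_fg.2 (homogeneousSubmodule_fg V k j)

lemma finrank_finset_sup_le {ι W : Type*} [AddCommGroup W] [Module k W] [FiniteDimensional k W]
    (s : Finset ι) (E : ι → Submodule k W) :
    finrank k (s.sup E : Submodule k W) ≤ ∑ i ∈ s, finrank k (E i) := by
  classical
  induction s using Finset.induction_on with
  | empty => simp
  | insert i s hi ih =>
    rw [Finset.sup_insert, Finset.sum_insert hi]
    exact (Submodule.finrank_add_le_finrank_add_finrank _ _).trans (Nat.add_le_add_left ih _)

/-- The quotient map as a linear map. -/
noncomputable def quo (K : Set (Finset V)) (a : Fin n → Option V → k) :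
    MvPolynomial V k →ₗ[k] MvPolynomial V k ⧸ AI K (lf a) n :=
  (Ideal.Quotient.mkₐ k (AI K (lf a) n)).toLinearMap

lemma quo_eq_zero {K : Set (Finset V)} {a : Fin n → Option V → k} {p : MvPolynomial V k} :
    quo K a p = 0 ↔ p ∈ AI K (lf a) n := Ideal.Quotient.eq_zero_iff_mem

lemma quo_mul (K : Set (Finset V)) (a : Fin n → Option V → k) (p q : MvPolynomial V k) :
    quo K a (p * q) = quo K a p * quo K a q := map_mul (Ideal.Quotient.mkₐ k (AI K (lf a) n)) p q

/-- The Hilbert function of the Artinian reduction. -/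
noncomputable def hilb (K : Set (Finset V)) (a : Fin n → Option V → k) (j : ℕ) : ℕ :=
  finrank k ((homogeneousSubmodule V k j).map (quo K a))

lemma exists_lift (K : Set (Finset V)) (a : Fin n → Option V → k) (j : ℕ) :
    ∃ E : Submodule k (MvPolynomial V k), E ≤ homogeneousSubmodule V k j ∧
      FiniteDimensional k E ∧ finrank k E ≤ hilb K a j ∧
      ∀ p ∈ homogeneousSubmodule V k j, ∃ e ∈ E, p - e ∈ AI K (lf a) n := by
  let f : homogeneousSubmodule V k j →ₗ[k] (homogeneousSubmodule V k j).map (quo K a) :=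
    (quo K a).restrict fun x hx => Submodule.mem_map_of_mem hx
  have hf : LinearMap.range f = ⊤ := by
    rw [LinearMap.range_eq_top]
    rintro ⟨_, x, hx, rfl⟩
    exact ⟨⟨x, hx⟩, rfl⟩
  obtain ⟨g, hg⟩ := f.exists_rightInverse_of_surjective hf
  refine ⟨LinearMap.range ((homogeneousSubmodule V k j).subtype ∘ₗ g), ?_, inferInstance,
    LinearMap.finrank_range_le _, ?_⟩
  · rintro _ ⟨x, rfl⟩
    exact (g x).2
  · intro p hp
    refine ⟨_, ⟨f ⟨p, hp⟩, rfl⟩, ?_⟩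
    rw [← quo_eq_zero (a := a), map_sub, sub_eq_zero]
    have := LinearMap.congr_fun hg (f ⟨p, hp⟩)
    exact (congrArg Subtype.val this).symm

lemma ev_eq_zero_of_mem_faceIdeal {K : Set (Finset V)} (hK : IsLowerSet K)
    (a : Fin n → Option V → k) {F : Finset V} (hF : IsFacet K n F) {p : MvPolynomial V k}
    (hp : p ∈ faceIdeal k K) : ev a F p = 0 := by
  rw [eq_sum_C_mul_monomial p, map_sum]
  refine Finset.sum_eq_zero fun m _ => ?_
  rw [map_mul]
  by_cases hm : m.support ⊆ F
  · rw [(mem_faceIdeal hK).1 hp m (hK hm hF.1), map_zero, map_zero, zero_mul]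
  · rw [ev_monomial_eq_zero a hF.2 hm, mul_zero]

theorem Gen.card_fct_le {K : Set (Finset V)} (hK : IsLowerSet K) {a : Fin n → Option V → k}
    (ha : Gen a) (N : ℕ)
    (hN : ∀ j, N ≤ j → ∀ p : MvPolynomial V k, p.IsHomogeneous j → p ∈ AI K (lf a) n) :
    (fct K n).card ≤ ∑ j ∈ Finset.range N, hilb K a j := by
  choose E hE hfd hEr hlift using exists_lift K a
  let φ : MvPolynomial V k →ₗ[k] (fct K n → k) := LinearMap.pi fun F => (ev a F.1).toLinearMap
  let T : Submodule k (fct K n → k) := (Finset.range N).sup fun j => (E j).map φ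
  have hφ : ∀ p F, φ p F = ev a F.1 p := fun p F => rfl
  have key : ∀ j p, p ∈ homogeneousSubmodule V k j → φ p ∈ T := by
    intro j
    induction j using Nat.strong_induction_on with
    | _ j ih =>
      have hAI : ∀ s ≤ n, ∀ q, q ∈ homogeneousSubmodule V k j → q ∈ AI K (lf a) s → φ q ∈ T := by
        intro s
        induction s with
        | zero =>
          intro _ q _ hq
          rw [AI_zero] at hq
          have : φ q = 0 := by
            ext F
            rw [hφ, ev_eq_zero_of_mem_faceIdeal hK a (mem_fct.1 F.2) hq, Pi.zero_apply]
          rw [this]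
          exact T.zero_mem
        | succ s ihs =>
          intro hs q hq hqA
          rcases Nat.eq_zero_or_pos j with rfl | hj
          · exact ihs (by omega) q hq (mem_AI_of_mem_AI_succ hqA hq)
          · obtain ⟨j, rfl⟩ : ∃ i, j = i + 1 := ⟨j - 1, by omega⟩
            obtain ⟨e, he, heA⟩ := exists_of_mem_AI_succ hqA hq
            have h1 : φ q = φ (q - lin (lf a s) * e) + a ⟨s, hs⟩ none • φ e := by
              ext F
              rw [Pi.add_apply, Pi.smul_apply, hφ, hφ, hφ, map_sub, map_mul, smul_eq_mul]
              have := ha.ev_lin (mem_fct.1 F.2).2 ⟨s, hs⟩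
              rw [← this]
              ring
            rw [h1]
            refine T.add_mem (ihs (by omega) _ ?_ heA) (T.smul_mem _ (ih j (by omega) e he))
            refine Submodule.sub_mem _ hq ?_
            rw [mem_homogeneousSubmodule, add_comm]
            exact (isHomogeneous_lin _).mul he
      intro p hp
      by_cases hj : j < N
      · obtain ⟨e, he, hpe⟩ := hlift j p hp
        have h1 : φ p = φ (p - e) + φ e := by rw [← map_add, sub_add_cancel]
        rw [h1]
        refine T.add_mem (hAI n le_rfl _ (Submodule.sub_mem _ hp (hE j he)) hpe) ?_
        exact (Finset.le_sup (f := fun j => (E j).map φ) (Finset.mem_range.2 hj) :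
          (E j).map φ ≤ T) (Submodule.mem_map_of_mem he)
      · exact hAI n le_rfl p hp (hN j (by omega) p hp)
  have htop : T = ⊤ := by
    rw [eq_top_iff, ← (Pi.basisFun k (fct K n)).span_eq, Submodule.span_le]
    rintro _ ⟨F, rfl⟩
    rw [SetLike.mem_coe, Pi.basisFun_apply]
    have hF := mem_fct.1 F.2
    have h1 := key n (monomial (ind F.1) 1) (isHomogeneous_monomial _ (by
      rw [degree_ind, hF.2]))
    have h2 : ev a F.1 (monomial (ind F.1) 1) ≠ 0 := by
      rw [ev_monomial, Finset.prod_ne_zero_iff]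
      intro v _
      rw [ind_apply]
      split_ifs with hv
      · rw [pow_one]
        exact ha.pt_ne_zero hF.2 hv
      · rw [pow_zero]
        exact one_ne_zero
    have h3 : Pi.single F 1 = (ev a F.1 (monomial (ind F.1) 1))⁻¹ • φ (monomial (ind F.1) 1) := by
      ext G
      rw [Pi.smul_apply, hφ, smul_eq_mul]
      rcases eq_or_ne G F with rfl | hG
      · rw [Pi.single_eq_same, inv_mul_cancel₀ h2]
      · have hG' := mem_fct.1 G.2
        rw [Pi.single_eq_of_ne hG, ev_monomial_eq_zero a hG'.2, mul_zero]
        rw [support_ind]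
        intro hs
        exact hG (Subtype.ext (Finset.eq_of_subset_of_card_le hs (by rw [hF.2, hG'.2])).symm)
    rw [h3]
    exact T.smul_mem _ h1
  have hfr : finrank k T = (fct K n).card := by
    rw [htop, finrank_top, Module.finrank_pi, Fintype.card_coe]
  rw [← hfr]
  refine (finrank_finset_sup_le _ _).trans (Finset.sum_le_sum fun j _ => ?_)
  exact (Submodule.finrank_map_le _ _).trans (hEr j)

/-- The variables of a facet can be eliminated. -/
theorem Gen.hilb_le_multichoose {K : Set (Finset V)} {a : Fin n → Option V → k} (ha : Gen a)
    (hV : n ≤ Fintype.card (Option V)) {G : Finset V} (hG : G.card = n) (j : ℕ) :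
    hilb K a j ≤ (Fintype.card V - n).multichoose j := by
  let U := {v : V // v ∉ G}
  let f : ∀ j, Sym U j → MvPolynomial V k ⧸ AI K (lf a) n := fun j s =>
    quo K a ((s : Multiset U).map fun u => X u.1).prod
  have hX : ∀ v, quo K a (X v) ∈ Submodule.span k (Set.range fun u : U => quo K a (X u.1)) := by
    intro v
    by_cases hv : v ∈ G
    · obtain ⟨x, hx1, hx0⟩ := ha.exists_functional hV (S := G.map Function.Embedding.some)
        (by rw [Finset.card_map, hG]) (Finset.mem_map_of_mem _ hv)
      have hx1' : ∑ s, x s * a s (some v) = 1 := hx1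
      have hx0' : ∀ w ∈ G, w ≠ v → ∑ s, x s * a s (some w) = 0 := fun w hw hwv =>
        hx0 (some w) (Finset.mem_map_of_mem _ hw) (fun e => hwv (Option.some_inj.1 e))
      have h1 := lin_comb_mem a x K
      have h2 : lin (fun v => ∑ s, x s * a s (some v)) =
          X v + ∑ u : U, (∑ s, x s * a s (some u.1)) • X u.1 := by
        rw [lin, ← Finset.sum_add_sum_compl G, Finset.sum_eq_single_of_mem v hv]
        · rw [hx1', C_1, one_mul]
          congr 1
          rw [← Finset.sum_subtype Gᶜ (fun v => Finset.mem_compl)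
            (fun u => (∑ s, x s * a s (some u)) • (X u : MvPolynomial V k))]
          exact Finset.sum_congr rfl fun u _ => by rw [smul_eq_C_mul]
        · intro w hw hwv
          rw [hx0' w hw hwv, C_0, zero_mul]
      rw [← quo_eq_zero, h2, map_add, map_sum, add_eq_zero_iff_eq_neg] at h1
      rw [h1]
      refine Submodule.neg_mem _ (Submodule.sum_mem _ fun u _ => ?_)
      rw [map_smul]
      exact Submodule.smul_mem _ _ (Submodule.subset_span ⟨u, rfl⟩)
    · exact Submodule.subset_span ⟨⟨v, hv⟩, rfl⟩
  have hmul : ∀ j x y, x ∈ Submodule.span k (Set.range fun u : U => quo K a (X u.1)) →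
      y ∈ Submodule.span k (Set.range (f j)) → x * y ∈ Submodule.span k (Set.range (f (j + 1))) := by
    intro j x y hx hy
    induction hx using Submodule.span_induction with
    | mem x hx =>
      obtain ⟨u, rfl⟩ := hx
      induction hy using Submodule.span_induction with
      | mem y hy =>
        obtain ⟨s, rfl⟩ := hy
        refine Submodule.subset_span ⟨u ::ₛ s, ?_⟩
        simp only [f]
        rw [Sym.coe_cons, Multiset.map_cons, Multiset.prod_cons, quo_mul]
      | zero => rw [mul_zero]; exact Submodule.zero_mem _
      | add y z _ _ hy hz => rw [mul_add]; exact Submodule.add_mem _ hy hz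
      | smul c y _ hy => rw [mul_smul_comm]; exact Submodule.smul_mem _ _ hy
    | zero => rw [zero_mul]; exact Submodule.zero_mem _
    | add x z _ _ hx hz => rw [add_mul]; exact Submodule.add_mem _ hx hz
    | smul c x _ hx => rw [smul_mul_assoc]; exact Submodule.smul_mem _ _ hx
  have hmon : ∀ j (m : V →₀ ℕ), m.degree = j →
      quo K a (monomial m 1) ∈ Submodule.span k (Set.range (f j)) := by
    intro j
    induction j with
    | zero =>
      intro m hm
      refine Submodule.subset_span ⟨Sym.nil, ?_⟩
      rw [(Finsupp.degree_eq_zero_iff m).1 hm]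
      simp only [f]
      rw [Sym.coe_nil, Multiset.map_zero, Multiset.prod_zero]
      rfl
    | succ j ih =>
      intro m hm
      obtain ⟨v, hv⟩ : ∃ v, m v ≠ 0 := by
        by_contra! hc
        rw [show m = 0 from Finsupp.ext hc, map_zero] at hm
        omega
      have hle : Finsupp.single v 1 ≤ m := by
        rw [Finsupp.single_le_iff]
        omega
      have hsub := tsub_add_cancel_of_le hle
      have hd : (m - Finsupp.single v 1).degree = j := by
        have := congrArg Finsupp.degree hsub
        rw [map_add, Finsupp.degree_single] at this
        omega
      have : (monomial m 1 : MvPolynomial V k) = X v * monomial (m - Finsupp.single v 1) 1 := by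
        rw [X, monomial_mul, one_mul, add_comm (Finsupp.single v 1), hsub]
      rw [this, quo_mul]
      exact hmul j _ _ (hX v) (ih _ hd)
  have hle : (homogeneousSubmodule V k j).map (quo K a) ≤ Submodule.span k (Set.range (f j)) := by
    rw [Submodule.map_le_iff_le_comap]
    intro p hp
    rw [Submodule.mem_comap, p.as_sum, map_sum]
    refine Submodule.sum_mem _ fun m hm => ?_
    rw [← mul_one (coeff m p), ← smul_eq_mul, ← smul_monomial, map_smul]
    exact Submodule.smul_mem _ _ (hmon j m (degree_eq_of_mem_support hp hm))
  have hfin : FiniteDimensional k (Submodule.span k (Set.range (f j))) :=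
    FiniteDimensional.span_of_finite k (Set.finite_range _)
  refine (Submodule.finrank_mono hle).trans ((finrank_range_le_card _).trans ?_)
  rw [Sym.card_sym_eq_multichoose]
  simp only [U]
  rw [Fintype.card_subtype_compl, Fintype.card_coe, hG]

end Counting

section Bound

open MvPolynomial Module

lemma sum_multichoose (N q : ℕ) :
    ∑ j ∈ Finset.range (q + 1), N.multichoose j = (N + 1).multichoose q := by
  induction q with
  | zero => simp
  | succ q ih => rw [Finset.sum_range_succ, ih, Nat.multichoose_succ_succ, add_comm]

lemma sum_multichoose_min (N d : ℕ) :
    ∑ j ∈ Finset.range (d + 1), N.multichoose (min j (d + 1 - j)) + 1 =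
      (N + (d + 1) / 2).choose ((d + 1) / 2) + (N + d / 2).choose (d / 2) := by
  have h1 : ∀ q, (N + q).choose q = (N + 1).multichoose q := fun q => by
    rw [Nat.multichoose_eq, add_right_comm, Nat.add_sub_cancel]
  rw [h1, h1, ← sum_multichoose, ← sum_multichoose, Finset.sum_range_succ' _ (d / 2),
    Nat.multichoose_zero_right, ← add_assoc]
  congr 1
  rw [← Finset.sum_range_reflect (fun j => N.multichoose (j + 1)),
    show d + 1 = (d + 1) / 2 + 1 + d / 2 by omega, Finset.sum_range_add,
    ← show d + 1 = (d + 1) / 2 + 1 + d / 2 by omega]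
  refine congrArg₂ _ (Finset.sum_congr rfl fun j hj => ?_) (Finset.sum_congr rfl fun j hj => ?_)
  all_goals
    rw [Finset.mem_range] at hj
    congr 1
    omega

variable {k : Type*} [Field k]

/-- Comparison of ranks along a bilinear form. -/
lemma finrank_range_le_of_pairing {X Y Z Z' : Type*} [AddCommGroup X] [Module k X]
    [AddCommGroup Y] [Module k Y] [AddCommGroup Z] [Module k Z] [AddCommGroup Z'] [Module k Z']
    [FiniteDimensional k X] [FiniteDimensional k Y]
    (B : X →ₗ[k] Y →ₗ[k] k) (f : Y →ₗ[k] Z) (g : X →ₗ[k] Z')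
    (hf : ∀ y, (∀ x, B x y = 0) → f y = 0) (hg : ∀ x, g x = 0 → B x = 0) :
    finrank k (LinearMap.range f) ≤ finrank k (LinearMap.range g) := by
  have h1 := f.finrank_range_add_finrank_ker
  have h2 := g.finrank_range_add_finrank_ker
  have h3 := B.finrank_range_add_finrank_ker
  have h4 := Subspace.finrank_add_finrank_dualCoannihilator_eq (LinearMap.range B)
  have h5 : finrank k (LinearMap.range B).dualCoannihilator ≤ finrank k (LinearMap.ker f) := by
    refine Submodule.finrank_mono fun y hy => hf y fun x => ?_
    exact (Submodule.mem_dualCoannihilator y).1 hy (B x) ⟨x, rfl⟩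
  have h6 : finrank k (LinearMap.ker g) ≤ finrank k (LinearMap.ker B) :=
    Submodule.finrank_mono fun x hx => hg x hx
  have h7 : finrank k (LinearMap.range B) + finrank k (LinearMap.range B).dualCoannihilator =
    finrank k Y := h4
  omega

variable [CharP k 2] {V : Type*} [Fintype V] [DecidableEq V] {d : ℕ}

/-- The span of the interior monomials of a given degree. -/
noncomputable def interiorSpan (k : Type*) [Field k] (K : Set (Finset V)) (n i : ℕ) :
    Submodule k (MvPolynomial V k) :=
  Submodule.span k ((fun m => monomial m 1) '' {m | m.degree = i ∧ ¬ IsBdry K n m.support})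

lemma interiorSpan_le (K : Set (Finset V)) (n i : ℕ) :
    interiorSpan k K n i ≤ homogeneousSubmodule V k i := by
  rw [interiorSpan, Submodule.span_le]
  rintro _ ⟨m, ⟨hm, _⟩, rfl⟩
  exact isHomogeneous_monomial _ hm

instance (K : Set (Finset V)) (n i : ℕ) : FiniteDimensional k (interiorSpan k K n i) :=
  Submodule.finiteDimensional_of_le (interiorSpan_le K n i)

lemma finrank_interiorSpan_one_le (K : Set (Finset V)) (n : ℕ) :
    finrank k (interiorSpan k K n 1) ≤ Nat.card {v : V // ¬ IsBdry K n {v}} := by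
  classical
  have h : (fun m => (monomial m 1 : MvPolynomial V k)) ''
      {m | m.degree = 1 ∧ ¬ IsBdry K n m.support} ⊆
      Set.range fun v : {v : V // ¬ IsBdry K n {v}} => (X v.1 : MvPolynomial V k) := by
    rintro _ ⟨m, ⟨hm, hb⟩, rfl⟩
    obtain ⟨I, rfl⟩ := exists_sum_single 1 m hm
    obtain ⟨v, hv⟩ : ∃ v, v = I 0 := ⟨_, rfl⟩
    rw [Fin.sum_univ_one, ← hv] at hb ⊢
    rw [Finsupp.support_single _ one_ne_zero] at hb
    exact ⟨⟨v, hb⟩, rfl⟩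
  have hfin : FiniteDimensional k (Submodule.span k
      (Set.range fun v : {v : V // ¬ IsBdry K n {v}} => (X v.1 : MvPolynomial V k))) :=
    FiniteDimensional.span_of_finite k (Set.finite_range _)
  rw [Nat.card_eq_fintype_card]
  exact (Submodule.finrank_mono (Submodule.span_mono h)).trans (finrank_range_le_card _)

variable {K : Set (Finset V)} {a : Fin (d + 1) → Option V → k}

theorem DeletionData.mem_of_interior (h : DeletionData k d K) (ha : Gen a)
    (hfl : Flag Finset.univ (d + 1) (lf a)) {i j : ℕ} (hij : i + j = d + 1) {p : MvPolynomial V k}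
    (hp : p.IsHomogeneous j) (hdg : ∀ q ∈ interiorSpan k K (d + 1) i, dg K a (q * p) = 0) :
    p ∈ AI K (lf a) (d + 1) := by
  have := h.mem_of_dg ha hfl (d + 1) ∅ h.empty_mem (by simp) j p hp fun m hm hb => by
    rw [Finset.card_empty] at hm
    rw [Finset.empty_union] at hb
    have h0 : ind (∅ : Finset V) = 0 := by
      ext v
      rw [ind_apply, if_neg (Finset.notMem_empty v), Finsupp.zero_apply]
    rw [h0, zero_add]
    exact hdg _ (Submodule.subset_span ⟨m, ⟨by omega, hb⟩, rfl⟩)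
  rwa [st_empty] at this

theorem DeletionData.mem_of_degree_gt (h : DeletionData k d K) (ha : Gen a)
    (hfl : Flag Finset.univ (d + 1) (lf a)) {j : ℕ} (hj : d + 1 ≤ j) {p : MvPolynomial V k}
    (hp : p.IsHomogeneous j) : p ∈ AI K (lf a) (d + 1) := by
  rw [eq_sum_C_mul_monomial p]
  refine Ideal.sum_mem _ fun m hm => Ideal.mul_mem_left _ _ ?_
  have hmd := degree_eq_of_mem_support hp hm
  obtain ⟨J, hJ, hJd⟩ := exists_le_degree_eq m (d + 1) (by omega)
  rw [← tsub_add_cancel_of_le hJ, ← one_mul (1 : k), ← monomial_mul]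
  refine Ideal.mul_mem_left _ _ (h.mem_of_interior ha hfl (zero_add _)
    (isHomogeneous_monomial _ hJd) fun q hq => ?_)
  have : interiorSpan k K (d + 1) 0 = ⊥ := by
    rw [interiorSpan, Submodule.span_eq_bot]
    rintro _ ⟨m, ⟨hm, hb⟩, rfl⟩
    rw [(Finsupp.degree_eq_zero_iff m).1 hm, Finsupp.support_zero] at hb
    exact absurd h.isBdry_empty hb
  rw [this, Submodule.mem_bot] at hq
  rw [hq, zero_mul, map_zero]

theorem DeletionData.dg_mul_eq_zero_of_mem (h : DeletionData k d K) (ha : Gen a) {i j : ℕ}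
    (hij : i + j = d + 1) {q r : MvPolynomial V k} (hq : q ∈ interiorSpan k K (d + 1) i)
    (hr : r.IsHomogeneous j) (hrA : r ∈ AI K (lf a) (d + 1)) : dg K a (q * r) = 0 := by
  induction hq using Submodule.span_induction with
  | mem q hq =>
    obtain ⟨m, ⟨hm, hb⟩, rfl⟩ := hq
    refine h.dg_monomial_mul ha hb (d + 1) le_rfl j r (by omega) hr (AI_anti ?_ _ _ hrA)
    intro H hH
    exact h.lower Finset.subset_union_left hH
  | zero => rw [zero_mul, map_zero]
  | add p q _ _ hp hq => rw [add_mul, map_add, hp, hq, add_zero]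
  | smul c q _ hq => rw [smul_mul_assoc, map_smul, hq, smul_zero]

/-- The pairing of interior classes with all classes. -/
noncomputable def pairing (K : Set (Finset V)) (a : Fin (d + 1) → Option V → k) (i j : ℕ) :
    interiorSpan k K (d + 1) i →ₗ[k] homogeneousSubmodule V k j →ₗ[k] k :=
  ((LinearMap.mul k (MvPolynomial V k)).compr₂ (dg K a)).domRestrict₁₂ _ _

lemma pairing_apply (i j : ℕ) (x : interiorSpan k K (d + 1) i) (y : homogeneousSubmodule V k j) :
    pairing K a i j x y = dg K a (x.1 * y.1) := rfl

theorem DeletionData.hilb_le_finrank (h : DeletionData k d K) (ha : Gen a)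
    (hfl : Flag Finset.univ (d + 1) (lf a)) {i j : ℕ} (hij : i + j = d + 1)
    {Z : Type*} [AddCommGroup Z] [Module k Z] (g : interiorSpan k K (d + 1) i →ₗ[k] Z)
    (hg : ∀ x, g x = 0 → pairing K a i j x = 0) :
    hilb K a j ≤ finrank k (LinearMap.range g) := by
  have h1 := finrank_range_le_of_pairing (pairing K a i j)
    (quo K a ∘ₗ (homogeneousSubmodule V k j).subtype) g (fun y hy => ?_) hg
  · rwa [LinearMap.range_comp, Submodule.range_subtype] at h1
  · exact quo_eq_zero.2 (h.mem_of_interior ha hfl hij y.2 fun q hq => hy ⟨q, hq⟩)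

theorem DeletionData.hilb_le_card (h : DeletionData k d K) (ha : Gen a)
    (hfl : Flag Finset.univ (d + 1) (lf a)) :
    hilb K a d ≤ Nat.card {v : V // ¬ IsBdry K (d + 1) {v}} := by
  refine (h.hilb_le_finrank ha hfl (add_comm 1 d) LinearMap.id fun x hx => ?_).trans
    ((LinearMap.finrank_range_le _).trans (finrank_interiorSpan_one_le K (d + 1)))
  rw [show x = 0 from hx, map_zero]

theorem DeletionData.hilb_symm_le (h : DeletionData k d K) (ha : Gen a)
    (hfl : Flag Finset.univ (d + 1) (lf a)) {δ : Fin (d + 1) → V → Der k}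
    (hδ : ∀ s v t o, δ s v (a t o) = if t = s ∧ o = some v then 1 else 0)
    {i j : ℕ} (hij : i + j = d + 1) (hle : i ≤ j) : hilb K a j ≤ hilb K a i := by
  refine (h.hilb_le_finrank ha hfl hij (quo K a ∘ₗ (interiorSpan k K (d + 1) i).subtype)
    fun x hx => ?_).trans ?_
  · have hxA : x.1 ∈ AI K (lf a) (d + 1) := quo_eq_zero.1 hx
    have hxh : x.1.IsHomogeneous i := interiorSpan_le K (d + 1) i x.2
    have key : ∀ L : V →₀ ℕ, L.degree = j → dg K a (x.1 * monomial L 1) = 0 := fun L hL =>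
      ha.dg_eq_zero_of_sq K hδ x.1 L (j - i) (by omega) (by omega) fun J hJ =>
        h.dg_mul_eq_zero_of_mem ha hij x.2
          (by
            have := hxh.mul (isHomogeneous_monomial (1 : k) hJ)
            rwa [Nat.add_sub_cancel' hle] at this)
          (Ideal.mul_mem_right _ _ hxA)
    ext y
    rw [pairing_apply, eq_sum_C_mul_monomial y.1, Finset.mul_sum, map_sum]
    refine Finset.sum_eq_zero fun m hm => ?_
    rw [mul_left_comm, ← smul_eq_C_mul, map_smul, key m (degree_eq_of_mem_support y.2 hm),
      smul_zero]
  · rw [LinearMap.range_comp, Submodule.range_subtype]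
    exact Submodule.finrank_mono (Submodule.map_mono (interiorSpan_le K (d + 1) i))

theorem DeletionData.card_fct_add_le (h : DeletionData k d K) (ha : Gen a)
    (hfl : Flag Finset.univ (d + 1) (lf a)) {δ : Fin (d + 1) → V → Der k}
    (hδ : ∀ s v t o, δ s v (a t o) = if t = s ∧ o = some v then 1 else 0) {N : ℕ}
    (hN : Fintype.card V = N + (d + 1)) :
    (fct K (d + 1)).card + N + 1 ≤ (N + (d + 1) / 2).choose ((d + 1) / 2) +
      (N + d / 2).choose (d / 2) + Nat.card {v : V // ¬ IsBdry K (d + 1) {v}} := by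
  obtain ⟨G, hG, _⟩ := h.exists_facet h.empty_mem
  have hmc : ∀ j, hilb K a j ≤ N.multichoose j := fun j => by
    have := ha.hilb_le_multichoose (K := K) h.card_option hG.2 j
    rwa [hN, Nat.add_sub_cancel] at this
  have hmin : ∀ j ∈ Finset.range d, hilb K a j ≤ N.multichoose (min j (d + 1 - j)) := by
    intro j hj
    rw [Finset.mem_range] at hj
    rcases le_total j (d + 1 - j) with hle | hle
    · rw [min_eq_left hle]
      exact hmc j
    · rw [min_eq_right hle]
      exact (h.hilb_symm_le ha hfl hδ (by omega) hle).trans (hmc _)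
  have h1 := ha.card_fct_le h.lower (d + 1) fun j hj p hp => h.mem_of_degree_gt ha hfl hj hp
  have h2 := h.hilb_le_card ha hfl
  have h3 := Finset.sum_le_sum hmin
  have h4 := sum_multichoose_min N d
  have h5 := h.one_le
  rw [Finset.sum_range_succ] at h1 h4
  rw [show min d (d + 1 - d) = 1 by omega, Nat.multichoose_one_right] at h4
  omega

end Bound

section Realization

variable {V : Type*} [Fintype V] [DecidableEq V]

lemma mem_realiz_powerset {G : Finset V} {w : V → ℝ} :
    w ∈ realiz {σ | σ ⊆ G} ↔ (∀ v, 0 ≤ w v) ∧ ∑ v, w v = 1 ∧ ∀ v ∉ G, w v = 0 := by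
  refine and_congr_right fun _ => and_congr_right fun _ => ?_
  simp only [Set.mem_ofPred_eq, Finset.subset_iff, Finset.mem_filter, Finset.mem_univ, true_and]
  exact forall_congr' fun v => not_imp_comm

lemma isCompact_realiz {K : Set (Finset V)} (hK : IsLowerSet K) : IsCompact (realiz K) := by
  have h : realiz K = ⋃ G ∈ K, realiz {σ | σ ⊆ G} := by
    ext w
    simp only [Set.mem_iUnion, exists_prop]
    exact ⟨fun hw => ⟨_, hw.2.2, hw.1, hw.2.1, Finset.Subset.refl _⟩,
      fun ⟨G, hG, hw⟩ => ⟨hw.1, hw.2.1, hK hw.2.2 hG⟩⟩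
  rw [h]
  refine (Set.toFinite K).isCompact_biUnion fun G _ => ?_
  have h2 : realiz {σ | σ ⊆ G} = stdSimplex ℝ V ∩ ⋂ v, ⋂ (_ : v ∉ G), {w : V → ℝ | w v = 0} := by
    ext w
    rw [mem_realiz_powerset]
    simp only [stdSimplex, Set.mem_inter_iff, Set.mem_ofPred_eq, Set.mem_iInter, and_assoc]
  rw [h2]
  refine (isCompact_stdSimplex ℝ V).inter_right ?_
  exact isClosed_iInter fun v => isClosed_iInter fun _ =>
    isClosed_eq (continuous_apply v) continuous_const

end Realization

section Geometric

variable {E : Type*} [AddCommGroup E] [Module ℝ E] (K : Geometry.SimplicialComplex ℝ E)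

/-- The abstract complex of a geometric complex, with the empty face included. -/
def abstr : Set (Finset K.vertices) :=
  {G | G.Nonempty → G.map (Function.Embedding.subtype _) ∈ K.faces}

lemma isLowerSet_abstr : IsLowerSet (abstr K) := fun _ _ hle hG hne =>
  K.down_closed (hG (hne.mono hle)) (Finset.map_subset_map.2 hle) (hne.map)

lemma empty_mem_abstr : ∅ ∈ abstr K := fun h => absurd h Finset.not_nonempty_empty

variable {K} in
lemma exists_map_eq {s : Finset E} (hs : s ∈ K.faces) :
    ∃ G ∈ abstr K, G.map (Function.Embedding.subtype _) = s := by
  classical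
  have h : (s.subtype (· ∈ K.vertices)).map (Function.Embedding.subtype _) = s := by
    refine Finset.subtype_map_of_mem fun y hy => ?_
    exact K.down_closed hs (Finset.singleton_subset_iff.2 hy) (Finset.singleton_nonempty y)
  exact ⟨_, fun _ => by rwa [h], h⟩

variable [Fintype K.vertices] [DecidableEq K.vertices]

/-- The point with given barycentric coordinates. -/
def bary (w : K.vertices → ℝ) : E := ∑ v, w v • (v : E)

lemma mem_convexHull_map {G : Finset K.vertices} {x : E} :
    x ∈ convexHull ℝ (G.map (Function.Embedding.subtype _) : Set E) ↔
      ∃ w ∈ realiz {σ | σ ⊆ G}, bary K w = x := by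
  constructor
  · intro hx
    obtain ⟨w, h0, h1, hx⟩ := Finset.mem_convexHull'.1 hx
    rw [Finset.sum_map] at h1 hx
    refine ⟨fun v => if v ∈ G then w v else 0, mem_realiz_powerset.2 ⟨fun v => ?_, ?_, ?_⟩, ?_⟩
    · split_ifs with hv
      · exact h0 _ (Finset.mem_map_of_mem _ hv)
      · exact le_rfl
    · rw [← h1, Finset.sum_ite_mem, Finset.univ_inter]
      rfl
    · intro v hv
      exact if_neg hv
    · rw [← hx, bary]
      simp only [ite_smul, zero_smul]
      rw [Finset.sum_ite_mem, Finset.univ_inter]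
      rfl
  · rintro ⟨w, hw, rfl⟩
    obtain ⟨h0, h1, h2⟩ := mem_realiz_powerset.1 hw
    rw [bary, ← Finset.sum_subset (Finset.subset_univ G) fun v _ hv => by rw [h2 v hv, zero_smul]]
    refine (convex_convexHull ℝ _).sum_mem (fun v _ => h0 v) ?_ fun v hv =>
      subset_convexHull ℝ _ (Finset.mem_coe.2 (Finset.mem_map_of_mem _ hv))
    rw [← h1]
    exact Finset.sum_subset (Finset.subset_univ G) fun v _ hv => h2 v hv

lemma bary_injOn_powerset {G : Finset K.vertices} (hG : G ∈ abstr K) :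
    Set.InjOn (bary K) (realiz {σ | σ ⊆ G}) := by
  intro w hw w' hw' h
  obtain ⟨_, h1, h2⟩ := mem_realiz_powerset.1 hw
  obtain ⟨_, h1', h2'⟩ := mem_realiz_powerset.1 hw'
  have hne : G.Nonempty := by
    by_contra hne
    rw [Finset.not_nonempty_iff_eq_empty] at hne
    rw [Finset.sum_eq_zero fun v _ => h2 v (by simp [hne])] at h1
    exact zero_ne_one h1
  have hind := (K.indep (hG hne)).comp_embedding
    (⟨fun v : G => ⟨v.1.1, Finset.mem_map_of_mem (Function.Embedding.subtype _) v.2⟩, fun v v' hv =>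
      Subtype.ext (Subtype.ext (Subtype.mk.inj hv))⟩ : G ↪ _)
  have key := hind.eq_zero_of_sum_eq_zero (s := Finset.univ) (w := fun v : G => w v - w' v) ?_ ?_
  · ext v
    by_cases hv : v ∈ G
    · exact sub_eq_zero.1 (key ⟨v, hv⟩ (Finset.mem_univ _))
    · rw [h2 v hv, h2' v hv]
  · rw [Finset.sum_coe_sort G (fun v => w v - w' v), Finset.sum_subset (Finset.subset_univ G)
      fun v _ hv => by rw [h2 v hv, h2' v hv, sub_zero], Finset.sum_sub_distrib, h1, h1', sub_self]
  · rw [← sub_eq_zero] at h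
    rw [← h, bary, bary, ← Finset.sum_sub_distrib]
    refine (Finset.sum_coe_sort G (fun v => (w v - w' v) • (v : E))).trans ?_
    rw [Finset.sum_subset (Finset.subset_univ G)
      fun v _ hv => by rw [h2 v hv, h2' v hv, sub_zero, zero_smul]]
    exact Finset.sum_congr rfl fun v _ => sub_smul _ _ _

lemma filter_nonempty_of_sum {w : K.vertices → ℝ} (h : ∑ v, w v = 1) :
    (Finset.univ.filter fun v => w v ≠ 0).Nonempty := by
  obtain ⟨v, hv, h0⟩ := Finset.exists_ne_zero_of_sum_ne_zero (h.trans_ne one_ne_zero)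
  exact ⟨v, Finset.mem_filter.2 ⟨hv, h0⟩⟩

lemma bary_bijOn : Set.BijOn (bary K) (realiz (abstr K)) K.space := by
  classical
  refine ⟨?_, ?_, ?_⟩
  · intro w hw
    exact Geometry.SimplicialComplex.mem_space_iff.2 ⟨_, hw.2.2 (filter_nonempty_of_sum K hw.2.1),
      (mem_convexHull_map K).2 ⟨w, ⟨hw.1, hw.2.1, Finset.Subset.refl _⟩, rfl⟩⟩
  · intro w hw w' hw' h
    have h1 := (mem_convexHull_map K).2 ⟨w, ⟨hw.1, hw.2.1, Finset.Subset.refl _⟩, rfl⟩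
    have h2 := (mem_convexHull_map K).2 ⟨w', ⟨hw'.1, hw'.2.1, Finset.Subset.refl _⟩, rfl⟩
    rw [← h] at h2
    have h3 := K.inter_subset_convexHull (hw.2.2 (filter_nonempty_of_sum K hw.2.1))
      (hw'.2.2 (filter_nonempty_of_sum K hw'.2.1)) ⟨h1, h2⟩
    rw [← Finset.coe_inter, ← Finset.map_inter, mem_convexHull_map] at h3
    obtain ⟨u, hu, hux⟩ := h3
    rw [bary_injOn_powerset K hw.2.2 ⟨hw.1, hw.2.1, Finset.Subset.refl _⟩
      ⟨hu.1, hu.2.1, hu.2.2.trans Finset.inter_subset_left⟩ hux.symm]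
    exact bary_injOn_powerset K hw'.2.2 ⟨hu.1, hu.2.1, hu.2.2.trans Finset.inter_subset_right⟩
      ⟨hw'.1, hw'.2.1, Finset.Subset.refl _⟩ (hux.trans h)
  · intro x hx
    obtain ⟨s, hs, hxs⟩ := Geometry.SimplicialComplex.mem_space_iff.1 hx
    obtain ⟨G, hG, rfl⟩ := exists_map_eq hs
    obtain ⟨w, hw, rfl⟩ := (mem_convexHull_map K).1 hxs
    exact ⟨w, ⟨hw.1, hw.2.1, isLowerSet_abstr K hw.2.2 hG⟩, rfl⟩

/-- The underlying space is the geometric realization of the abstract complex. -/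
noncomputable def realizHomeo [TopologicalSpace E] [IsTopologicalAddGroup E]
    [ContinuousSMul ℝ E] [T2Space E] : realiz (abstr K) ≃ₜ K.space :=
  have : CompactSpace (realiz (abstr K)) :=
    isCompact_iff_compactSpace.1 (isCompact_realiz (isLowerSet_abstr K))
  Continuous.homeoOfEquivCompactToT2 (f := (bary_bijOn K).equiv _) (by
    refine Continuous.subtype_mk (?_ : Continuous fun w : realiz (abstr K) => bary K w.1) _
    exact continuous_finsetSum _ fun v _ =>
      ((continuous_apply v).comp continuous_subtype_val).smul continuous_const)

end Geometric

lemma DeletionData.of_homeomorph (k : Type*) [Field k] [CharP k 2] {V : Type*} [Fintype V]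
    [DecidableEq V] {d : ℕ} (hd : 1 ≤ d) {K : Set (Finset V)} (hK : IsLowerSet K) (hne : ∅ ∈ K)
    (hcard : ∀ G ∈ K, G.card ≤ d + 1)
    (Hm : realiz K ≃ₜ Metric.closedBall (0 : EuclideanSpace ℝ (Fin d)) 1) :
    DeletionData k d K where
  one_le := hd
  lower := hK
  empty_mem := hne
  card_le := hcard
  acyclic j := by
    have h : ast K ∅ = K := by
      ext G
      simp [ast]
    have := (ast_homology (k := k) hd hK Hm ∅ hne).1 j fun h => absurd h Finset.not_nonempty_empty
    rwa [h] at this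
  low F hF hFne j hj := (ast_homology (k := k) hd hK Hm F hF).1 j fun _ => hj
  top F hF hFne := (ast_homology (k := k) hd hK Hm F hF).2 hFne

end UBT

/-- **Upper Bound Theorem for the facets of simplicial balls.** If `K` is a finite
geometric simplicial complex of dimension at most `d` in `ℝ^m` whose underlying space is
homeomorphic to the closed unit ball of `ℝ^d`, with `b` vertices, `b'` of which lie in
some boundary ridge, then the number of facets (faces with `d+1` vertices) of `K` is at
most `f_{d}(CycP_{d+1}(b)) - (b' - d)`, where the number of facets of the cyclic
`(d+1)`-polytope with `b` vertices is
`C(b - ⌈(d+1)/2⌉, ⌊(d+1)/2⌋) + C(b - 1 - ⌈d/2⌉, ⌊d/2⌋)`. -/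
theorem upper_bound_facets_simplicial_ball
    (d m : ℕ) (hd : 1 ≤ d)
    (K : Geometry.SimplicialComplex ℝ (Fin m → ℝ))
    (hfin : K.faces.Finite)
    (hdim : ∀ s ∈ K.faces, s.card ≤ d + 1)
    (hball : Nonempty (↥K.space ≃ₜ
      ↥(Metric.closedBall (0 : EuclideanSpace ℝ (Fin d)) 1)))
    (b b' : ℕ)
    (hb : Nat.card ↥K.vertices = b)
    (hb' : Nat.card {v : Fin m → ℝ // v ∈ K.vertices ∧
        ∃ s ∈ K.faces, s.card = d ∧
          (∃! t, t ∈ K.faces ∧ t.card = d + 1 ∧ s ⊆ t) ∧ v ∈ s} = b') :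
    (Nat.card {s : Finset (Fin m → ℝ) // s ∈ K.faces ∧ s.card = d + 1} : ℤ) ≤
      (((b - (d + 2) / 2).choose ((d + 1) / 2)
          + (b - 1 - (d + 1) / 2).choose (d / 2) : ℕ) : ℤ)
        - ((b' : ℤ) - (d : ℤ)) := by
  classical
  obtain ⟨Hm⟩ := hball
  have hV : Finite K.vertices := by
    have := hfin.to_subtype
    exact Finite.of_injective (fun v : K.vertices => (⟨{v.1}, v.2⟩ : K.faces)) fun v w h =>
      Subtype.ext (Finset.singleton_injective (Subtype.ext_iff.1 h))
  have := Fintype.ofFinite K.vertices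
  obtain ⟨k, _, _, a, δ, ha, hfl, hδ⟩ := UBT.exists_generic K.vertices (d + 1)
  have h : UBT.DeletionData k d (UBT.abstr K) :=
    .of_homeomorph k hd (UBT.isLowerSet_abstr K) (UBT.empty_mem_abstr K) (fun G hG => by
      rcases G.eq_empty_or_nonempty with rfl | hne
      · exact Nat.zero_le _
      · simpa using hdim _ (hG hne)) ((UBT.realizHomeo K).trans Hm)
  have hfacet : ∀ G, UBT.IsFacet (UBT.abstr K) (d + 1) G ↔
      G.map (Function.Embedding.subtype _) ∈ K.faces ∧
        (G.map (Function.Embedding.subtype _)).card = d + 1 := fun G => by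
    rw [UBT.IsFacet, Finset.card_map]
    refine and_congr_left fun hc => ⟨fun hG => hG (Finset.card_pos.1 (by omega)), fun hG _ => hG⟩
  obtain ⟨G₀, hG₀, _⟩ := h.exists_facet h.empty_mem
  have hb2 : Fintype.card K.vertices = b := by rw [← hb, Nat.card_eq_fintype_card]
  have hle : d + 1 ≤ b := by
    rw [← hb2, ← hG₀.2]
    exact Finset.card_le_univ G₀
  obtain ⟨N, rfl⟩ := Nat.exists_eq_add_of_le' hle
  have hmain := h.card_fct_add_le ha hfl hδ hb2
  have hf : Nat.card {s : Finset (Fin m → ℝ) // s ∈ K.faces ∧ s.card = d + 1} ≤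
      (UBT.fct (UBT.abstr K) (d + 1)).card := by
    rw [← Nat.card_eq_finsetCard]
    refine Nat.card_le_card_of_surjective (fun G => ⟨G.1.map (Function.Embedding.subtype _),
      (hfacet G.1).1 (UBT.mem_fct.1 G.2)⟩) ?_
    rintro ⟨s, hs, hsc⟩
    obtain ⟨G, hG, rfl⟩ := UBT.exists_map_eq hs
    exact ⟨⟨G, UBT.mem_fct.2 ((hfacet G).2 ⟨hs, hsc⟩)⟩, rfl⟩
  have hbd : b' ≤ Nat.card {v : K.vertices // UBT.IsBdry (UBT.abstr K) (d + 1) {v}} := by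
    rw [← hb']
    have key : ∀ (v : Fin m → ℝ) (hv : v ∈ K.vertices), (∃ s ∈ K.faces, s.card = d ∧
        (∃! t, t ∈ K.faces ∧ t.card = d + 1 ∧ s ⊆ t) ∧ v ∈ s) →
        UBT.IsBdry (UBT.abstr K) (d + 1) {⟨v, hv⟩} := by
      rintro v hv ⟨s, hs, hsd, ⟨t, ⟨ht, htd, hst⟩, huniq⟩, hvs⟩
      obtain ⟨S, hS, rfl⟩ := UBT.exists_map_eq hs
      obtain ⟨T, hT, rfl⟩ := UBT.exists_map_eq ht
      refine ⟨S, ?_, hS, by rw [← hsd, Finset.card_map], T,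
        ⟨(hfacet T).2 ⟨ht, htd⟩, Finset.map_subset_map.1 hst⟩, fun T' hT' => ?_⟩
      · rw [Finset.singleton_subset_iff]
        exact (Finset.mem_map' (Function.Embedding.subtype _)).1 hvs
      · have h1 := (hfacet T').1 hT'.1
        exact Finset.map_injective _ (huniq _ ⟨h1.1, h1.2, Finset.map_subset_map.2 hT'.2⟩)
    exact Nat.card_le_card_of_injective (fun v => ⟨⟨v.1, v.2.1⟩, key v.1 v.2.1 v.2.2⟩)
      fun v w hvw => Subtype.ext (Subtype.mk.inj (Subtype.mk.inj hvw))
  have hsum : Nat.card {v : K.vertices // UBT.IsBdry (UBT.abstr K) (d + 1) {v}} +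
      Nat.card {v : K.vertices // ¬ UBT.IsBdry (UBT.abstr K) (d + 1) {v}} = N + (d + 1) := by
    rw [← hb, ← Nat.card_sum]
    exact Nat.card_congr (Equiv.sumCompl _)
  rw [show N + (d + 1) - (d + 2) / 2 = N + (d + 1) / 2 by omega,
    show N + (d + 1) - 1 - (d + 1) / 2 = N + d / 2 by omega]
  omega
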